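/- arXiv:2108.07334 — 2 statements merged into one kernel-verified Lean document; each statement's English description precedes it below -/
import Mathlib

section
/- There exist absolute constants K and n₀ such that for every even n ≥ n₀ and every multiset A = {a₁, …, a_n} of pairwise distinct real numbers, ρ*(A) ≤ K · n^{−3/2}. -/
/-- `ρ*(A)`: the largest concentration probability of `∑ i, A i * x i` where `(x i)` is a
uniform 0-1 tuple with exactly `n/2` zero entries. -/
noncomputable def rhoStar (n : ℕ) (A : Fin n → ℝ) : ℝ :=
  ⨆ a : ℝ, ({s : Finset (Fin n) | s.card = n / 2 ∧ ∑ i ∈ s, A i = a}.ncard : ℝ) /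
    (n.choose (n / 2) : ℝ)

open Finset
open scoped Pointwise

lemma exp_neg_le_inv {y : ℝ} (hy : 0 < y) : Real.exp (-y) ≤ 1 / y := by
  rw [Real.exp_neg, ← one_div]
  exact one_div_le_one_div_of_le hy (by linarith [Real.add_one_le_exp y])

/-- A discretised layer-cake bound for `exp (-x / 4)` over the levels `4 ^ j`, `j ≤ L`. -/
lemma exp_neg_quarter_le_sum_levels (x : ℝ) (hx : 0 ≤ x) (L : ℕ) :
    Real.exp (-(x / 4)) ≤
      ∑ j ∈ range (L + 1), 16 / 4 ^ j * (if x ≤ 4 ^ j then 1 else 0) +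
        Real.exp (-(4 ^ L / 4)) := by
  induction L with
  | zero =>
    by_cases h : x ≤ 1
    · have : Real.exp (-(x / 4)) ≤ 1 := Real.exp_le_one_iff.2 (by linarith)
      have := Real.exp_pos (-((4 : ℝ) ^ 0 / 4))
      simp only [zero_add, range_one, sum_singleton, pow_zero, h, if_true] at this ⊢
      linarith
    · simp only [zero_add, range_one, sum_singleton, pow_zero, h]
      simp
      linarith
  | succ L ih =>
    rw [sum_range_succ]
    have hpos : (0 : ℝ) < 4 ^ L := by positivity
    by_cases h : x ≤ 4 ^ (L + 1)
    · have h1 : Real.exp (-(4 ^ L / 4)) ≤ 16 / (4 : ℝ) ^ (L + 1) := by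
        refine (exp_neg_le_inv (by positivity)).trans (le_of_eq ?_)
        field_simp
        ring
      have := Real.exp_pos (-((4 : ℝ) ^ (L + 1) / 4))
      rw [if_pos h]
      linarith
    · have h0 : 0 ≤ ∑ j ∈ range (L + 1), 16 / 4 ^ j * (if x ≤ 4 ^ j then (1 : ℝ) else 0) :=
        sum_nonneg fun j _ => by positivity
      have h2 : Real.exp (-(x / 4)) ≤ Real.exp (-(4 ^ (L + 1) / 4)) :=
        Real.exp_le_exp.2 (by linarith)
      rw [if_neg h]
      linarith

/-- Sublevel sets of a function satisfying a parallelogram-type inequality on `ZMod p` at least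
double when the level is multiplied by four. -/
lemma two_mul_card_sublevel_le {p : ℕ} (hp : p.Prime) [NeZero p] {g : ZMod p → ℝ}
    (h0 : g 0 = 0) (hadd : ∀ x y, g (x + y) ≤ 2 * (g x + g y)) {s : ℝ} (hs : 0 ≤ s)
    (hlt : #{t | g t ≤ 4 * s} < p) :
    2 * #{t | g t ≤ s} ≤ #{t | g t ≤ 4 * s} + 1 := by
  classical
  have hne : (univ.filter fun t => g t ≤ s).Nonempty := ⟨0, by simp [h0, hs]⟩
  have hcd := ZMod.cauchy_davenport hp hne hne
  have hsub : (univ.filter fun t => g t ≤ s) + (univ.filter fun t => g t ≤ s) ⊆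
      univ.filter fun t => g t ≤ 4 * s := by
    intro z hz
    obtain ⟨x, hx, y, hy, rfl⟩ := mem_add.1 hz
    simp only [mem_filter, mem_univ, true_and] at hx hy ⊢
    linarith [hadd x y]
  have := card_le_card hsub
  omega

lemma card_sublevel_four_pow_le {p : ℕ} (hp : p.Prime) [NeZero p] {g : ZMod p → ℝ}
    (h0 : g 0 = 0) (hadd : ∀ x y, g (x + y) ≤ 2 * (g x + g y)) (k : ℕ) :
    ∀ j : ℕ, #{t | g t ≤ 4 ^ (j + k)} < p →
      (#{t | g t ≤ 4 ^ j} : ℝ) ≤ 1 + #{t | g t ≤ 4 ^ (j + k)} / 2 ^ k := by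
  induction k with
  | zero => intro j _; simp
  | succ k ih =>
    intro j hlt
    rw [show j + (k + 1) = j + 1 + k by ring] at hlt ⊢
    have h1 := ih (j + 1) hlt
    have hle : #{t | g t ≤ 4 ^ (j + 1)} ≤ #{t | g t ≤ 4 ^ (j + 1 + k)} :=
      card_le_card <| monotone_filter_right _ fun t _ ht =>
        ht.trans (pow_le_pow_right₀ (by norm_num) (by omega))
    have h2 := two_mul_card_sublevel_le hp h0 hadd (s := 4 ^ j) (by positivity)
      (by rw [← pow_succ']; omega)
    rw [← pow_succ'] at h2
    have h3 : (2 : ℝ) * #{t | g t ≤ 4 ^ j} ≤ #{t | g t ≤ 4 ^ (j + 1)} + 1 := by exact_mod_cast h2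
    rw [pow_succ, ← div_div]
    linarith

lemma sum_exp_neg_le {p : ℕ} (hp : p.Prime) [NeZero p] {g : ZMod p → ℝ}
    (h0 : g 0 = 0) (hnn : ∀ t, 0 ≤ g t) (hadd : ∀ x y, g (x + y) ≤ 2 * (g x + g y)) (L : ℕ)
    (hlt : #{t | g t ≤ 4 ^ L} < p) :
    ∑ t, Real.exp (-(g t / 4)) ≤
      32 + 32 / 2 ^ L * #{t | g t ≤ 4 ^ L} + 32 / (4 ^ L) ^ 2 * p := by
  obtain ⟨N, hN⟩ : ∃ N : ℝ, (#{t | g t ≤ 4 ^ L} : ℝ) = N := ⟨_, rfl⟩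
  have hN0 : 0 ≤ N := hN ▸ Nat.cast_nonneg _
  rw [hN]
  have hlev : ∀ j ∈ range (L + 1),
      ∑ t, (16 : ℝ) / 4 ^ j * (if g t ≤ 4 ^ j then 1 else 0) ≤
        16 * (1 / 2) ^ j + 16 / 2 ^ L * N * (1 / 2) ^ j := by
    intro j hj
    obtain ⟨k, rfl⟩ := Nat.exists_eq_add_of_le (Nat.lt_succ_iff.1 (mem_range.1 hj))
    rw [← mul_sum, sum_boole]
    have h1 := card_sublevel_four_pow_le hp h0 hadd k j hlt
    rw [hN] at h1
    have h4 : (4 : ℝ) ^ j = 2 ^ j * 2 ^ j := by rw [← mul_pow]; norm_num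
    have h2j : (1 : ℝ) ≤ 2 ^ j := one_le_pow₀ (by norm_num)
    calc (16 : ℝ) / 4 ^ j * #{t | g t ≤ 4 ^ j}
        ≤ 16 / 4 ^ j * (1 + N / 2 ^ k) := by gcongr
      _ = 16 * (1 / 2) ^ j * (1 / 2 ^ j) + 16 / 2 ^ (j + k) * N * (1 / 2) ^ j := by
          rw [h4, pow_add, div_pow, one_pow]; field_simp
      _ ≤ _ := by
          have : 16 * (1 / 2 : ℝ) ^ j * (1 / 2 ^ j) ≤ 16 * (1 / 2) ^ j :=
            mul_le_of_le_one_right (by positivity) ((div_le_one (by positivity)).2 h2j)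
          linarith
  have hgeom : ∑ j ∈ range (L + 1), (1 / 2 : ℝ) ^ j ≤ 2 := sum_geometric_two_le _
  have hexp : Real.exp (-((4 : ℝ) ^ L / 4)) ≤ 32 / (4 ^ L) ^ 2 := by
    have hy : (0 : ℝ) < 4 ^ L / 4 := by positivity
    have := Real.quadratic_le_exp_of_nonneg hy.le
    rw [Real.exp_neg, ← one_div]
    refine (one_div_le_one_div_of_le (b := Real.exp (4 ^ L / 4)) (a := (4 ^ L / 4) ^ 2 / 2)
      (by positivity) (by linarith)).trans (le_of_eq ?_)
    field_simp
    norm_num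
  calc ∑ t, Real.exp (-(g t / 4))
      ≤ ∑ t : ZMod p, (∑ j ∈ range (L + 1), 16 / 4 ^ j * (if g t ≤ 4 ^ j then (1 : ℝ) else 0) +
          Real.exp (-(4 ^ L / 4))) :=
        sum_le_sum fun t _ => exp_neg_quarter_le_sum_levels _ (hnn t) L
    _ = ∑ j ∈ range (L + 1), ∑ t : ZMod p, 16 / 4 ^ j * (if g t ≤ 4 ^ j then (1 : ℝ) else 0) +
          p * Real.exp (-(4 ^ L / 4)) := by
        rw [sum_add_distrib, sum_comm]; simp [ZMod.card]
    _ ≤ ∑ j ∈ range (L + 1), (16 * (1 / 2) ^ j + 16 / 2 ^ L * N * (1 / 2) ^ j) +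
          p * (32 / (4 ^ L) ^ 2) := by gcongr with j hj; exact hlev j hj
    _ = (16 + 16 / 2 ^ L * N) * ∑ j ∈ range (L + 1), (1 / 2 : ℝ) ^ j +
          32 / (4 ^ L) ^ 2 * p := by
        rw [mul_sum, mul_comm (p : ℝ)]; simp_rw [add_mul]
    _ ≤ (16 + 16 / 2 ^ L * N) * 2 + 32 / (4 ^ L) ^ 2 * p := by gcongr
    _ = _ := by ring

/-- The number of coincidences `d i = ± d j`. -/
def signedCoincidences {p m : ℕ} (d : Fin m → ZMod p) : ℕ :=
  #{q : Fin m × Fin m | d q.1 = d q.2} + #{q : Fin m × Fin m | d q.1 = -d q.2}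

/-- The exponent `∑ i, (1 - cos (2 π t dᵢ / p))` controlling the characteristic function. -/
noncomputable def cosDefect {p m : ℕ} [NeZero p] (d : Fin m → ZMod p) (t : ZMod p) : ℝ :=
  ∑ i, (1 - (ZMod.stdAddChar (t * d i)).re)

lemma addChar_sum_eq_prod {G R ι : Type*} [AddCommMonoid G] [CommMonoid R] (ψ : AddChar G R)
    (s : Finset ι) (f : ι → G) : ψ (∑ i ∈ s, f i) = ∏ i ∈ s, ψ (f i) :=
  map_prod ψ.toMonoidHom (fun i => Multiplicative.ofAdd (f i)) s

section
variable {p m : ℕ} [NeZero p]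

lemma norm_stdAddChar (x : ZMod p) : ‖ZMod.stdAddChar x‖ = 1 := AddChar.norm_apply _ _

lemma re_sq_add_im_sq_stdAddChar (x : ZMod p) :
    (ZMod.stdAddChar x).re ^ 2 + (ZMod.stdAddChar x).im ^ 2 = 1 := by
  have := Complex.sq_norm (ZMod.stdAddChar x)
  rw [norm_stdAddChar, Complex.normSq_apply] at this
  linarith

lemma re_stdAddChar_le_one (x : ZMod p) : (ZMod.stdAddChar x).re ≤ 1 :=
  (Complex.re_le_norm _).trans (norm_stdAddChar x).le

lemma sum_re_stdAddChar (b : ZMod p) :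
    ∑ t, (ZMod.stdAddChar (t * b)).re = if b = 0 then (p : ℝ) else 0 := by
  rw [← Complex.re_sum, AddChar.sum_mulShift _ (ZMod.isPrimitive_stdAddChar p), ZMod.card]
  split_ifs <;> simp

lemma cosDefect_zero (d : Fin m → ZMod p) : cosDefect d 0 = 0 := by
  simp [cosDefect]

lemma cosDefect_nonneg (d : Fin m → ZMod p) (t : ZMod p) : 0 ≤ cosDefect d t :=
  sum_nonneg fun i _ => by linarith [re_stdAddChar_le_one (t * d i)]

lemma cosDefect_add_le (d : Fin m → ZMod p) (x y : ZMod p) :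
    cosDefect d (x + y) ≤ 2 * (cosDefect d x + cosDefect d y) := by
  unfold cosDefect
  rw [← sum_add_distrib, mul_sum]
  refine sum_le_sum fun i _ => ?_
  rw [add_mul, AddChar.map_add_eq_mul, Complex.mul_re]
  have hz := re_sq_add_im_sq_stdAddChar (x * d i)
  have hw := re_sq_add_im_sq_stdAddChar (y * d i)
  set z : ℂ := ZMod.stdAddChar (x * d i)
  set w : ℂ := ZMod.stdAddChar (y * d i)
  nlinarith [sq_nonneg (z.im - w.im), sq_nonneg (z.re + w.re - 2)]

lemma sum_cosDefect {d : Fin m → ZMod p} (hd : ∀ i, d i ≠ 0) :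
    ∑ t, cosDefect d t = p * m := by
  unfold cosDefect
  rw [sum_comm]
  simp_rw [sum_sub_distrib, sum_re_stdAddChar, if_neg (hd _)]
  simp [ZMod.card, mul_comm]

lemma card_cosDefect_le_lt {d : Fin m → ZMod p} (hd : ∀ i, d i ≠ 0) {s : ℝ} (hs : s < m) :
    #{t | cosDefect d t ≤ s} < p := by
  refine (card_le_univ _).trans_eq (ZMod.card p) |>.lt_of_ne fun heq => ?_
  have hall : ∀ t, cosDefect d t ≤ s := by
    have := (card_eq_iff_eq_univ _).1 (heq.trans (ZMod.card p).symm)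
    simpa [filter_eq_self] using this
  have h1 := sum_le_sum fun t (_ : t ∈ univ) => hall t
  rw [sum_cosDefect hd, sum_const, card_univ, ZMod.card, nsmul_eq_mul] at h1
  have hp : (0 : ℝ) < p := Nat.cast_pos.2 (NeZero.pos p)
  nlinarith

lemma sum_sq_re_stdAddChar (d : Fin m → ZMod p) :
    ∑ t, (∑ i, (ZMod.stdAddChar (t * d i)).re) ^ 2 = p * signedCoincidences d / 2 := by
  have hprod : ∀ t i j, (ZMod.stdAddChar (t * d i)).re * (ZMod.stdAddChar (t * d j)).re =
      ((ZMod.stdAddChar (t * (d i - d j))).re + (ZMod.stdAddChar (t * (d i + d j))).re) / 2 := by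
    intro t i j
    rw [mul_sub, mul_add, sub_eq_add_neg, AddChar.map_add_eq_mul, AddChar.map_add_eq_mul,
      AddChar.map_neg_eq_conj, Complex.mul_re, Complex.mul_re, Complex.conj_re, Complex.conj_im]
    ring
  simp_rw [sq, sum_mul_sum, hprod]
  rw [sum_comm]
  simp_rw [sum_comm (s := (univ : Finset (ZMod p)))]
  simp_rw [← sum_div, sum_add_distrib, sum_re_stdAddChar]
  simp only [signedCoincidences, Nat.cast_add, card_filter, Nat.cast_sum,
    Fintype.sum_prod_type, sub_eq_zero, add_eq_zero_iff_eq_neg, mul_add, mul_sum]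
  simp

lemma card_cosDefect_le_mul_sq_le (d : Fin m → ZMod p) {s : ℝ} (hs : s ≤ m / 2) :
    #{t | cosDefect d t ≤ s} * (m : ℝ) ^ 2 ≤ 2 * p * signedCoincidences d := by
  have h : ∀ t ∈ univ.filter (fun t => cosDefect d t ≤ s),
      (m : ℝ) ^ 2 / 4 ≤ (∑ i, (ZMod.stdAddChar (t * d i)).re) ^ 2 := by
    intro t ht
    have ht : cosDefect d t ≤ s := (mem_filter.1 ht).2
    unfold cosDefect at ht
    rw [sum_sub_distrib] at ht
    simp at ht
    have hm : (0 : ℝ) ≤ m := by positivity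
    nlinarith
  have h1 := card_nsmul_le_sum _ _ _ h
  have h2 : ∑ t ∈ univ.filter (fun t => cosDefect d t ≤ s),
      (∑ i, (ZMod.stdAddChar (t * d i)).re) ^ 2 ≤ p * signedCoincidences d / 2 := by
    rw [← sum_sq_re_stdAddChar]
    exact sum_le_univ_sum_of_nonneg fun t => sq_nonneg _
  rw [nsmul_eq_mul] at h1
  linarith

/-- Fourier bound for the number of choices, one element from each pair, with prescribed sum. -/
lemma card_choices_mul_le (A : Fin m → Bool → ZMod p) (a : ZMod p) :
    #{ε : Fin m → Bool | ∑ i, A i (ε i) = a} * (p : ℝ) ≤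
      2 ^ m * ∑ t, Real.exp (-(cosDefect (fun i => A i false - A i true) t / 4)) := by
  have hcount : (#{ε : Fin m → Bool | ∑ i, A i (ε i) = a} * p : ℂ) =
      ∑ t, ZMod.stdAddChar (-(t * a)) * ∏ i, ∑ b : Bool, ZMod.stdAddChar (t * A i b) := by
    have h1 : ∀ t : ZMod p, ZMod.stdAddChar (-(t * a)) *
        ∏ i, ∑ b : Bool, ZMod.stdAddChar (t * A i b) =
        ∑ ε : Fin m → Bool, (ZMod.stdAddChar (t * (∑ i, A i (ε i) - a)) : ℂ) := by
      intro t
      rw [prod_univ_sum, Fintype.piFinset_univ, mul_sum]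
      refine sum_congr rfl fun ε _ => ?_
      rw [mul_sub, sub_eq_add_neg, AddChar.map_add_eq_mul, mul_sum, addChar_sum_eq_prod, mul_comm]
    simp_rw [h1]
    rw [sum_comm]
    simp_rw [AddChar.sum_mulShift _ (ZMod.isPrimitive_stdAddChar p), ZMod.card, sub_eq_zero]
    rw [card_filter, Nat.cast_sum, sum_mul]
    refine sum_congr rfl fun ε _ => ?_
    split_ifs <;> simp
  have hfac : ∀ t i, ‖∑ b : Bool, (ZMod.stdAddChar (t * A i b) : ℂ)‖ ≤
      2 * Real.exp (-((1 - (ZMod.stdAddChar (t * (A i false - A i true)) : ℂ).re) / 4)) := by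
    intro t i
    have hz := re_sq_add_im_sq_stdAddChar (t * A i false)
    have hw := re_sq_add_im_sq_stdAddChar (t * A i true)
    rw [mul_sub t, sub_eq_add_neg (t * _), AddChar.map_add_eq_mul, AddChar.map_neg_eq_conj,
      Complex.mul_re, Complex.conj_re, Complex.conj_im, Fintype.sum_bool]
    set z : ℂ := ZMod.stdAddChar (t * A i false)
    set w : ℂ := ZMod.stdAddChar (t * A i true)
    refine le_of_sq_le_sq ?_ (by positivity)
    rw [Complex.sq_norm, Complex.normSq_apply, mul_pow, ← Real.exp_nat_mul, Complex.add_re,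
      Complex.add_im]
    have := Real.add_one_le_exp (((2 : ℕ) : ℝ) * -((1 - (z.re * w.re - z.im * -w.im)) / 4))
    push_cast at this ⊢
    nlinarith
  calc #{ε : Fin m → Bool | ∑ i, A i (ε i) = a} * (p : ℝ)
      = ‖(#{ε : Fin m → Bool | ∑ i, A i (ε i) = a} * p : ℂ)‖ := by simp
    _ ≤ ∑ t, ‖ZMod.stdAddChar (-(t * a)) * ∏ i, ∑ b : Bool, ZMod.stdAddChar (t * A i b)‖ := by
        rw [hcount]; exact norm_sum_le _ _
    _ ≤ ∑ t, ∏ i : Fin m, 2 * Real.exp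
          (-((1 - (ZMod.stdAddChar (t * (A i false - A i true)) : ℂ).re) / 4)) := by
        refine sum_le_sum fun t _ => ?_
        rw [norm_mul, norm_stdAddChar, one_mul, norm_prod]
        exact prod_le_prod (fun _ _ => norm_nonneg _) fun i _ => hfac t i
    _ = _ := by
        rw [mul_sum]
        refine sum_congr rfl fun t _ => ?_
        rw [prod_mul_distrib, ← Real.exp_sum]
        rw [cosDefect, sum_div, sum_neg_distrib]
        simp
end

section
variable {ι κ : Type*} [Fintype ι] [Fintype κ] [DecidableEq ι] [DecidableEq κ]

/-- If `φ σ` depends only on the restriction of the bijection `σ` to `T`, then `σ w` with `w ∉ T`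
takes the position prescribed by `φ σ` for at most a fraction `1 / (card κ - #T)` of all `σ`. -/
lemma card_equiv_apply_eq_mul_le {V : Type*} [DecidableEq V] {B : ι → V}
    (hB : Function.Injective B) (T : Finset κ) (φ : κ ≃ ι → V)
    (hφ : ∀ σ τ : κ ≃ ι, (∀ i ∈ T, σ i = τ i) → φ σ = φ τ) {w : κ} (hw : w ∉ T) :
    (Fintype.card κ - #T) * #{σ : κ ≃ ι | B (σ w) = φ σ} ≤ Fintype.card (κ ≃ ι) := by
  have hcard : ∀ u ∈ Tᶜ, #{σ : κ ≃ ι | B (σ u) = φ σ} = #{σ : κ ≃ ι | B (σ w) = φ σ} := by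
    intro u hu
    rw [mem_compl] at hu
    have hinv : ∀ σ : κ ≃ ι, φ ((Equiv.swap u w).trans σ) = φ σ := fun σ => hφ _ _ fun i hi => by
      rw [Equiv.trans_apply, Equiv.swap_apply_of_ne_of_ne] <;> rintro rfl <;> contradiction
    refine card_bij' (fun σ _ => (Equiv.swap u w).trans σ) (fun σ _ => (Equiv.swap u w).trans σ)
      ?_ ?_ ?_ ?_
    · intro σ hσ
      simpa [hinv] using hσ
    · intro σ hσ
      simpa [hinv] using hσ
    · intro σ _
      ext; simp
    · intro σ _
      ext; simp
  have hdisj : (Tᶜ : Set κ).PairwiseDisjoint fun u =>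
      univ.filter fun σ : κ ≃ ι => B (σ u) = φ σ := by
    intro u _ v _ huv
    refine disjoint_left.2 fun σ h1 h2 => huv ?_
    simp only [mem_filter, mem_univ, true_and] at h1 h2
    exact σ.injective (hB (h1.trans h2.symm))
  rw [← card_compl, ← smul_eq_mul, ← sum_const, ← sum_congr rfl hcard, ← card_biUnion]
  · exact card_le_univ _
  · exact fun u hu v hv => hdisj (by simpa using hu) (by simpa using hv)

/-- A uniformly random bijection sends a fixed set to a uniformly random set of the same size. -/
lemma card_equiv_map_mem_mul_choose (T : Finset κ) (F : Finset (Finset ι))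
    (hF : ∀ S ∈ F, #S = #T) :
    #{σ : κ ≃ ι | T.map σ.toEmbedding ∈ F} * (Fintype.card ι).choose #T =
      #F * Fintype.card (κ ≃ ι) := by
  have hconst : ∀ S S' : Finset ι, #S = #T → #S' = #T →
      #{σ : κ ≃ ι | T.map σ.toEmbedding = S} ≤ #{σ : κ ≃ ι | T.map σ.toEmbedding = S'} := by
    intro S S' hS hS'
    set e : Equiv.Perm ι := (Finset.equivOfCardEq (hS.trans hS'.symm)).extendSubtype
    have hmap : S.map e.toEmbedding = S' := by
      refine eq_of_subset_of_card_le ?_ (by rw [card_map, hS, hS'])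
      intro x hx
      obtain ⟨y, hy, rfl⟩ := mem_map.1 hx
      exact Equiv.extendSubtype_mem _ y hy
    refine card_le_card_of_injOn (fun σ => σ.trans e) ?_ ?_
    · intro σ hσ
      simp only [coe_filter, mem_univ, true_and, Set.mem_ofPred_eq] at hσ ⊢
      rw [← hmap, ← hσ, map_map]
      rfl
    · intro σ _ τ _ h
      ext x
      exact e.injective (congrArg (fun f : κ ≃ ι => f x) h)
  have hsum : ∀ G : Finset (Finset ι), #{σ : κ ≃ ι | T.map σ.toEmbedding ∈ G} =
      ∑ S ∈ G, #{σ : κ ≃ ι | T.map σ.toEmbedding = S} := by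
    intro G
    rw [card_eq_sum_card_fiberwise (f := fun σ : κ ≃ ι => T.map σ.toEmbedding) (t := G)]
    · refine sum_congr rfl fun S hS => ?_
      rw [filter_filter]
      congr 1
      ext σ
      simp only [mem_filter, mem_univ, true_and]
      exact ⟨fun h => h.2, fun h => ⟨h ▸ hS, h⟩⟩
    · intro σ hσ
      simpa using hσ
  have hall := hsum (powersetCard #T univ)
  rw [filter_true_of_mem (fun σ _ => by simp [mem_powersetCard]), card_univ] at hall
  rw [hsum, hall, ← card_univ (α := ι), ← card_powersetCard, ← smul_eq_mul (a := #F), ← sum_const,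
    sum_mul]
  refine sum_congr rfl fun S hS => ?_
  rw [mul_comm, ← smul_eq_mul, ← sum_const]
  refine sum_congr rfl fun S' hS' => ?_
  have hS' := (mem_powersetCard.1 hS').2
  exact le_antisymm (hconst _ _ (hF S hS) hS') (hconst _ _ hS' (hF S hS))

/-- The differences of `A` along the pairs `{σ (i, false), σ (i, true)}`. -/
def pairDiff {m p : ℕ} (A : ι → ZMod p) (σ : Fin m × Bool ≃ ι) (i : Fin m) : ZMod p :=
  A (σ (i, false)) - A (σ (i, true))

lemma sum_signedCoincidences_le {m p : ℕ} (hm : 3 ≤ m) {A : ι → ZMod p}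
    (hA : Function.Injective A) :
    ∑ σ : Fin m × Bool ≃ ι, signedCoincidences (pairDiff A σ) ≤
      4 * m * Fintype.card (Fin m × Bool ≃ ι) := by
  set M := Fintype.card (Fin m × Bool ≃ ι) with hM
  have hoff : ∀ (i j : Fin m) (b : Bool), i ≠ j →
      m * #{σ : Fin m × Bool ≃ ι | A (σ (i, false)) =
        A (σ (i, true)) + (A (σ (j, b)) - A (σ (j, !b)))} ≤ M := by
    intro i j b hij
    refine le_trans (Nat.mul_le_mul_right _ ?_) (card_equiv_apply_eq_mul_le hA
      {(i, true), (j, b), (j, !b)} _ (fun σ τ h => ?_) (w := (i, false)) ?_)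
    · have h3 : #{(i, true), (j, b), (j, !b)} ≤ 3 := card_le_three
      simp only [Fintype.card_prod, Fintype.card_fin, Fintype.card_bool]
      omega
    · simp only [mem_insert, mem_singleton, forall_eq_or_imp, forall_eq] at h
      rw [h.1, h.2.1, h.2.2]
    · simp [hij]
  have hpair : ∀ i j : Fin m,
      m * #{σ : Fin m × Bool ≃ ι | pairDiff A σ i = pairDiff A σ j} +
        m * #{σ : Fin m × Bool ≃ ι | pairDiff A σ i = -pairDiff A σ j} ≤
      2 * M + if i = j then 2 * m * M else 0 := by
    intro i j
    split_ifs with hij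
    · have h1 := card_le_univ (univ.filter fun σ : Fin m × Bool ≃ ι =>
        pairDiff A σ i = pairDiff A σ j)
      have h2 := card_le_univ (univ.filter fun σ : Fin m × Bool ≃ ι =>
        pairDiff A σ i = -pairDiff A σ j)
      rw [← hM] at h1 h2
      have h1 := Nat.mul_le_mul_left m h1
      have h2 := Nat.mul_le_mul_left m h2
      have : 2 * m * M = m * M + m * M := by ring
      omega
    · have h1 := hoff i j false hij
      have h2 := hoff i j true hij
      simp only [Bool.not_false, Bool.not_true] at h1 h2
      simp_rw [pairDiff, neg_sub, sub_eq_iff_eq_add, add_comm (_ - _) (A _)]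
      omega
  have hswap : ∑ σ : Fin m × Bool ≃ ι, signedCoincidences (pairDiff A σ) =
      ∑ i, ∑ j, (#{σ : Fin m × Bool ≃ ι | pairDiff A σ i = pairDiff A σ j} +
        #{σ : Fin m × Bool ≃ ι | pairDiff A σ i = -pairDiff A σ j}) := by
    simp only [signedCoincidences, card_filter, ← sum_add_distrib]
    rw [sum_comm, Fintype.sum_prod_type]
  refine Nat.le_of_mul_le_mul_left (c := m) ?_ (by omega)
  calc m * ∑ σ : Fin m × Bool ≃ ι, signedCoincidences (pairDiff A σ)
      ≤ ∑ i : Fin m, ∑ j : Fin m, (2 * M + if i = j then 2 * m * M else 0) := by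
        rw [hswap, mul_sum]
        refine sum_le_sum fun i _ => ?_
        rw [mul_sum]
        refine sum_le_sum fun j _ => ?_
        rw [mul_add]
        exact hpair i j
    _ = m * (4 * m * M) := by
        simp only [sum_add_distrib, sum_const, card_univ, Fintype.card_fin, smul_eq_mul, sum_ite_eq,
          mem_univ, if_true]
        ring
end

lemma card_choices_mul_le_of_level {p m : ℕ} (hp : p.Prime) [NeZero p] (hm : 0 < m) {L : ℕ}
    (hL : (4 : ℝ) ^ L ≤ m / 2) (A : Fin m → Bool → ZMod p) (hA : ∀ i, A i false ≠ A i true)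
    (a : ZMod p) :
    #{ε : Fin m → Bool | ∑ i, A i (ε i) = a} * (p : ℝ) ≤
      2 ^ m * (32 + 64 * p / (2 ^ L * (m : ℝ) ^ 2) *
        signedCoincidences (fun i => A i false - A i true) + 32 / (4 ^ L) ^ 2 * p) := by
  refine (card_choices_mul_le A a).trans (mul_le_mul_of_nonneg_left ?_ (by positivity))
  set d := fun i => A i false - A i true with hd
  have hm' : (0 : ℝ) < m := Nat.cast_pos.2 hm
  have hlt := card_cosDefect_le_lt (d := d) (fun i => sub_ne_zero.2 (hA i)) (s := 4 ^ L)
    (by linarith)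
  refine (sum_exp_neg_le hp (cosDefect_zero d) (cosDefect_nonneg d) (cosDefect_add_le d) L
    hlt).trans ?_
  have hN := card_cosDefect_le_mul_sq_le d hL
  rw [← le_div_iff₀ (by positivity)] at hN
  have : 32 / 2 ^ L * (#{t | cosDefect d t ≤ 4 ^ L} : ℝ) ≤
      64 * p / (2 ^ L * (m : ℝ) ^ 2) * signedCoincidences d := by
    refine (mul_le_mul_of_nonneg_left hN (by positivity)).trans (le_of_eq ?_)
    field_simp
    ring
  linarith

/-- Anticoncentration on the middle slice for distinct residues modulo a prime. -/
lemma card_slice_sum_eq_le {ι : Type*} [Fintype ι] [DecidableEq ι] {p m : ℕ} (hp : p.Prime)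
    (hm : 3 ≤ m) (hι : Fintype.card ι = 2 * m) {L : ℕ} (hL : (4 : ℝ) ^ L ≤ m / 2)
    {A : ι → ZMod p} (hA : Function.Injective A) (a : ZMod p) :
    (#{s : Finset ι | #s = m ∧ ∑ i ∈ s, A i = a} : ℝ) ≤
      (2 * m).choose m * (32 / p + 256 / (2 ^ L * m) + 32 / (4 ^ L) ^ 2) := by
  have : NeZero p := ⟨hp.ne_zero⟩
  have hp0 : (0 : ℝ) < p := Nat.cast_pos.2 hp.pos
  have hm0 : (0 : ℝ) < m := Nat.cast_pos.2 (by omega)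
  set F : Finset (Finset ι) := {s | #s = m ∧ ∑ i ∈ s, A i = a} with hF
  have hM : 0 < Fintype.card (Fin m × Bool ≃ ι) :=
    Fintype.card_pos_iff.2 ⟨Fintype.equivOfCardEq (by simp [hι, mul_comm])⟩
  set M := Fintype.card (Fin m × Bool ≃ ι)
  have hfix : ∀ ε : Fin m → Bool,
      #{σ : Fin m × Bool ≃ ι | ∑ i, A (σ (i, ε i)) = a} * (2 * m).choose m = #F * M := by
    intro ε
    set T : Finset (Fin m × Bool) := univ.map ⟨fun i => (i, ε i), fun i j h => congrArg Prod.fst h⟩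
      with hT
    have hTc : #T = m := by simp [hT]
    have := card_equiv_map_mem_mul_choose T F (fun S hS => by
      rw [hTc]; exact (mem_filter.1 hS).2.1)
    rw [hTc, hι] at this
    rw [← this]
    congr 3
    ext σ
    simp [hF, hT]
    rfl
  have hdouble : (∑ σ : Fin m × Bool ≃ ι, #{ε : Fin m → Bool | ∑ i, A (σ (i, ε i)) = a}) *
      (2 * m).choose m = 2 ^ m * (#F * M) := by
    simp only [card_filter]
    rw [sum_comm, sum_mul]
    simp only [← card_filter, hfix]
    simp
  have hR : (∑ σ : Fin m × Bool ≃ ι, signedCoincidences (pairDiff A σ) : ℝ) ≤ 4 * m * M := by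
    exact_mod_cast sum_signedCoincidences_le hm hA
  have hbound : (∑ σ : Fin m × Bool ≃ ι, #{ε : Fin m → Bool | ∑ i, A (σ (i, ε i)) = a} : ℝ) * p ≤
      2 ^ m * M * p * (32 / p + 256 / (2 ^ L * m) + 32 / (4 ^ L) ^ 2) := by
    rw [sum_mul]
    calc ∑ σ : Fin m × Bool ≃ ι, (#{ε : Fin m → Bool | ∑ i, A (σ (i, ε i)) = a} : ℝ) * p
        ≤ ∑ σ : Fin m × Bool ≃ ι, 2 ^ m * (32 + 64 * p / (2 ^ L * (m : ℝ) ^ 2) *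
            signedCoincidences (pairDiff A σ) + 32 / (4 ^ L) ^ 2 * p) :=
          sum_le_sum fun σ _ => card_choices_mul_le_of_level hp (by omega) hL
            (fun i b => A (σ (i, b))) (fun i h => by simpa using σ.injective (hA h)) a
      _ = 2 ^ m * (M * 32 + 64 * p / (2 ^ L * (m : ℝ) ^ 2) *
            ∑ σ : Fin m × Bool ≃ ι, (signedCoincidences (pairDiff A σ) : ℝ) +
            M * (32 / (4 ^ L) ^ 2 * p)) := by
          rw [← mul_sum, sum_add_distrib, sum_add_distrib, ← mul_sum]
          simp [M]
      _ ≤ 2 ^ m * (M * 32 + 64 * p / (2 ^ L * (m : ℝ) ^ 2) * (4 * m * M) +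
            M * (32 / (4 ^ L) ^ 2 * p)) := by gcongr
      _ = _ := by
          field_simp
          ring
  have hdouble' : (∑ σ : Fin m × Bool ≃ ι,
      #{ε : Fin m → Bool | ∑ i, A (σ (i, ε i)) = a} : ℝ) * (2 * m).choose m =
      2 ^ m * (#F * M) := by exact_mod_cast hdouble
  have hM0 : (0 : ℝ) < M := Nat.cast_pos.2 hM
  refine le_of_mul_le_mul_left (a := 2 ^ m * M * (p : ℝ)) ?_ (by positivity)
  have := mul_le_mul_of_nonneg_right hbound (Nat.cast_nonneg (α := ℝ) ((2 * m).choose m))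
  linear_combination -(p : ℝ) * hdouble' + this

/-- Finitely many distinct reals can be replaced by distinct residues modulo an arbitrarily large
prime so that all coincidences between subset sums of equal value are preserved. -/
lemma exists_prime_model {ι : Type*} [Fintype ι] {A : ι → ℝ} (hA : Function.Injective A) (N : ℕ) :
    ∃ p : ℕ, p.Prime ∧ N ≤ p ∧ ∃ B : ι → ZMod p, Function.Injective B ∧
      ∀ s t : Finset ι, ∑ i ∈ s, A i = ∑ i ∈ t, A i → ∑ i ∈ s, B i = ∑ i ∈ t, B i := by
  obtain ⟨f, hf⟩ := Module.exists_dual_forall_apply_ne_zero (K := ℚ)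
    (fun q : {q : ι × ι // q.1 ≠ q.2} => A q.1.1 - A q.1.2)
    (fun q => sub_ne_zero.2 (hA.ne q.2))
  obtain ⟨b, hb⟩ := IsLocalization.exist_integer_multiples_of_finite (nonZeroDivisors ℤ)
    (fun i => f (A i))
  choose B hB using hb
  have hb0 : ((b : ℤ) : ℚ) ≠ 0 := Int.cast_ne_zero.2 (nonZeroDivisors.coe_ne_zero b)
  replace hB : ∀ i, (B i : ℚ) = (b : ℤ) * f (A i) := fun i => by simpa using hB i
  have hinj : Function.Injective B := by
    intro i j hij
    by_contra hne
    refine hf ⟨(i, j), hne⟩ ?_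
    have : ((b : ℤ) : ℚ) * f (A i) = (b : ℤ) * f (A j) := by rw [← hB, ← hB, hij]
    simpa [sub_eq_zero] using mul_left_cancel₀ hb0 this
  obtain ⟨p, hNp, hp⟩ := Nat.exists_infinite_primes (N + (∑ i, (B i).natAbs) * 2 + 1)
  refine ⟨p, hp, by omega, fun i => (B i : ZMod p), fun i j hij => hinj ?_, fun s t hst => ?_⟩
  · have hdvd := (ZMod.intCast_eq_intCast_iff_dvd_sub _ _ _).1 hij
    have hi := single_le_sum (f := fun i => (B i).natAbs) (fun _ _ => Nat.zero_le _) (mem_univ i)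
    have hj := single_le_sum (f := fun i => (B i).natAbs) (fun _ _ => Nat.zero_le _) (mem_univ j)
    have := Int.eq_zero_of_abs_lt_dvd hdvd (by rw [abs_lt]; omega)
    omega
  · have h : ∑ i ∈ s, B i = ∑ i ∈ t, B i := by
      have : ((∑ i ∈ s, B i : ℤ) : ℚ) = (∑ i ∈ t, B i : ℤ) := by
        push_cast
        simp_rw [hB, ← mul_sum, ← map_sum, hst]
      exact_mod_cast this
    simpa using congrArg (Int.cast : ℤ → ZMod p) h

theorem stmt6 :
    ∃ (K : ℝ) (n₀ : ℕ), 0 < K ∧ ∀ n : ℕ, n₀ ≤ n → Even n →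
      ∀ A : Fin n → ℝ, Function.Injective A →
        rhoStar n A ≤ K / (n : ℝ) ^ ((3 : ℝ) / 2) := by
  refine ⟨20000, 6, by norm_num, fun n hn heven A hA => ?_⟩
  obtain ⟨m, rfl⟩ := even_iff_exists_two_mul.1 heven
  have hhalf : 2 * m / 2 = m := by omega
  obtain ⟨p, hp, hpn, B, hB, hAB⟩ := exists_prime_model hA ((2 * m) ^ 2)
  have hm3 : (3 : ℝ) ≤ m := by exact_mod_cast (by omega : 3 ≤ m)
  obtain ⟨L, hL1, hL2⟩ := exists_nat_pow_near (x := (m : ℝ) / 2) (y := 4) (by linarith)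
    (by norm_num)
  set r := √((2 * m : ℕ) : ℝ) with hr
  have hr2 : r ^ 2 = 2 * m := by rw [hr, Real.sq_sqrt (by positivity)]; push_cast; rfl
  have hr1 : 1 ≤ r := Real.one_le_sqrt.2 (by push_cast; linarith)
  have hpow : ((2 * m : ℕ) : ℝ) ^ ((3 : ℝ) / 2) = r ^ 3 := by
    rw [hr, Real.sqrt_eq_rpow, ← Real.rpow_natCast, ← Real.rpow_mul (by positivity)]
    norm_num
  have hnum : 32 / p + 256 / (2 ^ L * m) + 32 / ((4 : ℝ) ^ L) ^ 2 ≤ 20000 / r ^ 3 := by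
    have h4 : r ^ 2 / 16 ≤ (4 : ℝ) ^ L := by rw [pow_succ] at hL2; linarith
    have h2 : r / 4 ≤ 2 ^ L := by
      refine le_of_sq_le_sq ?_ (by positivity)
      rw [← pow_mul, mul_comm L, pow_mul]
      norm_num
      linarith
    have hpr : r ^ 4 ≤ p := by
      calc r ^ 4 = (r ^ 2) ^ 2 := by ring
        _ = (((2 * m) ^ 2 : ℕ) : ℝ) := by rw [hr2]; push_cast; rfl
        _ ≤ p := by exact_mod_cast hpn
    have hmr : (m : ℝ) = r ^ 2 / 2 := by linarith
    have h34 : 1 / r ^ 4 ≤ 1 / r ^ 3 :=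
      one_div_le_one_div_of_le (by positivity) (pow_le_pow_right₀ hr1 (by norm_num))
    calc 32 / p + 256 / (2 ^ L * m) + 32 / ((4 : ℝ) ^ L) ^ 2
        ≤ 32 / r ^ 4 + 256 / (r / 4 * (r ^ 2 / 2)) + 32 / (r ^ 2 / 16) ^ 2 := by
          rw [hmr]; gcongr
      _ = 2048 * (1 / r ^ 3) + 8224 * (1 / r ^ 4) := by field_simp; ring
      _ ≤ 20000 * (1 / r ^ 3) := by
          have : 0 ≤ 1 / r ^ 3 := by positivity
          linarith
      _ = 20000 / r ^ 3 := by ring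
  unfold rhoStar
  rw [hpow, hhalf]
  refine ciSup_le fun a => ?_
  rw [div_le_iff₀ (Nat.cast_pos.2 (Nat.choose_pos (by omega)))]
  rcases Set.eq_empty_or_nonempty {s : Finset (Fin (2 * m)) | s.card = m ∧ ∑ i ∈ s, A i = a} with
    hempty | ⟨s₀, -, hs₀⟩
  · rw [hempty, Set.ncard_empty, Nat.cast_zero]
    positivity
  · have hle : {s : Finset (Fin (2 * m)) | s.card = m ∧ ∑ i ∈ s, A i = a}.ncard ≤
        #{s : Finset (Fin (2 * m)) | #s = m ∧ ∑ i ∈ s, B i = ∑ i ∈ s₀, B i} := by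
      rw [← Set.ncard_coe_finset]
      refine Set.ncard_le_ncard (fun s hs => ?_) (Set.toFinite _)
      simp only [coe_filter, mem_univ, true_and, Set.mem_ofPred_eq] at hs ⊢
      exact ⟨hs.1, hAB _ _ (hs.2.trans hs₀.symm)⟩
    calc _ ≤ (#{s : Finset (Fin (2 * m)) | #s = m ∧ ∑ i ∈ s, B i = ∑ i ∈ s₀, B i} : ℝ) := by
          exact_mod_cast hle
      _ ≤ _ := card_slice_sum_eq_le hp (by omega) (by simp) hL1 hB _
      _ ≤ _ := by rw [mul_comm]; gcongr
end

section
/- Let 0 < ε < 1 and C > 0 be constants. There exist constants r₀, K and m₀, depending only on ε and C, such that the following holds for all m ≥ m₀. Let A = {a₁, …, a_n} be a symmetric multiset of real numbers with ρ_m(A) ≥ m^{−C}. Then for every n' with εn ≤ n' ≤ n there exists a symmetric proper GAP Q of rank r ≤ r₀ such that a_i ∈ Q for at least n − n' indices i ∈ {1, …, n} (counted with multiplicity), and |Q| ≤ max{1, K · ρ_m(A)^{−1} / (m·n'/n)^{r/2}}. -/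
/-- A generalized arithmetic progression (GAP) of rank `r` in an additive abelian group,
given by its generators and dimensions. -/
structure GAPData (G : Type*) [AddCommGroup G] (r : ℕ) where
  g₀ : G
  g : Fin r → G
  N : Fin r → ℤ
  N' : Fin r → ℤ
  hle : ∀ i, N i ≤ N' i

namespace GAPData

variable {G : Type*} [AddCommGroup G] {r : ℕ}

/-- The set of elements of the GAP. -/
def toSet (P : GAPData G r) : Set G :=
  {x | ∃ m : Fin r → ℤ, (∀ i, P.N i ≤ m i ∧ m i ≤ P.N' i) ∧ x = P.g₀ + ∑ i, m i • P.g i}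

/-- A GAP is proper if every element has a unique representation. -/
def IsProper (P : GAPData G r) : Prop :=
  ∀ m m' : Fin r → ℤ, (∀ i, P.N i ≤ m i ∧ m i ≤ P.N' i) →
    (∀ i, P.N i ≤ m' i ∧ m' i ≤ P.N' i) →
    P.g₀ + ∑ i, m i • P.g i = P.g₀ + ∑ i, m' i • P.g i → m = m'

/-- A GAP is symmetric if `g₀ = 0` and `N i = -N' i` for all `i`. -/
def IsSymmetric (P : GAPData G r) : Prop :=
  P.g₀ = 0 ∧ ∀ i, P.N i = -P.N' i

end GAPData

/-- `ρ_m(A)`: the largest concentration probability of the `m`-step random walk whose iid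
steps are uniform on the multiset `A = {a₁, …, a_n}`. -/
noncomputable def rhoWalk (n m : ℕ) (A : Fin n → ℝ) : ℝ :=
  ⨆ a : ℝ, ({f : Fin m → Fin n | ∑ j, A (f j) = a}.ncard : ℝ) / (n : ℝ) ^ m

open scoped Pointwise

/-- Lifting along the quotient by the line through a lattice vector, with control of norms. -/
lemma exists_lift_norm_le {E L : Type} [NormedAddCommGroup E] [NormedSpace ℝ E] [AddCommGroup L]
    (ι : L →+ E) (b u : L) {δ : ℝ} (hδ : 0 < δ) :
    ∃ n : ℤ, ‖ι (u - n • b)‖ ≤ ‖(Submodule.span ℝ {ι b}).mkQ (ι u)‖ + δ + ‖ι b‖ / 2 := by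
  obtain ⟨z, hz, hzn⟩ := Submodule.Quotient.norm_mk_lt
    ((Submodule.span ℝ {ι b}).mkQ (ι u)) hδ
  have hmem : ι u - z ∈ Submodule.span ℝ {ι b} := by
    rw [← Submodule.Quotient.eq]
    rw [hz]; rfl
  obtain ⟨s, hs⟩ := Submodule.mem_span_singleton.1 hmem
  refine ⟨round s, ?_⟩
  have h1 : ι (u - round s • b) = z + (s - round s) • ι b := by
    rw [map_sub, map_zsmul, sub_smul, hs, Int.cast_smul_eq_zsmul]; abel
  rw [h1]
  have h2 := abs_sub_round s
  calc _ ≤ ‖z‖ + ‖(s - round s) • ι b‖ := norm_add_le _ _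
    _ = ‖z‖ + |s - round s| * ‖ι b‖ := by rw [norm_smul, Real.norm_eq_abs]
    _ ≤ _ := by nlinarith [norm_nonneg (ι b)]

lemma finite_quotient_ball {E L : Type} [NormedAddCommGroup E] [NormedSpace ℝ E] [AddCommGroup L]
    (ι : L →+ E) (hd : ∀ R : ℝ, {v : E | ∃ u, ι u = v ∧ ‖v‖ ≤ R}.Finite) (b : L) (R : ℝ) :
    {v | ∃ u, (Submodule.span ℝ {ι b}).mkQ (ι u) = v ∧ ‖v‖ ≤ R}.Finite := by
  refine ((hd (R + 1 + ‖ι b‖ / 2)).image (Submodule.span ℝ {ι b}).mkQ).subset ?_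
  rintro _ ⟨u, rfl, hu⟩
  obtain ⟨n, hn⟩ := exists_lift_norm_le ι b u one_pos
  refine ⟨ι (u - n • b), ⟨_, rfl, by linarith⟩, ?_⟩
  rw [map_sub, map_sub, map_zsmul, map_zsmul]
  have : (Submodule.span ℝ {ι b}).mkQ (ι b) = 0 := by
    simp [Submodule.mem_span_singleton_self]
  rw [this]; simp

lemma finrank_quotient_span_singleton_le {E : Type} [NormedAddCommGroup E] [NormedSpace ℝ E]
    [FiniteDimensional ℝ E] {D : ℕ} (hD : Module.finrank ℝ E ≤ D + 1) {v : E} (hv : v ≠ 0) :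
    Module.finrank ℝ (E ⧸ Submodule.span ℝ {v}) ≤ D := by
  have h1 := Submodule.finrank_quotient_add_finrank (Submodule.span ℝ {v})
  rw [finrank_span_singleton hv] at h1
  omega

/-- A discrete subgroup of a finite-dimensional normed space has a reduced basis: the coordinates
of a lattice vector are controlled by its norm. -/
theorem exists_reduced_basis (D : ℕ) : ∃ C : ℝ, 1 ≤ C ∧
    ∀ (E L : Type) [NormedAddCommGroup E] [NormedSpace ℝ E] [FiniteDimensional ℝ E]
      [AddCommGroup L] (ι : L →+ E), Module.finrank ℝ E ≤ D →
      (∀ R : ℝ, {v : E | ∃ u, ι u = v ∧ ‖v‖ ≤ R}.Finite) →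
      ∃ (r : ℕ) (b : Fin r → L), r ≤ D ∧ (∀ i, ι (b i) ≠ 0) ∧
        (∀ u, ∃ x : Fin r → ℤ, ι u = ∑ i, x i • ι (b i)) ∧
        ∀ (x : Fin r → ℤ) (i), |(x i : ℝ)| * ‖ι (b i)‖ ≤ C * ‖∑ j, x j • ι (b j)‖ := by
  induction D with
  | zero =>
    refine ⟨1, le_rfl, fun E L _ _ _ _ ι hE hd => ⟨0, Fin.elim0, le_rfl, fun i => i.elim0, ?_,
      fun x i => i.elim0⟩⟩
    intro u
    have : Subsingleton E := Module.finrank_zero_iff.1 (Nat.le_zero.1 hE)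
    exact ⟨Fin.elim0, Subsingleton.elim _ _⟩
  | succ D ih =>
    obtain ⟨C, hC, ih⟩ := ih
    refine ⟨1 + 3 * C * (D + 1), by nlinarith [show (0 : ℝ) ≤ D by positivity],
      fun E L _ _ _ _ ι hE hd => ?_⟩
    by_cases h0 : ∀ u, ι u = 0
    · exact ⟨0, Fin.elim0, Nat.zero_le _, fun i => i.elim0, fun u => ⟨Fin.elim0, by simp [h0]⟩,
        fun x i => i.elim0⟩
    push Not at h0
    obtain ⟨u₀, hu₀⟩ := h0
    obtain ⟨v, ⟨⟨b₀, rfl, hb₀R⟩, hb₀⟩, hmin⟩ := Set.exists_min_image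
      ({v : E | ∃ u, ι u = v ∧ ‖v‖ ≤ ‖ι u₀‖} ∩ {0}ᶜ) (fun v => ‖v‖)
      ((hd ‖ι u₀‖).inter_of_left _) ⟨ι u₀, ⟨_, rfl, le_rfl⟩, hu₀⟩
    replace hb₀ : ι b₀ ≠ 0 := hb₀
    have hmin' : ∀ u, ι u ≠ 0 → ‖ι b₀‖ ≤ ‖ι u‖ := by
      intro u hu
      by_cases h : ‖ι u‖ ≤ ‖ι u₀‖
      · exact hmin _ ⟨⟨u, rfl, h⟩, hu⟩
      · linarith
    have hpos : 0 < ‖ι b₀‖ := norm_pos_iff.2 hb₀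
    set W := Submodule.span ℝ {ι b₀} with hW
    have : IsClosed (W : Set E) := Submodule.closed_of_finiteDimensional W
    have hq0 : W.mkQ (ι b₀) = 0 := by
      simp [hW, Submodule.mem_span_singleton_self]
    obtain ⟨r, b', hr, hb', hgen, hred⟩ := ih (E ⧸ W) L (W.mkQ.toAddMonoidHom.comp ι)
      (finrank_quotient_span_singleton_le hE hb₀) (finite_quotient_ball ι hd b₀)
    simp only [AddMonoidHom.comp_apply, LinearMap.toAddMonoidHom_coe] at hb' hgen hred
    have hlow : ∀ i, ‖ι b₀‖ / 2 ≤ ‖W.mkQ (ι (b' i))‖ := by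
      intro i
      refine le_of_forall_pos_le_add fun δ hδ => ?_
      obtain ⟨n, hn⟩ := exists_lift_norm_le ι b₀ (b' i) hδ
      have := hmin' (b' i - n • b₀) (fun h => hb' i (by
        have h2 := congrArg W.mkQ h
        rwa [map_sub, map_sub, map_zsmul, map_zsmul, hq0, smul_zero, sub_zero, map_zero] at h2))
      linarith
    have hlift : ∀ i, ∃ n : ℤ, ‖ι (b' i - n • b₀)‖ ≤ 3 * ‖W.mkQ (ι (b' i))‖ := by
      intro i
      obtain ⟨n, hn⟩ := exists_lift_norm_le ι b₀ (b' i) (norm_pos_iff.2 (hb' i))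
      exact ⟨n, by linarith [hlow i]⟩
    choose n hn using hlift
    set b : Fin r → L := fun i => b' i - n i • b₀ with hb
    have hqb : ∀ i, W.mkQ (ι (b i)) = W.mkQ (ι (b' i)) := by
      intro i
      simp only [hb]
      rw [map_sub, map_sub, map_zsmul, map_zsmul, hq0, smul_zero, sub_zero]
    have hsum : ∀ x : Fin r → ℤ, W.mkQ (∑ i, x i • ι (b i)) = ∑ i, x i • W.mkQ (ι (b' i)) := by
      intro x
      rw [map_sum]
      exact Finset.sum_congr rfl fun i _ => by rw [map_zsmul, hqb]
    refine ⟨r + 1, Fin.cons b₀ b, by omega, ?_, ?_, ?_⟩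
    · intro i
      refine Fin.cases ?_ (fun i => ?_) i
      · simpa using hb₀
      · intro h
        simp only [Fin.cons_succ] at h
        apply hb' i
        rw [← hqb, h, map_zero]
    · intro u
      obtain ⟨x, hx⟩ := hgen u
      have hmem : ι u - ∑ i, x i • ι (b i) ∈ W := by
        rw [← Submodule.Quotient.mk_eq_zero, ← Submodule.mkQ_apply, map_sub, hsum, hx, sub_self]
      obtain ⟨s, hs⟩ := Submodule.mem_span_singleton.1 hmem
      have hfr : ι (u - ∑ i, x i • b i - ⌊s⌋ • b₀) = Int.fract s • ι b₀ := by
        rw [map_sub, map_sub, map_sum, map_zsmul]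
        simp only [map_zsmul]
        rw [← hs, ← Int.self_sub_floor, sub_smul, Int.cast_smul_eq_zsmul]
      have hz : ι (u - ∑ i, x i • b i - ⌊s⌋ • b₀) = 0 := by
        by_contra hne
        have h1 := hmin' _ hne
        rw [hfr, norm_smul, Real.norm_eq_abs, abs_of_nonneg (Int.fract_nonneg s)] at h1
        nlinarith [Int.fract_lt_one s]
      refine ⟨Fin.cons ⌊s⌋ x, ?_⟩
      rw [Fin.sum_univ_succ]
      simp only [Fin.cons_zero, Fin.cons_succ]
      rw [map_sub, map_sub, map_sum, map_zsmul, sub_eq_zero] at hz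
      simp only [map_zsmul] at hz
      rw [← hz]; abel
    · intro x
      have htail : ∀ i : Fin r, |(x i.succ : ℝ)| * ‖ι (b i)‖ ≤
          3 * C * ‖∑ j, x j • ι ((Fin.cons b₀ b : Fin (r + 1) → L) j)‖ := by
        intro i
        have h1 := hred (fun i => x i.succ) i
        have h2 : ∑ j, x j.succ • W.mkQ (ι (b' j)) =
            W.mkQ (∑ j, x j • ι ((Fin.cons b₀ b : Fin (r + 1) → L) j)) := by
          rw [Fin.sum_univ_succ, map_add]
          simp only [Fin.cons_zero, Fin.cons_succ]
          rw [hsum, map_zsmul, hq0, smul_zero, zero_add]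
        rw [h2] at h1
        have h3 := Submodule.Quotient.norm_mk_le W
          (∑ j, x j • ι ((Fin.cons b₀ b : Fin (r + 1) → L) j))
        rw [← Submodule.mkQ_apply] at h3
        have h4 := hn i
        have h5 := abs_nonneg (x i.succ : ℝ)
        calc |(x i.succ : ℝ)| * ‖ι (b i)‖
            ≤ |(x i.succ : ℝ)| * (3 * ‖W.mkQ (ι (b' i))‖) := by gcongr
          _ = 3 * (|(x i.succ : ℝ)| * ‖W.mkQ (ι (b' i))‖) := by ring
          _ ≤ 3 * (C * ‖∑ j, x j • ι ((Fin.cons b₀ b : Fin (r + 1) → L) j)‖) := by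
              refine mul_le_mul_of_nonneg_left (h1.trans ?_) (by norm_num)
              gcongr
          _ = _ := by ring
      set T := ‖∑ j, x j • ι ((Fin.cons b₀ b : Fin (r + 1) → L) j)‖ with hT
      have hT0 : 0 ≤ T := norm_nonneg _
      have hrD : (r : ℝ) ≤ D := by exact_mod_cast hr
      intro i
      refine Fin.cases ?_ (fun i => ?_) i
      · simp only [Fin.cons_zero]
        have h1 : x 0 • ι b₀ = (∑ j, x j • ι ((Fin.cons b₀ b : Fin (r + 1) → L) j)) -
            ∑ i : Fin r, x i.succ • ι (b i) := by
          rw [Fin.sum_univ_succ]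
          simp only [Fin.cons_zero, Fin.cons_succ]
          abel
        have h2 : |(x 0 : ℝ)| * ‖ι b₀‖ = ‖x 0 • ι b₀‖ := by
          rw [← Int.cast_smul_eq_zsmul ℝ, norm_smul, Real.norm_eq_abs]
        rw [h2, h1]
        have h3 : ‖∑ i : Fin r, x i.succ • ι (b i)‖ ≤ r * (3 * C * T) := by
          refine (norm_sum_le _ _).trans ?_
          calc _ ≤ ∑ _i : Fin r, 3 * C * T := by
                refine Finset.sum_le_sum fun i _ => ?_
                rw [← Int.cast_smul_eq_zsmul ℝ, norm_smul, Real.norm_eq_abs]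
                exact htail i
            _ = _ := by simp
        have h4 : (r : ℝ) * (3 * C * T) ≤ D * (3 * C * T) := by gcongr
        have h5 : 0 ≤ C * T := by positivity
        refine (norm_sub_le _ _).trans ?_
        rw [← hT]
        nlinarith
      · simp only [Fin.cons_succ]
        refine (htail i).trans ?_
        have : 0 ≤ C * T := by positivity
        have : 0 ≤ D * (C * T) := by positivity
        nlinarith

lemma Fintype.sum_subtype_of_eq_zero {α M : Type} [Fintype α] [AddCommMonoid M] (p : α → Prop)
    [DecidablePred p] (f : α → M) (h : ∀ i, ¬ p i → f i = 0) :
    ∑ i : {i // p i}, f i = ∑ i, f i := by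
  have h1 := Finset.sum_subtype_eq_sum_filter (s := Finset.univ) f (p := p)
  rw [Finset.subtype_univ] at h1
  rw [h1]
  exact Finset.sum_filter_of_ne fun i _ hi => by_contra fun hp => hi (h i hp)

/-- The progression attached to a reduced basis, when the projection is injective on a large ball. -/
lemma lattice_gap_of_injOn {Γ L E : Type} [AddCommGroup Γ] [AddCommGroup L]
    [NormedAddCommGroup E] [NormedSpace ℝ E] (ι : L →+ E) (φ : L →+ Γ)
    (hker : ∀ u, ι u = 0 → φ u = 0) {C : ℝ} {D k : ℕ} {C' : ℝ} (hC' : 0 ≤ C')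
    (hC : 2 * D * C' ≤ C) (hk : 1 ≤ k) {r : ℕ} (b : Fin r → L) (hr : r ≤ D)
    (hb : ∀ i, ι (b i) ≠ 0) (hgen : ∀ u, ∃ x : Fin r → ℤ, ι u = ∑ i, x i • ι (b i))
    (hred : ∀ (x : Fin r → ℤ) (i), |(x i : ℝ)| * ‖ι (b i)‖ ≤ C' * ‖∑ j, x j • ι (b j)‖)
    (hinj : ∀ u, ‖ι u‖ ≤ C * k → φ u = 0 → ι u = 0) :
    ∃ (J : Type) (_ : Fintype J) (w : J → Γ) (N : J → ℕ), Fintype.card J ≤ D ∧ (∀ i, 1 ≤ N i) ∧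
      (∀ u, ‖ι u‖ ≤ 1 → ∃ x : J → ℤ, (∀ i, |x i| ≤ N i) ∧ φ u = ∑ i, x i • w i) ∧
      (∀ x : J → ℤ, (∀ i, |x i| ≤ k * N i) → ∃ u, ‖ι u‖ ≤ C * k ∧ φ u = ∑ i, x i • w i) ∧
      (∀ x : J → ℤ, (∀ i, |x i| ≤ 2 * k * N i) → ∑ i, x i • w i = 0 → x = 0) := by
  classical
  have hpos : ∀ i, 0 < ‖ι (b i)‖ := fun i => norm_pos_iff.2 (hb i)
  set N : Fin r → ℕ := fun i => ⌊C' / ‖ι (b i)‖⌋₊ with hN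
  have hNle : ∀ i, (N i : ℝ) * ‖ι (b i)‖ ≤ C' := fun i =>
    (le_div_iff₀ (hpos i)).1 (Nat.floor_le (div_nonneg hC' (hpos i).le))
  have hbound : ∀ (c : ℕ) (x : {i // 1 ≤ N i} → ℤ), (∀ i, |x i| ≤ c * N i) →
      ‖ι (∑ i, x i • b i)‖ ≤ c * (D * C') := by
    intro c x hx
    rw [map_sum]
    refine (norm_sum_le _ _).trans ?_
    calc _ ≤ ∑ _i : {i // 1 ≤ N i}, c * C' := by
          refine Finset.sum_le_sum fun i _ => ?_
          rw [map_zsmul, ← Int.cast_smul_eq_zsmul ℝ, norm_smul, Real.norm_eq_abs]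
          have h1 : |(x i : ℝ)| ≤ c * N i := by exact_mod_cast hx i
          calc _ ≤ (c * N i : ℝ) * ‖ι (b i)‖ := by gcongr
            _ = c * (N i * ‖ι (b i)‖) := by ring
            _ ≤ c * C' := by gcongr; exact hNle i
      _ = Fintype.card {i // 1 ≤ N i} * (c * C') := by simp
      _ ≤ D * (c * C') := by
          have : Fintype.card {i // 1 ≤ N i} ≤ D :=
            (Fintype.card_subtype_le _).trans (by simpa using hr)
          gcongr
      _ = _ := by ring
  have hk' : (1 : ℝ) ≤ k := by exact_mod_cast hk
  have hDC : 0 ≤ D * C' := by positivity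
  refine ⟨{i // 1 ≤ N i}, inferInstance, fun i => φ (b i), fun i => N i,
    (Fintype.card_subtype_le _).trans (by simpa using hr), fun i => i.2, ?_, ?_, ?_⟩
  · intro u hu
    obtain ⟨x, hx⟩ := hgen u
    have hxN : ∀ i, |x i| ≤ N i := by
      intro i
      have h1 := hred x i
      rw [← hx] at h1
      have h2 : ((x i).natAbs : ℝ) ≤ C' / ‖ι (b i)‖ := by
        rw [le_div_iff₀ (hpos i), Nat.cast_natAbs, Int.cast_abs]
        nlinarith
      have h3 := Nat.le_floor h2
      rw [Int.abs_eq_natAbs]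
      exact_mod_cast h3
    refine ⟨fun i => x i, fun i => hxN i, ?_⟩
    have h4 : φ u = ∑ i, x i • φ (b i) := by
      have : φ (u - ∑ i, x i • b i) = 0 := hker _ (by
        rw [map_sub, map_sum, hx, sub_eq_zero]
        exact Finset.sum_congr rfl fun i _ => (map_zsmul ι _ _).symm)
      rw [map_sub, map_sum, sub_eq_zero] at this
      simpa only [map_zsmul] using this
    rw [h4]
    symm
    refine Fintype.sum_subtype_of_eq_zero (fun i => 1 ≤ N i) (fun i => x i • φ (b i)) ?_
    intro i hi
    have h5 := hxN i
    have : N i = 0 := by omega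
    rw [this, Nat.cast_zero] at h5
    simp [abs_nonpos_iff.1 h5]
  · intro x hx
    refine ⟨∑ i, x i • b i, ?_, ?_⟩
    · refine (hbound k x hx).trans ?_
      nlinarith
    · rw [map_sum]
      exact Finset.sum_congr rfl fun i _ => map_zsmul φ _ _
  · intro x hx h0
    have h1 : ‖ι (∑ i, x i • b i)‖ ≤ C * k := by
      refine (hbound (2 * k) x (by exact_mod_cast hx)).trans ?_
      push_cast
      nlinarith
    have h2 := hinj _ h1 (by
      rw [map_sum, ← h0]
      exact Finset.sum_congr rfl fun i _ => map_zsmul φ _ _)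
    funext i
    set y : Fin r → ℤ := fun i => if h : 1 ≤ N i then x ⟨i, h⟩ else 0 with hy
    have h3 : ∑ j, y j • ι (b j) = ι (∑ i, x i • b i) := by
      rw [map_sum, ← Fintype.sum_subtype_of_eq_zero (fun i => 1 ≤ N i)]
      · exact Finset.sum_congr rfl fun i _ => by simp [hy, i.2]
      · intro i hi
        simp [hy, hi]
    have h4 := hred y i
    rw [h3, h2, norm_zero, mul_zero] at h4
    have h5 : |(y i : ℝ)| ≤ 0 := by
      by_contra hne
      push Not at hne
      have := mul_pos hne (hpos i)
      linarith
    have h6 : y i = 0 := by exact_mod_cast abs_nonpos_iff.1 h5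
    simpa [hy, i.2] using h6

theorem exists_lattice_gap (D : ℕ) : ∃ C : ℕ, 1 ≤ C ∧
    ∀ (Γ L E : Type) [AddCommGroup Γ] [AddCommGroup L] [NormedAddCommGroup E] [NormedSpace ℝ E]
      [FiniteDimensional ℝ E] (ι : L →+ E) (φ : L →+ Γ), Module.finrank ℝ E ≤ D →
      (∀ R : ℝ, {v : E | ∃ u, ι u = v ∧ ‖v‖ ≤ R}.Finite) → (∀ u, ι u = 0 → φ u = 0) →
      (∀ (n : ℤ) (g : Γ), n • g = 0 → n ≠ 0 → g = 0) → ∀ k : ℕ, 1 ≤ k →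
    ∃ (J : Type) (_ : Fintype J) (w : J → Γ) (N : J → ℕ), Fintype.card J ≤ D ∧ (∀ i, 1 ≤ N i) ∧
      (∀ u, ‖ι u‖ ≤ 1 → ∃ x : J → ℤ, (∀ i, |x i| ≤ N i) ∧ φ u = ∑ i, x i • w i) ∧
      (∀ x : J → ℤ, (∀ i, |x i| ≤ k * N i) →
        ∃ u, ‖ι u‖ ≤ C * k ∧ φ u = ∑ i, x i • w i) ∧
      (∀ x : J → ℤ, (∀ i, |x i| ≤ 2 * k * N i) → ∑ i, x i • w i = 0 → x = 0) := by
  induction D with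
  | zero =>
    refine ⟨1, le_rfl, fun Γ L E _ _ _ _ _ ι φ hE hd hker htf k hk => ?_⟩
    have : Subsingleton E := Module.finrank_zero_iff.1 (Nat.le_zero.1 hE)
    exact lattice_gap_of_injOn ι φ hker le_rfl (C := (1 : ℕ)) (by simp) hk (b := Fin.elim0) le_rfl
      (fun i => i.elim0) (fun u => ⟨Fin.elim0, Subsingleton.elim _ _⟩) (fun x i => i.elim0)
      (fun _ _ _ => Subsingleton.elim _ _)
  | succ D ih =>
    obtain ⟨C', hC', ih⟩ := ih
    obtain ⟨C'', hC'', hbasis⟩ := exists_reduced_basis (D + 1)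
    obtain ⟨M, hM⟩ := exists_nat_ge (2 * (D + 1 : ℕ) * C'')
    refine ⟨2 * C' + 2 + M, by omega, fun Γ L E _ _ _ _ _ ι φ hE hd hker htf k hk => ?_⟩
    have hk' : (1 : ℝ) ≤ k := by exact_mod_cast hk
    by_cases hA : ∀ u, ‖ι u‖ ≤ (2 * C' + 2 + M : ℕ) * k → φ u = 0 → ι u = 0
    · obtain ⟨r, b, hr, hb, hgen, hred⟩ := hbasis E L ι hE hd
      refine lattice_gap_of_injOn ι φ hker (by linarith) (hM.trans ?_) hk b hr hb hgen hred hA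
      push_cast
      have : (0 : ℝ) ≤ C' := by positivity
      linarith
    · push Not at hA
      obtain ⟨u₀, hu₀, hφ, hne⟩ := hA
      set W := Submodule.span ℝ {ι u₀} with hW
      have : IsClosed (W : Set E) := Submodule.closed_of_finiteDimensional W
      have hq0 : W.mkQ (ι u₀) = 0 := by
        simp [hW, Submodule.mem_span_singleton_self]
      have hker' : ∀ u, W.mkQ (ι u) = 0 → φ u = 0 := by
        intro u hu
        rw [Submodule.mkQ_apply, Submodule.Quotient.mk_eq_zero] at hu
        obtain ⟨s, hs⟩ := Submodule.mem_span_singleton.1 hu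
        have hfr : ∀ q : ℤ, ι (q • u - round (q * s) • u₀) = (q * s - round (q * s)) • ι u₀ := by
          intro q
          rw [map_sub, map_zsmul, map_zsmul, ← hs, sub_smul, Int.cast_smul_eq_zsmul, mul_smul,
            Int.cast_smul_eq_zsmul]
        have hmaps : ∀ q : ℤ, ‖ι (q • u - round (q * s) • u₀)‖ ≤ ‖ι u₀‖ := by
          intro q
          rw [hfr, norm_smul, Real.norm_eq_abs]
          have := abs_sub_round (q * s)
          nlinarith [norm_nonneg (ι u₀)]
        obtain ⟨q, -, q', -, hqq, he⟩ := Set.infinite_univ.exists_ne_map_eq_of_mapsTo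
          (f := fun q : ℤ => ι (q • u - round (q * s) • u₀)) (t := {v : E | ∃ u, ι u = v ∧
            ‖v‖ ≤ ‖ι u₀‖}) (fun q _ => ⟨_, rfl, hmaps q⟩) (hd ‖ι u₀‖)
        have h5 := hker _ ((map_sub ι _ _).trans (sub_eq_zero.2 he))
        simp only [map_sub, map_zsmul, hφ, smul_zero, sub_zero] at h5
        rw [← sub_smul] at h5
        exact htf _ _ h5 (sub_ne_zero.2 hqq)
      obtain ⟨J, hJ, w, N, hcard, hN, h1, h2, h3⟩ := ih Γ L (E ⧸ W) (W.mkQ.toAddMonoidHom.comp ι) φ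
        (finrank_quotient_span_singleton_le hE hne) (finite_quotient_ball ι hd u₀) hker' htf k hk
      simp only [AddMonoidHom.comp_apply, LinearMap.toAddMonoidHom_coe] at h1 h2
      refine ⟨J, hJ, w, N, by omega, hN, fun u hu => h1 u ?_, fun x hx => ?_, h3⟩
      · exact (Submodule.Quotient.norm_mk_le W _).trans hu
      · obtain ⟨u, hu, hφu⟩ := h2 x hx
        obtain ⟨n, hn⟩ := exists_lift_norm_le ι u₀ u (δ := k) (by linarith)
        refine ⟨u - n • u₀, hn.trans ?_, by rw [map_sub, map_zsmul, hφ, smul_zero, sub_zero, hφu]⟩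
        push_cast at hu₀ ⊢
        have : (0 : ℝ) ≤ M * k := by positivity
        nlinarith

/-- The `k`-fold sumset of a finite set. -/
def kfold {Γ : Type} [AddCommGroup Γ] [DecidableEq Γ] (X : Finset Γ) : ℕ → Finset Γ
  | 0 => 0
  | k + 1 => kfold X k + X

section kfold

variable {Γ : Type} [AddCommGroup Γ] [DecidableEq Γ] {X : Finset Γ}

lemma kfold_add (X : Finset Γ) (a b : ℕ) : kfold X (a + b) = kfold X a + kfold X b := by
  induction b with
  | zero => simp [kfold]
  | succ b ih => rw [← add_assoc, kfold, kfold, ih, add_assoc]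

lemma kfold_one (X : Finset Γ) : kfold X 1 = X := by
  simp [kfold]

lemma zero_mem_kfold (h0 : 0 ∈ X) (k : ℕ) : 0 ∈ kfold X k := by
  induction k with
  | zero => simp [kfold]
  | succ k ih => exact Finset.mem_add.2 ⟨0, ih, 0, h0, add_zero 0⟩

lemma kfold_mono (h0 : 0 ∈ X) : Monotone (kfold X) :=
  monotone_nat_of_le_succ fun _ _ hx => Finset.mem_add.2 ⟨_, hx, 0, h0, add_zero _⟩

lemma card_kfold_pos (h0 : 0 ∈ X) (k : ℕ) : 0 < (kfold X k).card :=
  Finset.card_pos.2 ⟨0, zero_mem_kfold h0 k⟩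

lemma neg_mem_kfold (hs : ∀ x ∈ X, -x ∈ X) {k : ℕ} {x : Γ} (hx : x ∈ kfold X k) :
    -x ∈ kfold X k := by
  induction k generalizing x with
  | zero => simpa [kfold] using hx
  | succ k ih =>
    obtain ⟨y, hy, z, hz, rfl⟩ := Finset.mem_add.1 hx
    exact Finset.mem_add.2 ⟨-y, ih hy, -z, hs z hz, by abel⟩

lemma add_mem_kfold {a b : ℕ} {x y : Γ} (hx : x ∈ kfold X a) (hy : y ∈ kfold X b) :
    x + y ∈ kfold X (a + b) := by
  rw [kfold_add]
  exact Finset.add_mem_add hx hy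

lemma nsmul_mem_kfold {x : Γ} (hx : x ∈ X) (n : ℕ) : n • x ∈ kfold X n := by
  induction n with
  | zero => simp [kfold]
  | succ n ih => rw [succ_nsmul]; exact Finset.add_mem_add ih hx

lemma zsmul_mem_kfold (hs : ∀ x ∈ X, -x ∈ X) {x : Γ} (hx : x ∈ X) (n : ℤ) :
    n • x ∈ kfold X n.natAbs := by
  obtain ⟨k, rfl | rfl⟩ := n.eq_nat_or_neg
  · rw [natCast_zsmul, Int.natAbs_natCast]
    exact nsmul_mem_kfold hx _
  · rw [neg_smul, natCast_zsmul, Int.natAbs_neg, Int.natAbs_natCast]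
    exact neg_mem_kfold hs (nsmul_mem_kfold hx _)

lemma sum_zsmul_mem_kfold (hs : ∀ x ∈ X, -x ∈ X) {J : Type} (s : Finset J) (e : J → Γ)
    (he : ∀ i, e i ∈ X) (n : J → ℤ) : ∑ i ∈ s, n i • e i ∈ kfold X (∑ i ∈ s, (n i).natAbs) := by
  classical
  induction s using Finset.induction_on with
  | empty => simp [kfold]
  | insert a s ha ih =>
    rw [Finset.sum_insert ha, Finset.sum_insert ha]
    exact add_mem_kfold (zsmul_mem_kfold hs (he a) _) ih

end kfold

section Characters

variable {d N : ℕ} [NeZero N]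

/-- The pairing of `(ℤ/N)^d` with itself. -/
noncomputable def pairing (a b : Fin d → ZMod N) : ℂ := ZMod.stdAddChar (a ⬝ᵥ b)

lemma pairing_comm (a b : Fin d → ZMod N) : pairing a b = pairing b a := by
  rw [pairing, dotProduct_comm, pairing]

lemma pairing_add (a b c : Fin d → ZMod N) : pairing a (b + c) = pairing a b * pairing a c := by
  rw [pairing, dotProduct_add, AddChar.map_add_eq_mul, pairing, pairing]

lemma pairing_zero (a : Fin d → ZMod N) : pairing a 0 = 1 := by
  rw [pairing, dotProduct_zero, AddChar.map_zero_eq_one]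

lemma norm_pairing (a b : Fin d → ZMod N) : ‖pairing a b‖ = 1 := by
  rw [pairing]
  exact AddChar.norm_apply _ _

lemma pairing_neg (a b : Fin d → ZMod N) : pairing a (-b) = starRingEnd ℂ (pairing a b) := by
  rw [pairing, dotProduct_neg, pairing, AddChar.map_neg_eq_conj]

lemma sum_pairing (b : Fin d → ZMod N) :
    ∑ a, pairing a b = if b = 0 then (Fintype.card (Fin d → ZMod N) : ℂ) else 0 := by
  let ψ : AddChar (Fin d → ZMod N) ℂ :=
    { toFun := fun a => pairing b a
      map_zero_eq_one' := pairing_zero b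
      map_add_eq_mul' := pairing_add b }
  have h : ψ = 0 ↔ b = 0 := by
    constructor
    · intro h
      funext i
      have h1 : pairing b (Pi.single i 1) = 1 := by
        change ψ _ = 1
        rw [h]; rfl
      rw [pairing, dotProduct_single, mul_one, ← AddChar.map_zero_eq_one (ZMod.stdAddChar (N := N))]
        at h1
      exact ZMod.injective_stdAddChar h1
    · rintro rfl
      ext a
      change pairing 0 a = 1
      rw [pairing_comm, pairing_zero]
  have h2 := AddChar.sum_eq_ite ψ
  simp only [h] at h2
  rw [← h2]
  exact Finset.sum_congr rfl fun a _ => pairing_comm _ _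

lemma sum_pairing_sub (x y : Fin d → ZMod N) :
    ∑ a, pairing a x * starRingEnd ℂ (pairing a y) =
      if x = y then (Fintype.card (Fin d → ZMod N) : ℂ) else 0 := by
  simp_rw [← pairing_neg, ← pairing_add, sum_pairing, ← sub_eq_add_neg, sub_eq_zero]

/-- Parseval's identity for the indicator function of a set. -/
lemma sum_norm_sum_pairing_sq (S : Finset (Fin d → ZMod N)) :
    ∑ a, ‖∑ b ∈ S, pairing a b‖ ^ 2 = (Fintype.card (Fin d → ZMod N) : ℝ) * S.card := by
  have h : ∀ a : Fin d → ZMod N, ((‖∑ b ∈ S, pairing a b‖ ^ 2 : ℝ) : ℂ) =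
      ∑ b ∈ S, ∑ c ∈ S, pairing a b * starRingEnd ℂ (pairing a c) := by
    intro a
    rw [Complex.ofReal_pow, ← Complex.mul_conj', map_sum, Finset.sum_mul_sum]
  have h2 : ((∑ a, ‖∑ b ∈ S, pairing a b‖ ^ 2 : ℝ) : ℂ) =
      (Fintype.card (Fin d → ZMod N) : ℂ) * S.card := by
    rw [Complex.ofReal_sum]
    simp_rw [h]
    rw [Finset.sum_comm]
    simp_rw [Finset.sum_comm (s := Finset.univ) (t := S), sum_pairing_sub]
    simp [mul_comm]
  exact_mod_cast h2

/-- Reduction modulo `N`. -/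
def redMod (d N : ℕ) : (Fin d → ℤ) →+ (Fin d → ZMod N) where
  toFun x i := (x i : ZMod N)
  map_zero' := by ext; simp
  map_add' x y := by ext; simp

lemma redMod_injOn {d N : ℕ} {x y : Fin d → ℤ} (hx : ∀ i, 2 * |x i| < N) (hy : ∀ i, 2 * |y i| < N)
    (h : redMod d N x = redMod d N y) : x = y := by
  funext i
  have h1 : ((x i : ℤ) : ZMod N) = (y i : ℤ) := congrFun h i
  rw [ZMod.intCast_eq_intCast_iff_dvd_sub] at h1
  have h2 : |y i - x i| < N := by
    have := abs_sub (y i) (x i)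
    have := hx i
    have := hy i
    omega
  have := Int.eq_zero_of_abs_lt_dvd h1 h2
  omega

end Characters

section Spectrum

variable {d N : ℕ} [NeZero N]

/-- A set of small doubling has a large spectrum. -/
lemma card_le_card_spectrum (Y : Finset (Fin d → ZMod N)) (hY : Y.Nonempty) {κ : ℝ} (hκ : 0 < κ)
    (hdbl : ((Y + Y).card : ℝ) ≤ κ ^ 2 * Y.card) (S : Finset (Fin d → ZMod N))
    (hS : ∀ a, a ∉ S → 2 * κ * ‖∑ b ∈ Y, pairing a b‖ ≤ Y.card) :
    (Fintype.card (Fin d → ZMod N) : ℝ) ≤ 2 * κ ^ 2 * Y.card * S.card := by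
  set f : (Fin d → ZMod N) → ℂ := fun a => ∑ b ∈ Y, pairing a b with hf
  set g : (Fin d → ZMod N) → ℂ := fun a => ∑ b ∈ Y + Y, pairing a b with hg
  set M : ℝ := (Fintype.card (Fin d → ZMod N) : ℝ) with hM
  have hYpos : (0 : ℝ) < Y.card := by exact_mod_cast hY.card_pos
  have h1 : ∑ a, f a ^ 2 * starRingEnd ℂ (g a) =
      (Fintype.card (Fin d → ZMod N) : ℂ) * Y.card ^ 2 := by
    have : ∀ a, f a ^ 2 * starRingEnd ℂ (g a) = ∑ b ∈ Y, ∑ c ∈ Y, ∑ z ∈ Y + Y,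
        pairing a (b + c) * starRingEnd ℂ (pairing a z) := by
      intro a
      simp only [hf, hg]
      rw [sq, Finset.sum_mul_sum, map_sum, Finset.sum_mul]
      refine Finset.sum_congr rfl fun b _ => ?_
      rw [Finset.sum_mul]
      refine Finset.sum_congr rfl fun c _ => ?_
      rw [Finset.mul_sum]
      exact Finset.sum_congr rfl fun z _ => by rw [pairing_add]
    simp_rw [this]
    rw [Finset.sum_comm]
    simp_rw [Finset.sum_comm (s := Finset.univ), sum_pairing_sub]
    have h2 : ∀ b ∈ Y, ∑ c ∈ Y, ∑ z ∈ Y + Y,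
        (if b + c = z then (Fintype.card (Fin d → ZMod N) : ℂ) else 0) =
        Y.card * (Fintype.card (Fin d → ZMod N) : ℂ) := by
      intro b hb
      rw [Finset.sum_congr rfl fun c hc => by
        rw [Finset.sum_ite_eq, if_pos (Finset.add_mem_add hb hc)], Finset.sum_const, nsmul_eq_mul]
    rw [Finset.sum_congr rfl h2, Finset.sum_const, nsmul_eq_mul]
    ring
  have h2 : M * Y.card ^ 2 ≤ ∑ a, ‖f a‖ ^ 2 * ‖g a‖ := by
    have h3 : ‖∑ a, f a ^ 2 * starRingEnd ℂ (g a)‖ = M * Y.card ^ 2 := by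
      rw [h1, norm_mul, norm_pow]
      simp [hM]
    rw [← h3]
    refine (norm_sum_le _ _).trans (Finset.sum_le_sum fun a _ => ?_)
    rw [norm_mul, norm_pow, RCLike.norm_conj]
  have hfg : ∀ (T : Finset (Fin d → ZMod N)) (a), ‖∑ b ∈ T, pairing a b‖ ≤ T.card := by
    intro T a
    refine (norm_sum_le _ _).trans ?_
    simp [norm_pairing]
  have h3 : ∀ a, ‖f a‖ ^ 2 * ‖g a‖ ≤ (if a ∈ S then (Y.card : ℝ) ^ 2 * (κ ^ 2 * Y.card) else 0) +
      Y.card / (2 * κ) * ((κ * ‖f a‖ ^ 2 + ‖g a‖ ^ 2 / κ) / 2) := by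
    intro a
    have hpos : 0 ≤ (κ * ‖f a‖ ^ 2 + ‖g a‖ ^ 2 / κ) / 2 := by positivity
    split_ifs with ha
    · have := hfg Y a
      have h4 := (hfg (Y + Y) a).trans hdbl
      have : ‖f a‖ ^ 2 * ‖g a‖ ≤ (Y.card : ℝ) ^ 2 * (κ ^ 2 * Y.card) := by gcongr
      have : 0 ≤ Y.card / (2 * κ) * ((κ * ‖f a‖ ^ 2 + ‖g a‖ ^ 2 / κ) / 2) := by positivity
      linarith
    · rw [zero_add]
      have h4 : ‖f a‖ ≤ Y.card / (2 * κ) := by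
        rw [le_div_iff₀ (by positivity), mul_comm]
        exact hS a ha
      have h5 : ‖f a‖ * ‖g a‖ ≤ (κ * ‖f a‖ ^ 2 + ‖g a‖ ^ 2 / κ) / 2 := by
        have h6 : (κ * ‖f a‖ ^ 2 + ‖g a‖ ^ 2 / κ) / 2 - ‖f a‖ * ‖g a‖ =
            (κ * ‖f a‖ - ‖g a‖) ^ 2 / (2 * κ) := by
          field_simp
          ring
        have : 0 ≤ (κ * ‖f a‖ - ‖g a‖) ^ 2 / (2 * κ) := by positivity
        linarith
      calc ‖f a‖ ^ 2 * ‖g a‖ = ‖f a‖ * (‖f a‖ * ‖g a‖) := by ring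
        _ ≤ _ := by gcongr
  have h4 := h2.trans (Finset.sum_le_sum fun a _ => h3 a)
  rw [Finset.sum_add_distrib, ← Finset.mul_sum, ← Finset.sum_div, Finset.sum_add_distrib,
    ← Finset.mul_sum, ← Finset.sum_div, sum_norm_sum_pairing_sq, sum_norm_sum_pairing_sq,
    Finset.sum_ite_mem, Finset.univ_inter, Finset.sum_const, nsmul_eq_mul] at h4
  have h5 : Y.card / (2 * κ) * ((κ * (M * Y.card) + M * (Y + Y).card / κ) / 2) ≤
      M * Y.card ^ 2 / 2 := by
    calc _ ≤ Y.card / (2 * κ) * ((κ * (M * Y.card) + M * (κ ^ 2 * Y.card) / κ) / 2) := by gcongr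
      _ = _ := by field_simp; ring
  have h6 : M * (Y.card : ℝ) ^ 2 ≤ (2 * κ ^ 2 * Y.card * S.card) * Y.card ^ 2 := by linarith
  exact le_of_mul_le_mul_right h6 (by positivity)

/-- Characters in the spectrum are almost constant on almost-periods. -/
lemma norm_one_sub_pairing_le (Y : Finset (Fin d → ZMod N)) (hY : Y.Nonempty) {κ η : ℝ}
    (hκ : 0 < κ) {a y : Fin d → ZMod N} (ha : Y.card ≤ 2 * κ * ‖∑ b ∈ Y, pairing a b‖)
    (W : Finset (Fin d → ZMod N)) (hYW : Y ⊆ W) (hyW : ∀ z ∈ Y, y + z ∈ W)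
    (hW : (W.card : ℝ) ≤ (1 + η) * Y.card) : ‖1 - pairing a y‖ ≤ 4 * κ * η := by
  classical
  have hYpos : (0 : ℝ) < Y.card := by exact_mod_cast hY.card_pos
  set Y' := Y.image (fun z => y + z) with hY'
  have hinj : Function.Injective (fun z => y + z) := add_right_injective y
  have hcard : Y'.card = Y.card := Finset.card_image_of_injective _ hinj
  have h1 : (∑ b ∈ Y, pairing a b) * pairing a y = ∑ b ∈ Y', pairing a b := by
    rw [hY', Finset.sum_image hinj.injOn, Finset.sum_mul]
    exact Finset.sum_congr rfl fun z _ => by rw [pairing_add, mul_comm]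
  have h2 : ‖∑ b ∈ Y \ Y', pairing a b‖ ≤ (Y \ Y').card := by
    refine (norm_sum_le _ _).trans ?_
    simp [norm_pairing]
  have h3 : ‖∑ b ∈ Y' \ Y, pairing a b‖ ≤ (Y' \ Y).card := by
    refine (norm_sum_le _ _).trans ?_
    simp [norm_pairing]
  have h4 : (∑ b ∈ Y, pairing a b) * (1 - pairing a y) =
      ∑ b ∈ Y \ Y', pairing a b - ∑ b ∈ Y' \ Y, pairing a b := by
    rw [mul_sub, mul_one, h1, Finset.sum_sdiff_sub_sum_sdiff]
  have h5 : (Y' \ Y).card = (Y \ Y').card := Finset.card_sdiff_comm hcard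
  have h6 : ((Y' \ Y).card : ℝ) ≤ η * Y.card := by
    have : (Y' \ Y).card + Y.card ≤ W.card := by
      rw [← Finset.card_union_of_disjoint Finset.sdiff_disjoint]
      refine Finset.card_le_card (Finset.union_subset ?_ hYW)
      refine Finset.sdiff_subset.trans ?_
      intro z hz
      obtain ⟨w, hw, rfl⟩ := Finset.mem_image.1 hz
      exact hyW w hw
    have : ((Y' \ Y).card : ℝ) + Y.card ≤ W.card := by exact_mod_cast this
    linarith
  have h7 : ‖∑ b ∈ Y, pairing a b‖ * ‖1 - pairing a y‖ ≤ 2 * (η * Y.card) := by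
    rw [← norm_mul, h4]
    refine (norm_sub_le _ _).trans ?_
    rw [← h5] at h2
    linarith
  have h8 := norm_nonneg (1 - pairing a y)
  have h9 : Y.card * ‖1 - pairing a y‖ ≤ Y.card * (4 * κ * η) := by
    calc _ ≤ (2 * κ * ‖∑ b ∈ Y, pairing a b‖) * ‖1 - pairing a y‖ := by gcongr
      _ = 2 * κ * (‖∑ b ∈ Y, pairing a b‖ * ‖1 - pairing a y‖) := by ring
      _ ≤ 2 * κ * (2 * (η * Y.card)) := by gcongr
      _ = _ := by ring
  exact le_of_mul_le_mul_left h9 hYpos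

/-- A set on which all characters of `S` have large real part is small. -/
lemma card_mul_card_le (S T : Finset (Fin d → ZMod N))
    (h : ∀ x ∈ T, (S.card : ℝ) / 2 ≤ ‖∑ a ∈ S, pairing a x‖) :
    (T.card : ℝ) * S.card ≤ 4 * Fintype.card (Fin d → ZMod N) := by
  rcases S.eq_empty_or_nonempty with rfl | hS
  · simp
  have hSpos : (0 : ℝ) < S.card := by exact_mod_cast hS.card_pos
  have h1 : (T.card : ℝ) * ((S.card : ℝ) / 2) ^ 2 ≤ ∑ x, ‖∑ a ∈ S, pairing x a‖ ^ 2 := by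
    rw [← nsmul_eq_mul, ← Finset.sum_const]
    refine (Finset.sum_le_sum fun x hx => ?_).trans
      (Finset.sum_le_sum_of_subset_of_nonneg (Finset.subset_univ T) fun _ _ _ => by positivity)
    have := h x hx
    simp_rw [pairing_comm x]
    gcongr
  rw [sum_norm_sum_pairing_sq] at h1
  nlinarith

end Spectrum

section Angle

variable {N : ℕ} [NeZero N]

/-- The representative in `(-1/2, 1/2]` of the angle of the character value at `a`. -/
noncomputable def angle (a : ZMod N) : ℝ := a.valMinAbs / N

lemma stdAddChar_eq_exp (a : ZMod N) :
    ZMod.stdAddChar a = Complex.exp (Complex.I * ((2 * Real.pi * angle a : ℝ) : ℂ)) := by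
  conv_lhs => rw [← ZMod.coe_valMinAbs a, ZMod.stdAddChar_coe]
  congr 1
  rw [angle]
  push_cast
  ring

lemma abs_angle_le (a : ZMod N) : |angle a| ≤ 1 / 2 := by
  have hN : (0 : ℝ) < N := by exact_mod_cast NeZero.pos N
  have h := ZMod.natAbs_valMinAbs_le a
  have h1 : 2 * a.valMinAbs.natAbs ≤ N := by omega
  have h2 : 2 * |(a.valMinAbs : ℝ)| ≤ N := by
    rw [← Int.cast_abs, Int.abs_eq_natAbs]
    exact_mod_cast h1
  rw [angle, abs_div, abs_of_pos hN, div_le_iff₀ hN]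
  linarith

lemma abs_angle_le_norm (a : ZMod N) : 4 * |angle a| ≤ ‖1 - (ZMod.stdAddChar a : ℂ)‖ := by
  rw [norm_sub_rev, stdAddChar_eq_exp, Complex.norm_exp_I_mul_ofReal_sub_one, Real.norm_eq_abs,
    abs_mul, abs_two]
  have h := abs_angle_le a
  have h1 : 2 * Real.pi * angle a / 2 = Real.pi * angle a := by ring
  rw [h1]
  have h2 : |Real.pi * angle a| ≤ Real.pi / 2 := by
    rw [abs_mul, abs_of_pos Real.pi_pos]
    nlinarith [Real.pi_pos]
  have h3 := Real.mul_abs_le_abs_sin h2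
  rw [abs_mul, abs_of_pos Real.pi_pos] at h3
  have h4 : 2 / Real.pi * (Real.pi * |angle a|) = 2 * |angle a| := by
    field_simp
  linarith

lemma valMinAbs_intCast {n : ℤ} (h : 2 * |n| < N) : ((n : ZMod N)).valMinAbs = n := by
  rw [ZMod.valMinAbs_spec]
  refine ⟨rfl, ?_⟩
  have := abs_lt.1 (show |n| < (N : ℤ) by have := abs_nonneg n; omega)
  have h1 := neg_abs_le n
  have h2 := le_abs_self n
  constructor <;> omega

/-- If the first `j` multiples of `a` have small angle, the angle of `a` is smaller by a factor
`j`. -/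
lemma mul_abs_angle_le {a : ZMod N} {j : ℕ} {t : ℝ} (ht : t < 1 / 4)
    (h : ∀ i : ℕ, i ≤ j → |angle ((i : ZMod N) * a)| ≤ t) : j * |angle a| ≤ t := by
  have hN : (0 : ℝ) < N := by exact_mod_cast NeZero.pos N
  have key : ∀ i : ℕ, i ≤ j → i * |angle a| ≤ t := by
    intro i
    induction i with
    | zero =>
      intro _
      simpa using (abs_nonneg _).trans (h 0 (Nat.zero_le _))
    | succ i ih =>
      intro hi
      have h1 := ih (by omega)
      have h2 : |angle a| ≤ t := by simpa using h 1 (by omega)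
      have h3 : ((i + 1 : ℕ) : ℝ) * |angle a| < 1 / 2 := by push_cast; linarith
      have h4 : ((((i + 1 : ℕ) : ℤ) * a.valMinAbs : ℤ) : ZMod N) = ((i + 1 : ℕ) : ZMod N) * a := by
        push_cast
        simp
      have h5 : 2 * |((i + 1 : ℕ) : ℤ) * a.valMinAbs| < N := by
        have h6 : 2 * (((i + 1 : ℕ) : ℝ) * |(a.valMinAbs : ℝ)|) < N := by
          rw [angle, abs_div, abs_of_pos hN, ← mul_div_assoc, div_lt_iff₀ hN] at h3
          linarith
        rw [abs_mul, Nat.abs_cast]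
        exact_mod_cast h6
      have h7 := h (i + 1) hi
      rw [← h4, angle, valMinAbs_intCast h5] at h7
      rw [angle]
      push_cast at h7 ⊢
      rw [mul_div_assoc, abs_mul] at h7
      rwa [abs_of_nonneg (by positivity : (0 : ℝ) ≤ (i : ℝ) + 1)] at h7
  exact key j le_rfl

lemma half_le_re_stdAddChar {θ : ℝ} (hθ : |θ| ≤ 1 / 8) :
    1 / 2 ≤ (Complex.exp (Complex.I * ((2 * Real.pi * θ : ℝ) : ℂ))).re := by
  rw [mul_comm, Complex.exp_ofReal_mul_I_re]
  have h := Real.pi_pos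
  rw [← Real.cos_pi_div_three, ← Real.cos_abs (2 * Real.pi * θ)]
  refine Real.cos_le_cos_of_nonneg_of_le_pi (abs_nonneg _) (by linarith) ?_
  rw [abs_mul, abs_of_pos (by positivity)]
  nlinarith

end Angle

/-- The homomorphism from formal integer combinations to actual ones. -/
def combHom {α M : Type} [Fintype α] [AddCommGroup M] (t : α → M) : (α → ℤ) →+ M where
  toFun c := ∑ x, c x • t x
  map_zero' := by simp
  map_add' c c' := by simp [add_smul, Finset.sum_add_distrib]

lemma combHom_apply {α M : Type} [Fintype α] [AddCommGroup M] (t : α → M) (c : α → ℤ) :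
    combHom t c = ∑ x, c x • t x := rfl

lemma combHom_apply_apply {α I R : Type} [Fintype α] [Ring R] (t : α → I → R) (c : α → ℤ) (i : I) :
    combHom t c i = ∑ x, (c x : R) * t x i := by
  rw [combHom_apply, Finset.sum_apply]
  exact Finset.sum_congr rfl fun x _ => by rw [Pi.smul_apply, zsmul_eq_mul]

lemma combHom_single {α M : Type} [Fintype α] [DecidableEq α] [AddCommGroup M] (t : α → M) (x : α)
    (n : ℤ) : combHom t (Pi.single x n) = n • t x := by
  rw [combHom_apply, Finset.sum_eq_single x]
  · simp
  · intro y _ hy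
    simp [hy]
  · simp

/-- The elements of a lattice of bounded norm are finite in number when the coordinates have a
common denominator. -/
lemma finite_ball_of_denominator {I L : Type} [Fintype I] [AddCommGroup L] (ι : L →+ (I → ℝ))
    {N : ℝ} (hN : 0 < N) (h : ∀ u i, ∃ n : ℤ, ι u i = n / N) (R : ℝ) :
    {v : I → ℝ | ∃ u, ι u = v ∧ ‖v‖ ≤ R}.Finite := by
  classical
  refine ((Set.finite_Icc (fun _ : I => -⌈N * R⌉) (fun _ => ⌈N * R⌉)).image
    (fun n : I → ℤ => fun i => (n i : ℝ) / N)).subset ?_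
  rintro _ ⟨u, rfl, hu⟩
  choose n hn using h u
  have h1 : ∀ i, |(n i : ℝ)| ≤ N * R := by
    intro i
    have h2 := (norm_le_pi_norm (ι u) i).trans hu
    rw [hn, Real.norm_eq_abs, abs_div, abs_of_pos hN, div_le_iff₀ hN] at h2
    linarith
  refine ⟨n, ⟨fun i => ?_, fun i => ?_⟩, funext fun i => (hn i).symm⟩
  · have h3 := (abs_le.1 (h1 i)).1
    have h4 := Int.le_ceil (N * R)
    have : (-⌈N * R⌉ : ℝ) ≤ n i := by linarith
    exact_mod_cast this
  · have h3 := (abs_le.1 (h1 i)).2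
    have h4 := Int.le_ceil (N * R)
    have : (n i : ℝ) ≤ ⌈N * R⌉ := by linarith
    exact_mod_cast this

lemma AddChar.map_sum_eq_finset_prod {α A R : Type} [AddCommMonoid A] [CommMonoid R]
    (ψ : AddChar A R) (s : Finset α) (f : α → A) : ψ (∑ i ∈ s, f i) = ∏ i ∈ s, ψ (f i) := by
  classical
  induction s using Finset.induction_on with
  | empty => simp
  | insert a s ha ih => rw [Finset.sum_insert ha, Finset.prod_insert ha, ψ.map_add_eq_mul, ih]

lemma exp_sum_angle {d N : ℕ} [NeZero N] (X : Finset (Fin d → ℤ)) (a : Fin d → ZMod N)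
    (c : X → ℤ) :
    Complex.exp (Complex.I * ((2 * Real.pi *
      ∑ x : X, c x * angle (a ⬝ᵥ redMod d N x) : ℝ) : ℂ)) =
      pairing a (redMod d N (combHom (fun x : X => (x : Fin d → ℤ)) c)) := by
  have h1 : Complex.I * ((2 * Real.pi * ∑ x : X, c x * angle (a ⬝ᵥ redMod d N x) : ℝ) : ℂ) =
      ∑ x : X, (c x : ℂ) * (Complex.I * ((2 * Real.pi * angle (a ⬝ᵥ redMod d N x) : ℝ) : ℂ)) := by
    rw [Finset.mul_sum, Complex.ofReal_sum, Finset.mul_sum]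
    refine Finset.sum_congr rfl fun x _ => ?_
    push_cast
    ring
  rw [h1, Complex.exp_sum, combHom_apply, map_sum, pairing, dotProduct_sum,
    AddChar.map_sum_eq_finset_prod]
  refine Finset.prod_congr rfl fun x _ => ?_
  rw [Complex.exp_int_mul, ← stdAddChar_eq_exp, map_zsmul, dotProduct_smul,
    AddChar.map_zsmul_eq_zpow]

/-- The lattice attached to the spectrum of an iterated sumset. -/
theorem exists_bohr_lattice {d : ℕ} (X : Finset (Fin d → ℤ)) (h0 : 0 ∈ X)
    {κ : ℝ} (hκ : 0 < κ) {l j : ℕ} (hl : 1 ≤ l) (hj : 1 ≤ j)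
    (hdbl : ((kfold X (2 * l)).card : ℝ) ≤ κ ^ 2 * (kfold X l).card)
    (hgrow : ((kfold X (l + j)).card : ℝ) ≤ (1 + 1 / (64 * κ)) * (kfold X l).card) (hjl : j ≤ l) :
    ∃ (I : Type) (_ : Fintype I) (ι : (X → ℤ) →+ (I → ℝ)),
      (∀ x, ‖ι (Pi.single x 1)‖ * (64 * j) ≤ 1) ∧
      (∀ u, ι u = 0 → combHom (fun x : X => (x : Fin d → ℤ)) u = 0) ∧
      (∀ R : ℝ, {v : I → ℝ | ∃ u, ι u = v ∧ ‖v‖ ≤ R}.Finite) ∧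
      ∀ Z : Finset (I → ℝ), (∀ z ∈ Z, ∃ u, ι u = z ∧ ‖z‖ ≤ 1 / 8) →
        (Z.card : ℝ) ≤ 8 * κ ^ 2 * (kfold X l).card := by
  classical
  obtain ⟨N, hN⟩ : ∃ N : ℕ, (N : ℤ) = 1 + 64 * j * ∑ x ∈ kfold X (2 * l), ∑ i, |x i| := by
    refine ⟨(1 + 64 * j * ∑ x ∈ kfold X (2 * l), ∑ i, |x i|).toNat, Int.toNat_of_nonneg ?_⟩
    positivity
  have hNpos : 0 < N := by
    have : (0 : ℤ) < N := by rw [hN]; positivity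
    exact_mod_cast this
  have : NeZero N := ⟨hNpos.ne'⟩
  have hNR : (0 : ℝ) < N := by exact_mod_cast hNpos
  have hbig : ∀ x ∈ kfold X (2 * l), ∀ i, 64 * j * |x i| < N := by
    intro x hx i
    have h1 : |x i| ≤ ∑ i, |x i| :=
      Finset.single_le_sum (f := fun i => |x i|) (fun i _ => abs_nonneg _) (Finset.mem_univ i)
    have h2 : ∑ i, |x i| ≤ ∑ x ∈ kfold X (2 * l), ∑ i, |x i| :=
      Finset.single_le_sum (f := fun x : Fin d → ℤ => ∑ i, |x i|)
        (fun x _ => Finset.sum_nonneg fun i _ => abs_nonneg _) hx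
    have h3 : (64 * j : ℤ) * |x i| ≤ 64 * j * ∑ x ∈ kfold X (2 * l), ∑ i, |x i| := by
      gcongr
      exact h1.trans h2
    omega
  have hinj : Set.InjOn (redMod d N) (kfold X (2 * l) : Set (Fin d → ℤ)) := by
    have h2 : ∀ x ∈ kfold X (2 * l), ∀ i, 2 * |x i| < N := by
      intro x hx i
      have h3 := hbig x hx i
      have : (1 : ℤ) ≤ j := by exact_mod_cast hj
      nlinarith [abs_nonneg (x i)]
    exact fun x hx y hy h => redMod_injOn (h2 x hx) (h2 y hy) h
  have hcard : ∀ i ≤ 2 * l, ((kfold X i).image (redMod d N)).card = (kfold X i).card :=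
    fun i hi => Finset.card_image_of_injOn (hinj.mono (by exact_mod_cast kfold_mono h0 hi))
  set Y := (kfold X l).image (redMod d N) with hYdef
  have hYcard : Y.card = (kfold X l).card := hcard l (by omega)
  have hYne : Y.Nonempty := ⟨_, Finset.mem_image_of_mem _ (zero_mem_kfold h0 l)⟩
  set S := Finset.univ.filter fun a => (Y.card : ℝ) ≤ 2 * κ * ‖∑ b ∈ Y, pairing a b‖ with hSdef
  have hScard : (Fintype.card (Fin d → ZMod N) : ℝ) ≤ 2 * κ ^ 2 * Y.card * S.card := by
    refine card_le_card_spectrum Y hYne hκ ?_ S fun a ha => ?_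
    · rw [hYdef, ← Finset.image_add, ← kfold_add, ← two_mul, hcard _ le_rfl, hcard _ (by omega)]
      exact hdbl
    · simp only [hSdef, Finset.mem_filter, Finset.mem_univ, true_and, not_le] at ha
      exact ha.le
  have hSpos : (0 : ℝ) < S.card := by
    have : (0 : ℝ) < Fintype.card (Fin d → ZMod N) := by exact_mod_cast Fintype.card_pos
    by_contra h
    have h1 : (S.card : ℝ) = 0 := le_antisymm (not_lt.1 h) (by positivity)
    rw [h1, mul_zero] at hScard
    linarith
  have hangle : ∀ a ∈ S, ∀ x ∈ X, j * |angle (a ⬝ᵥ redMod d N x)| ≤ 1 / 64 := by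
    intro a ha x hx
    refine mul_abs_angle_le (by norm_num) fun i hi => ?_
    have h1 : (i : ZMod N) * (a ⬝ᵥ redMod d N x) = a ⬝ᵥ redMod d N (i • x) := by
      rw [map_nsmul, dotProduct_smul, nsmul_eq_mul]
    rw [h1]
    have h2 := abs_angle_le_norm (a ⬝ᵥ redMod d N (i • x))
    have h3 := norm_one_sub_pairing_le (y := redMod d N (i • x)) Y hYne hκ
      (Finset.mem_filter.1 ha).2
      ((kfold X (l + j)).image (redMod d N))
      (Finset.image_subset_image (kfold_mono h0 (by omega))) (fun z hz => by
        obtain ⟨w, hw, rfl⟩ := Finset.mem_image.1 hz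
        rw [← map_add, add_comm (i • x)]
        exact Finset.mem_image_of_mem _ (add_mem_kfold hw
          (kfold_mono h0 hi (nsmul_mem_kfold hx i))))
      (by rw [hcard _ (by omega), hYcard]; exact hgrow)
    have h4 : 4 * κ * (1 / (64 * κ)) = 4 / 64 := by field_simp
    rw [h4] at h3
    rw [pairing] at h3
    linarith
  set t : X → (Fin d ⊕ (Fin d → ZMod N)) → ℝ := fun x => Sum.elim (fun i => (x.1 i : ℝ) / N)
    (fun a => if a ∈ S then angle (a ⬝ᵥ redMod d N x) else 0) with ht
  set φ := combHom (fun x : X => (x : Fin d → ℤ)) with hφ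
  have hinl : ∀ u i, combHom t u (Sum.inl i) = (φ u i : ℝ) / N := by
    intro u i
    rw [hφ, combHom_apply_apply, combHom_apply_apply, Int.cast_sum, Finset.sum_div]
    refine Finset.sum_congr rfl fun x _ => ?_
    simp only [ht, Sum.elim_inl, Int.cast_mul, Int.cast_id]
    ring
  have hinr : ∀ u, ∀ a ∈ S, combHom t u (Sum.inr a) =
      ∑ x : X, u x * angle (a ⬝ᵥ redMod d N x) := by
    intro u a ha
    rw [combHom_apply_apply]
    simp only [ht, Sum.elim_inr, if_pos ha]
  have hinr0 : ∀ u, ∀ a ∉ S, combHom t u (Sum.inr a) = 0 := by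
    intro u a ha
    rw [combHom_apply_apply]
    simp only [ht, Sum.elim_inr, if_neg ha, mul_zero, Finset.sum_const_zero]
  have hexp : ∀ u, ∀ a ∈ S, Complex.exp (Complex.I *
      ((2 * Real.pi * combHom t u (Sum.inr a) : ℝ) : ℂ)) = pairing a (redMod d N (φ u)) := by
    intro u a ha
    rw [hinr u a ha]
    exact exp_sum_angle X a u
  refine ⟨_, inferInstance, combHom t, ?_, ?_, ?_, ?_⟩
  · intro x
    have hjpos : (0 : ℝ) < j := by exact_mod_cast hj
    rw [combHom_single, one_smul, ← le_div_iff₀ (by positivity), pi_norm_le_iff_of_nonneg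
      (by positivity)]
    rintro (i | a)
    · simp only [ht, Sum.elim_inl, Real.norm_eq_abs]
      rw [abs_div, abs_of_pos hNR, div_le_div_iff₀ hNR (by positivity)]
      have h1 := hbig x (kfold_mono h0 (by omega : 1 ≤ 2 * l) (by rw [kfold_one]; exact x.2)) i
      have h2 : (64 * j * |(x.1 i : ℝ)|) < N := by exact_mod_cast h1
      linarith
    · simp only [ht, Sum.elim_inr, Real.norm_eq_abs]
      split_ifs with ha
      · have h1 := hangle a ha x x.2
        rw [le_div_iff₀ (by positivity)]
        linarith
      · rw [abs_zero]
        positivity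
  · intro u hu
    funext i
    have h1 := hinl u i
    rw [hu, Pi.zero_apply, eq_comm, div_eq_zero_iff, or_iff_left hNR.ne'] at h1
    exact_mod_cast h1
  · refine finite_ball_of_denominator _ hNR fun u i => ?_
    rcases i with i | a
    · exact ⟨_, hinl u i⟩
    · by_cases ha : a ∈ S
      · refine ⟨∑ x : X, u x * (a ⬝ᵥ redMod d N x).valMinAbs, ?_⟩
        rw [hinr u a ha, Int.cast_sum, Finset.sum_div]
        refine Finset.sum_congr rfl fun x _ => ?_
        rw [angle]
        push_cast
        ring
      · exact ⟨0, by rw [hinr0 u a ha]; simp⟩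
  · intro Z hZ
    choose! u hu hunorm using hZ
    have hcoord : ∀ z ∈ Z, ∀ i, |z i| ≤ 1 / 8 := fun z hz i =>
      (norm_le_pi_norm z i).trans (hunorm z hz)
    have hinjZ : Set.InjOn (fun z => redMod d N (φ (u z))) (Z : Set _) := by
      intro z hz z' hz' h
      have hz := Finset.mem_coe.1 hz
      have hz' := Finset.mem_coe.1 hz'
      have hsmall : ∀ z ∈ Z, ∀ i, 2 * |φ (u z) i| < N := by
        intro z hz i
        have h1 := hcoord z hz (Sum.inl i)
        rw [← hu z hz, hinl, abs_div, abs_of_pos hNR, div_le_iff₀ hNR] at h1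
        have h2 : 2 * |(φ (u z) i : ℝ)| < N := by linarith
        exact_mod_cast h2
      have h1 : φ (u z) = φ (u z') := redMod_injOn (hsmall z hz) (hsmall z' hz') h
      rw [← hu z hz, ← hu z' hz']
      funext i
      rcases i with i | a
      · rw [hinl, hinl, h1]
      · by_cases ha : a ∈ S
        · have h2 := (hexp (u z) a ha).trans ((congrArg (pairing a) h).trans
            (hexp (u z') a ha).symm)
          obtain ⟨n, hn⟩ := Complex.exp_eq_exp_iff_exists_int.1 h2
          rw [hu z hz, hu z' hz'] at hn ⊢
          have h3 : z (Sum.inr a) = z' (Sum.inr a) + n := by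
            have h4 : (z (Sum.inr a) : ℂ) = z' (Sum.inr a) + n := by
              have h5 : (2 * Real.pi * Complex.I : ℂ) ≠ 0 := Complex.two_pi_I_ne_zero
              apply mul_left_cancel₀ h5
              push_cast at hn
              linear_combination hn
            exact_mod_cast h4
          have h4 := abs_le.1 (hcoord z hz (Sum.inr a))
          have h5 := abs_le.1 (hcoord z' hz' (Sum.inr a))
          have h6 : |(n : ℝ)| < 1 := by
            rw [abs_lt]
            constructor <;> linarith [h4.1, h4.2, h5.1, h5.2]
          have h7 : n = 0 := Int.abs_lt_one_iff.1 (by exact_mod_cast h6)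
          rw [h3, h7, Int.cast_zero, add_zero]
        · rw [hinr0 _ a ha, hinr0 _ a ha]
    have h1 := card_mul_card_le S (Z.image fun z => redMod d N (φ (u z))) (by
      intro x hx
      obtain ⟨z, hz, rfl⟩ := Finset.mem_image.1 hx
      refine le_trans ?_ (Complex.re_le_norm _)
      rw [Complex.re_sum, div_eq_mul_one_div, ← nsmul_eq_mul, ← Finset.sum_const]
      refine Finset.sum_le_sum fun a ha => ?_
      rw [← hexp _ a ha, hu z hz]
      exact half_le_re_stdAddChar (hcoord z hz _))
    rw [Finset.card_image_of_injOn hinjZ] at h1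
    have h2 : (Z.card : ℝ) * S.card ≤ (8 * κ ^ 2 * (kfold X l).card) * S.card := by
      rw [hYcard] at hScard
      linarith
    exact le_of_mul_le_mul_right h2 hSpos

/-- Any finite spanning family contains a basis in which the whole family has coordinates bounded
by `1`. -/
lemma exists_auerbach {α E : Type} [Finite α] [NormedAddCommGroup E] [NormedSpace ℝ E]
    [FiniteDimensional ℝ E] (t : α → E) :
    ∃ (e : Fin (Module.finrank ℝ (Submodule.span ℝ (Set.range t))) → α)
      (c : α → Fin (Module.finrank ℝ (Submodule.span ℝ (Set.range t))) → ℝ),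
      (∀ x, t x = ∑ i, c x i • t (e i)) ∧ (∀ x i, |c x i| ≤ 1) ∧
      LinearIndependent ℝ (fun i => t (e i)) := by
  set V := Submodule.span ℝ (Set.range t) with hV
  set D := Module.finrank ℝ V with hD
  let T : α → V := fun x => ⟨t x, Submodule.subset_span ⟨x, rfl⟩⟩
  have hTspan : Submodule.span ℝ (Set.range T) = ⊤ := by
    have : Set.range T = ((↑) : V → E) ⁻¹' Set.range t := by
      ext v
      simp [T, Subtype.ext_iff]
    rw [this]
    exact Submodule.span_span_coe_preimage
  let b := Module.finBasis ℝ V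
  obtain ⟨f, hf⟩ : ∃ f : Fin D → α, IsUnit (b.det (fun i => T (f i))) := by
    obtain ⟨s, hs, hspan, hli⟩ := exists_linearIndependent ℝ (Set.range T)
    let b' := Module.Basis.mk hli (by rw [Subtype.range_coe, hspan, hTspan])
    have : Fintype s := FiniteDimensional.fintypeBasisIndex b'
    have hcard : Fintype.card s = D := (Module.finrank_eq_card_basis b').symm
    let σ : Fin D ≃ s := (Fintype.equivFinOfCardEq hcard).symm
    choose f hf using fun i => hs (σ i).2
    refine ⟨f, ?_⟩
    rw [← Module.Basis.is_basis_iff_det]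
    have h1 : (fun i => T (f i)) = (fun x : s => (x : V)) ∘ σ := funext hf
    rw [h1]
    refine ⟨hli.comp _ σ.injective, ?_⟩
    rw [Set.range_comp, σ.surjective.range_eq, Set.image_univ, Subtype.range_coe, hspan, hTspan]
  have : Nonempty (Fin D → α) := ⟨f⟩
  obtain ⟨e, he⟩ := Finite.exists_max fun e : Fin D → α => |b.det (fun i => T (e i))|
  have hdet : b.det (fun i => T (e i)) ≠ 0 := by
    intro h
    have h1 := he f
    simp only [h, abs_zero] at h1
    exact hf.ne_zero (abs_nonpos_iff.1 h1)
  obtain ⟨hli, hsp⟩ := (Module.Basis.is_basis_iff_det b).2 (isUnit_iff_ne_zero.2 hdet)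
  let b' := Module.Basis.mk hli hsp.ge
  refine ⟨e, fun x i => b'.repr (T x) i, fun x => ?_, fun x i => ?_, ?_⟩
  · have h1 := b'.sum_repr (T x)
    have h2 := congrArg (Subtype.val) h1
    rw [Submodule.coe_sum] at h2
    refine h2.symm.trans (Finset.sum_congr rfl fun i _ => ?_)
    rw [Submodule.coe_smul, Module.Basis.mk_apply]
  · have h1 := LinearMap.congr_fun (Module.Basis.det_smul_mk_coord_eq_det_update b hli hsp.ge i)
      (T x)
    simp only [LinearMap.smul_apply, Module.Basis.coord_apply, smul_eq_mul,
      MultilinearMap.toLinearMap_apply, AlternatingMap.coe_multilinearMap] at h1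
    have h2 : Function.update (fun i => T (e i)) i (T x) = fun k => T (Function.update e i x k) := by
      funext k
      by_cases hk : k = i
      · subst hk; simp
      · simp [hk]
    rw [h2] at h1
    have h3 := he (Function.update e i x)
    rw [← h1, abs_mul] at h3
    have h4 : 0 < |b.det (fun i => T (e i))| := abs_pos.2 hdet
    exact le_of_mul_le_mul_left (by rw [mul_one]; exact h3) h4
  · exact hli.map' V.subtype (Submodule.ker_subtype V)

lemma finrank_span_le_of_cover {α E : Type} [Fintype α] [DecidableEq α] [NormedAddCommGroup E]
    [NormedSpace ℝ E] [FiniteDimensional ℝ E] (ι : (α → ℤ) →+ E) {t : ℝ}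
    (ht0 : 0 ≤ t) (ht : ∀ x, ‖ι (Pi.single x 1)‖ ≤ t) (F : Finset E) (hF : ∀ f ∈ F, ∃ u, ι u = f)
    (hcov : ∀ u, ‖ι u‖ ≤ 4 * t → ∃ f ∈ F, ‖ι u - f‖ ≤ 2 * t) :
    Module.finrank ℝ (Submodule.span ℝ (Set.range fun x => ι (Pi.single x 1))) ≤ F.card := by
  set W := Submodule.span ℝ (F : Set E) with hW
  have : IsClosed (W : Set E) := Submodule.closed_of_finiteDimensional W
  let P : (α → ℤ) → Prop := fun u => ∃ w, ι w ∈ W ∧ ‖ι u - ι w‖ ≤ 2 * t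
  have hstep : ∀ u v, ‖ι v‖ ≤ t → P u → P (u + v) := by
    rintro u v hv ⟨w, hw, huw⟩
    have h1 : ‖ι (u + v - w)‖ ≤ 4 * t := by
      have : ι (u + v - w) = (ι u - ι w) + ι v := by rw [map_sub, map_add]; abel
      rw [this]
      refine (norm_add_le _ _).trans ?_
      linarith
    obtain ⟨f, hf, hfn⟩ := hcov _ h1
    obtain ⟨g, rfl⟩ := hF f hf
    refine ⟨w + g, ?_, ?_⟩
    · rw [map_add]
      exact W.add_mem hw (Submodule.subset_span hf)
    · have : ι (u + v) - ι (w + g) = ι (u + v - w) - ι g := by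
        rw [map_sub, map_add ι w g]; abel
      rwa [this]
  have hsingle : ∀ u x (n : ℤ), P u → P (u + Pi.single x n) := by
    intro u x n hu
    induction n using Int.induction_on with
    | zero => simpa using hu
    | succ n ih =>
      rw [Pi.single_add, ← add_assoc]
      exact hstep _ _ (ht x) ih
    | pred n ih =>
      rw [sub_eq_add_neg, Pi.single_add, ← add_assoc]
      refine hstep _ _ ?_ ih
      rw [Pi.single_neg, map_neg, norm_neg]
      exact ht x
  have hP : ∀ u, P u := by
    have hfin : ∀ (u : α → ℤ) (s : Finset α), P (∑ x ∈ s, Pi.single x (u x)) := by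
      intro u s
      induction s using Finset.induction_on with
      | empty => exact ⟨0, by simp, by simpa using ht0⟩
      | insert a s ha ih =>
        rw [Finset.sum_insert ha, add_comm]
        exact hsingle _ _ _ ih
    intro u
    have := hfin u Finset.univ
    rwa [Finset.univ_sum_single] at this
  have hmem : ∀ u, ι u ∈ W := by
    intro u
    have h1 : ∀ n : ℕ, (n : ℝ) * ‖W.mkQ (ι u)‖ ≤ 2 * t := by
      intro n
      obtain ⟨w, hw, hn⟩ := hP (n • u)
      rw [map_nsmul] at hn
      have h2 : W.mkQ (ι w) = 0 := by simpa using hw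
      have h3 := Submodule.Quotient.norm_mk_le W (ι (n • u) - ι w)
      rw [← Submodule.mkQ_apply, map_sub, h2, sub_zero, map_nsmul, map_nsmul,
        ← Nat.cast_smul_eq_nsmul ℝ, norm_smul, Real.norm_natCast] at h3
      exact h3.trans hn
    have h2 : ‖W.mkQ (ι u)‖ = 0 := by
      by_contra hne
      have hpos : 0 < ‖W.mkQ (ι u)‖ := lt_of_le_of_ne (norm_nonneg _) (Ne.symm hne)
      obtain ⟨n, hn⟩ := exists_nat_gt (2 * t / ‖W.mkQ (ι u)‖)
      rw [div_lt_iff₀ hpos] at hn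
      linarith [h1 n]
    rw [norm_eq_zero, Submodule.mkQ_apply, Submodule.Quotient.mk_eq_zero] at h2
    exact h2
  have hle : Submodule.span ℝ (Set.range fun x => ι (Pi.single x 1)) ≤ W := by
    rw [Submodule.span_le]
    rintro _ ⟨x, rfl⟩
    exact hmem _
  exact (Submodule.finrank_mono hle).trans (finrank_span_finset_le_card F)

lemma exists_lift_kfold {Γ E : Type} [AddCommGroup Γ] [DecidableEq Γ] [NormedAddCommGroup E]
    (X : Finset Γ) (ι : (X → ℤ) →+ E) {t : ℝ} (ht : ∀ x, ‖ι (Pi.single x 1)‖ ≤ t) (i : ℕ) {y : Γ}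
    (hy : y ∈ kfold X i) :
    ∃ u, combHom (fun x : X => (x : Γ)) u = y ∧ ‖ι u‖ ≤ i * t := by
  classical
  induction i generalizing y with
  | zero =>
    have : y = 0 := by simpa [kfold] using hy
    exact ⟨0, by simp [this], by simp⟩
  | succ i ih =>
    obtain ⟨z, hz, x, hx, rfl⟩ := Finset.mem_add.1 hy
    obtain ⟨u, rfl, hu⟩ := ih hz
    refine ⟨u + Pi.single ⟨x, hx⟩ 1, ?_, ?_⟩
    · rw [map_add, combHom_single, one_smul]
    · rw [map_add]
      refine (norm_add_le _ _).trans ?_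
      push_cast
      linarith [ht ⟨x, hx⟩]

/-- A set of values of `φ` lifts to a set of points of the lattice of the same size. -/
lemma exists_lift_finset {Γ L E : Type} [AddCommGroup Γ] [AddCommGroup L] [NormedAddCommGroup E]
    (ι : L →+ E) (φ : L →+ Γ) (hker : ∀ u, ι u = 0 → φ u = 0) (Z : Finset Γ) {R : ℝ}
    (hZ : ∀ z ∈ Z, ∃ u, φ u = z ∧ ‖ι u‖ ≤ R) :
    ∃ Z' : Finset E, Z'.card = Z.card ∧ ∀ z ∈ Z', ∃ u, ι u = z ∧ ‖z‖ ≤ R := by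
  classical
  choose! u hu hR using hZ
  refine ⟨Z.image fun z => ι (u z), Finset.card_image_of_injOn fun z hz z' hz' h => ?_, ?_⟩
  · have := hker (u z - u z') (by rw [map_sub, sub_eq_zero]; exact h)
    rw [map_sub, hu z hz, hu z' hz', sub_eq_zero] at this
    exact this
  · intro z hz
    obtain ⟨w, hw, rfl⟩ := Finset.mem_image.1 hz
    exact ⟨_, rfl, hR w hw⟩

lemma finite_values {Γ L E : Type} [AddCommGroup Γ] [AddCommGroup L] [NormedAddCommGroup E]
    (ι : L →+ E) (φ : L →+ Γ) (hker : ∀ u, ι u = 0 → φ u = 0)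
    (hd : ∀ R : ℝ, {v : E | ∃ u, ι u = v ∧ ‖v‖ ≤ R}.Finite) (R : ℝ) :
    {z | ∃ u, φ u = z ∧ ‖ι u‖ ≤ R}.Finite := by
  choose! g hg using fun (v : E) (h : ∃ u, ι u = v) => h
  refine ((hd R).image fun v => φ (g v)).subset ?_
  rintro _ ⟨u, rfl, hu⟩
  refine ⟨ι u, ⟨u, rfl, hu⟩, ?_⟩
  have := hker (g (ι u) - u) (by rw [map_sub, hg _ ⟨u, rfl⟩, sub_self])
  rwa [map_sub, sub_eq_zero] at this

lemma map_eq_sum_zsmul_single {α E : Type} [Fintype α] [DecidableEq α] [AddCommGroup E]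
    (ι : (α → ℤ) →+ E) (u : α → ℤ) : ι u = ∑ x, u x • ι (Pi.single x 1) := by
  have h1 : u = ∑ x, u x • Pi.single x 1 := by
    conv_lhs => rw [← Finset.univ_sum_single u]
    refine Finset.sum_congr rfl fun x _ => ?_
    rw [← Pi.single_smul, smul_eq_mul, mul_one]
  conv_lhs => rw [h1, map_sum]
  exact Finset.sum_congr rfl fun x _ => map_zsmul ι _ _

/-- Coordinates on a lattice with respect to an Auerbach basis chosen among its generators. -/
lemma exists_adapted_coordinates {α E : Type} [Fintype α] [DecidableEq α] [NormedAddCommGroup E]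
    [NormedSpace ℝ E] [FiniteDimensional ℝ E] (ι : (α → ℤ) →+ E) {t : ℝ}
    (ht : ∀ x, ‖ι (Pi.single x 1)‖ ≤ t) (hd : ∀ R : ℝ, {v : E | ∃ u, ι u = v ∧ ‖v‖ ≤ R}.Finite) :
    ∃ (D : ℕ) (e : Fin D → α) (c : α → Fin D → ℝ),
      D = Module.finrank ℝ (Submodule.span ℝ (Set.range fun x => ι (Pi.single x 1))) ∧
      (∀ x i, |c x i| ≤ 1) ∧ (∀ i, combHom c (Pi.single (e i) 1) = Pi.single i 1) ∧
      (∀ u, combHom c u = 0 → ι u = 0) ∧ (∀ u, ‖ι u‖ ≤ D * (‖combHom c u‖ * t)) ∧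
      ∀ R : ℝ, {v : Fin D → ℝ | ∃ u, combHom c u = v ∧ ‖v‖ ≤ R}.Finite := by
  obtain ⟨D, hD, e, c, htc, hc, hli⟩ : ∃ (D : ℕ)
      (_ : D = Module.finrank ℝ (Submodule.span ℝ (Set.range fun x => ι (Pi.single x 1))))
      (e : Fin D → α) (c : α → Fin D → ℝ),
      (∀ x, ι (Pi.single x 1) = ∑ i, c x i • ι (Pi.single (e i) 1)) ∧ (∀ x i, |c x i| ≤ 1) ∧
        LinearIndependent ℝ fun i => ι (Pi.single (e i) 1) :=
    ⟨_, rfl, exists_auerbach fun x => ι (Pi.single x 1)⟩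
  have hι : ∀ u, ι u = ∑ i, combHom c u i • ι (Pi.single (e i) 1) := by
    intro u
    calc ι u = ∑ x, u x • ∑ i, c x i • ι (Pi.single (e i) 1) := by
          rw [map_eq_sum_zsmul_single]
          exact Finset.sum_congr rfl fun x _ => by rw [← htc x]
      _ = ∑ x, ∑ i, ((u x : ℝ) * c x i) • ι (Pi.single (e i) 1) := by
          refine Finset.sum_congr rfl fun x _ => ?_
          rw [Finset.smul_sum]
          refine Finset.sum_congr rfl fun i _ => ?_
          rw [mul_smul, Int.cast_smul_eq_zsmul]
      _ = _ := by
          rw [Finset.sum_comm]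
          refine Finset.sum_congr rfl fun i _ => ?_
          rw [combHom_apply_apply, Finset.sum_smul]
  have hinj : Function.Injective fun v : Fin D → ℝ => ∑ i, v i • ι (Pi.single (e i) 1) := by
    intro v w hvw
    have h2 : ∑ k, (v k - w k) • ι (Pi.single (e k) 1) = 0 := by
      simp_rw [sub_smul]
      rw [Finset.sum_sub_distrib, sub_eq_zero]
      exact hvw
    funext k
    exact sub_eq_zero.1 (Fintype.linearIndependent_iff.1 hli _ h2 k)
  have hnorm : ∀ u, ‖ι u‖ ≤ D * (‖combHom c u‖ * t) := by
    intro u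
    have h1 : ‖ι u‖ ≤ ∑ _i : Fin D, ‖combHom c u‖ * t := by
      rw [hι u]
      refine (norm_sum_le _ _).trans (Finset.sum_le_sum fun i _ => ?_)
      rw [norm_smul]
      exact mul_le_mul (norm_le_pi_norm _ i) (ht _) (norm_nonneg _) (norm_nonneg _)
    rwa [Finset.sum_const, Finset.card_univ, Fintype.card_fin, nsmul_eq_mul] at h1
  refine ⟨D, e, c, hD, hc, fun i => ?_, fun u hu => ?_, hnorm, fun R => ?_⟩
  · refine hinj ?_
    beta_reduce
    rw [← hι]
    simp
  · rw [hι, hu]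
    simp
  · refine ((hd (D * (R * |t|))).preimage hinj.injOn).subset ?_
    rintro _ ⟨u, rfl, hu⟩
    refine ⟨u, hι u, ?_⟩
    beta_reduce
    rw [← hι u]
    refine (hnorm u).trans ?_
    have h1 : ‖combHom c u‖ * t ≤ ‖combHom c u‖ * |t| := by
      gcongr
      exact le_abs_self t
    have h2 : ‖combHom c u‖ * |t| ≤ R * |t| := by gcongr
    exact mul_le_mul_of_nonneg_left (h1.trans h2) (Nat.cast_nonneg D)

/-- The rank of the lattice is bounded by a covering argument. -/
lemma finrank_span_le_of_card_le {d : ℕ} {E : Type} [NormedAddCommGroup E] [NormedSpace ℝ E]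
    [FiniteDimensional ℝ E] (X : Finset (Fin d → ℤ)) (ι : (X → ℤ) →+ E) {j K₂ : ℕ} (hj : 1 ≤ j)
    (hgen' : ∀ x, ‖ι (Pi.single x 1)‖ ≤ 1 / (64 * j))
    (hker : ∀ u, ι u = 0 → combHom (fun x : X => (x : Fin d → ℤ)) u = 0)
    (hd : ∀ R : ℝ, {v : E | ∃ u, ι u = v ∧ ‖v‖ ≤ R}.Finite) {B : ℝ}
    (hcount : ∀ Z : Finset E, (∀ z ∈ Z, ∃ u, ι u = z ∧ ‖z‖ ≤ 1 / 8) → (Z.card : ℝ) ≤ B)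
    (hK₂ : B ≤ K₂ * (kfold X j).card) :
    Module.finrank ℝ (Submodule.span ℝ (Set.range fun x => ι (Pi.single x 1))) ≤ K₂ := by
  classical
  set φ := combHom (fun x : X => (x : Fin d → ℤ)) with hφ
  have hjpos : (1 : ℝ) ≤ j := by exact_mod_cast hj
  have hgen'' : ∀ x, ‖ι (Pi.single x 1)‖ ≤ 1 / 64 := fun x => (hgen' x).trans (by
    rw [div_le_div_iff₀ (by positivity) (by norm_num)]
    linarith)
  obtain ⟨F, hFA, hFcard, hF⟩ := Finset.ruzsa_covering_add (A := (hd (4 * (1 / 64))).toFinset)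
    (B := (hd (1 / 64)).toFinset) (K := K₂) ⟨0, by
      rw [Set.Finite.mem_toFinset]
      exact ⟨0, map_zero ι, by simp⟩⟩ (by
    have h1 : (((hd (4 * (1 / 64))).toFinset + (hd (1 / 64)).toFinset).card : ℝ) ≤
        B := by
      refine hcount _ fun z hz => ?_
      obtain ⟨v, hv, w, hw, rfl⟩ := Finset.mem_add.1 hz
      rw [Set.Finite.mem_toFinset] at hv hw
      obtain ⟨u, rfl, hu⟩ := hv
      obtain ⟨u', rfl, hu'⟩ := hw
      exact ⟨u + u', map_add ι _ _, (norm_add_le _ _).trans (by linarith)⟩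
    obtain ⟨Z', hZ'card, hZ'⟩ := exists_lift_finset ι φ hker (kfold X j) (R := 1 / 64)
      fun z hz => by
        obtain ⟨u, hu, hn⟩ := exists_lift_kfold X ι hgen' j hz
        refine ⟨u, hu, hn.trans (le_of_eq ?_)⟩
        field_simp
    have h2 : (kfold X j).card ≤ ((hd (1 / 64)).toFinset).card := by
      rw [← hZ'card]
      exact Finset.card_le_card fun z hz => (Set.Finite.mem_toFinset _).2 (hZ' z hz)
    have h3 : ((kfold X j).card : ℝ) ≤ ((hd (1 / 64)).toFinset).card := by exact_mod_cast h2
    calc _ ≤ _ := h1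
      _ ≤ _ := hK₂
      _ ≤ _ := by gcongr)
  have hrank := finrank_span_le_of_cover ι (t := 1 / 64) (by norm_num) hgen'' F (fun f hf => by
    obtain ⟨u, hu, -⟩ := (Set.Finite.mem_toFinset _).1 (hFA hf)
    exact ⟨u, hu⟩) (fun u hu => by
    obtain ⟨f, hf, b, hb, hfb⟩ := Finset.mem_add.1 (hF ((Set.Finite.mem_toFinset _).2 ⟨u, rfl, hu⟩))
    obtain ⟨b₁, hb₁, b₂, hb₂, rfl⟩ := Finset.mem_sub.1 hb
    obtain ⟨-, -, hn₁⟩ := (Set.Finite.mem_toFinset _).1 hb₁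
    obtain ⟨-, -, hn₂⟩ := (Set.Finite.mem_toFinset _).1 hb₂
    refine ⟨f, hf, ?_⟩
    rw [← hfb, add_sub_cancel_left]
    exact (norm_sub_le _ _).trans (by linarith))
  exact hrank.trans (by exact_mod_cast hFcard)

/-- Counting the values of a lattice by rounding to the basis of generators. -/
lemma card_le_of_adapted_coordinates {d : ℕ} {X : Finset (Fin d → ℤ)} (hs : ∀ x ∈ X, -x ∈ X)
    (h0 : 0 ∈ X) {D : ℕ} {e : Fin D → X} {c : X → Fin D → ℝ} (hc : ∀ x i, |c x i| ≤ 1)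
    (hone : ∀ i, combHom c (Pi.single (e i) 1) = Pi.single i 1)
    (hkerc : ∀ u, combHom c u = 0 → combHom (fun x : X => (x : Fin d → ℤ)) u = 0)
    (hdc : ∀ R : ℝ, {v : Fin D → ℝ | ∃ u, combHom c u = v ∧ ‖v‖ ≤ R}.Finite)
    {j' : ℕ} (hj' : 1 ≤ j') {B K₃ : ℝ}
    (hcountc : ∀ Z : Finset (Fin d → ℤ),
      (∀ z ∈ Z, ∃ u, combHom (fun x : X => (x : Fin d → ℤ)) u = z ∧ ‖combHom c u‖ ≤ 2 * j') →
      (Z.card : ℝ) ≤ B)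
    (hK₃ : B ≤ K₃ * (kfold X j').card) (R k : ℕ) (hk : 2 * j' + D * (R + 1) ≤ k)
    (Z : Finset (Fin d → ℤ))
    (hZ : ∀ z ∈ Z, ∃ u, combHom (fun x : X => (x : Fin d → ℤ)) u = z ∧ ‖combHom c u‖ ≤ R) :
    (Z.card : ℝ) ≤ K₃ * (kfold X k).card := by
  classical
  set φ := combHom (fun x : X => (x : Fin d → ℤ)) with hφ
  have hgenc : ∀ x, ‖combHom c (Pi.single x 1)‖ ≤ 1 := by
    intro x
    rw [combHom_single, one_smul, pi_norm_le_iff_of_nonneg zero_le_one]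
    exact hc x
  have hj'pos : (1 : ℝ) ≤ j' := by exact_mod_cast hj'
  set U := (finite_values (combHom c) φ hkerc hdc 1).toFinset with hU
  obtain ⟨F', hF'U, hF'card, hF'⟩ := Finset.ruzsa_covering_add (A := U) (B := kfold X j') (K := K₃)
    ⟨0, zero_mem_kfold h0 _⟩ (by
    refine (hcountc _ fun z hz => ?_).trans hK₃
    obtain ⟨v, hv, w, hw, rfl⟩ := Finset.mem_add.1 hz
    rw [hU, Set.Finite.mem_toFinset] at hv
    obtain ⟨u, rfl, hu⟩ := hv
    obtain ⟨u', rfl, hu'⟩ := exists_lift_kfold X (combHom c) hgenc j' hw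
    refine ⟨u + u', map_add φ _ _, ?_⟩
    rw [map_add]
    exact (norm_add_le _ _).trans (by linarith))
  have hsub : Z ⊆ F' + kfold X k := by
    intro z hz
    obtain ⟨u, rfl, hu⟩ := hZ z hz
    set n : Fin D → ℤ := fun i => ⌊combHom c u i⌋ with hn
    have h1 : combHom c (u - ∑ i, n i • Pi.single (e i) 1) = fun i => Int.fract (combHom c u i) := by
      rw [map_sub, map_sum]
      simp_rw [map_zsmul, hone]
      funext i
      rw [Pi.sub_apply, Finset.sum_apply, Finset.sum_eq_single i]
      · simp [hn, Int.self_sub_floor]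
      · intro k _ hk
        simp [Ne.symm hk]
      · simp
    have h2 : φ (u - ∑ i, n i • Pi.single (e i) 1) ∈ U := by
      rw [hU, Set.Finite.mem_toFinset]
      refine ⟨_, rfl, ?_⟩
      rw [h1, pi_norm_le_iff_of_nonneg zero_le_one]
      intro i
      rw [Real.norm_eq_abs, abs_of_nonneg (Int.fract_nonneg _)]
      exact (Int.fract_lt_one _).le
    have h3 : φ u = φ (u - ∑ i, n i • Pi.single (e i) 1) + ∑ i, n i • (e i : Fin d → ℤ) := by
      rw [map_sub, map_sum]
      simp_rw [map_zsmul, hφ, combHom_single, one_smul]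
      abel
    have h4 : ∑ i, (n i).natAbs ≤ D * (R + 1) := by
      have h5 : ∀ i, (n i).natAbs ≤ R + 1 := by
        intro i
        have h6 := (norm_le_pi_norm (combHom c u) i).trans hu
        rw [Real.norm_eq_abs, abs_le] at h6
        have h7 : -(R : ℤ) ≤ n i := Int.le_floor.2 (by push_cast; exact h6.1)
        have h8 : n i ≤ R := by
          have : (n i : ℝ) ≤ R := (Int.floor_le _).trans h6.2
          exact_mod_cast this
        omega
      calc _ ≤ ∑ _i : Fin D, (R + 1) := Finset.sum_le_sum fun i _ => h5 i
        _ = D * (R + 1) := by simp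
    obtain ⟨f, hf, b, hb, hfb⟩ := Finset.mem_add.1 (hF' h2)
    obtain ⟨b₁, hb₁, b₂, hb₂, rfl⟩ := Finset.mem_sub.1 hb
    have h5 := sum_zsmul_mem_kfold hs Finset.univ (fun i => (e i : Fin d → ℤ)) (fun i => (e i).2) n
    have h6 := add_mem_kfold (add_mem_kfold hb₁ (neg_mem_kfold hs hb₂)) h5
    refine Finset.mem_add.2 ⟨f, hf, _, kfold_mono h0 (by omega) h6, ?_⟩
    rw [h3, ← hfb, sub_eq_add_neg, ← add_assoc f]
  calc (Z.card : ℝ) ≤ (F' + kfold X k).card := by exact_mod_cast Finset.card_le_card hsub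
    _ ≤ F'.card * (kfold X k).card := by exact_mod_cast Finset.card_add_le
    _ ≤ _ := mul_le_mul_of_nonneg_right hF'card (Nat.cast_nonneg _)

/-- The lattice of an iterated sumset in coordinates adapted to the generators. -/
theorem exists_dense_lattice {d : ℕ} (X : Finset (Fin d → ℤ)) (hs : ∀ x ∈ X, -x ∈ X) (h0 : 0 ∈ X)
    {κ K₃ : ℝ} (hκ : 0 < κ) {l j j' K₂ : ℕ} (hl : 1 ≤ l) (hj : 1 ≤ j) (hj' : 1 ≤ j') (hjl : j ≤ l)
    (hjj' : K₂ * j' ≤ j)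
    (hdbl : ((kfold X (2 * l)).card : ℝ) ≤ κ ^ 2 * (kfold X l).card)
    (hgrow : ((kfold X (l + j)).card : ℝ) ≤ (1 + 1 / (64 * κ)) * (kfold X l).card)
    (hK₂ : 8 * κ ^ 2 * (kfold X l).card ≤ K₂ * (kfold X j).card)
    (hK₃ : 8 * κ ^ 2 * (kfold X l).card ≤ K₃ * (kfold X j').card) :
    ∃ (D : ℕ) (ι : (X → ℤ) →+ (Fin D → ℝ)), D ≤ K₂ ∧ (∀ x, ‖ι (Pi.single x 1)‖ ≤ 1) ∧
      (∀ u, ι u = 0 → combHom (fun x : X => (x : Fin d → ℤ)) u = 0) ∧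
      (∀ R : ℝ, {v : Fin D → ℝ | ∃ u, ι u = v ∧ ‖v‖ ≤ R}.Finite) ∧
      ∀ R k : ℕ, 2 * j' + K₂ * (R + 1) ≤ k → ∀ Z : Finset (Fin d → ℤ),
        (∀ z ∈ Z, ∃ u, combHom (fun x : X => (x : Fin d → ℤ)) u = z ∧ ‖ι u‖ ≤ R) →
        (Z.card : ℝ) ≤ K₃ * (kfold X k).card := by
  classical
  obtain ⟨I, hI, ι, hgen, hker, hd, hcount⟩ := exists_bohr_lattice X h0 hκ hl hj hdbl hgrow hjl
  have hjpos : (1 : ℝ) ≤ j := by exact_mod_cast hj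
  have hgen' : ∀ x, ‖ι (Pi.single x 1)‖ ≤ 1 / (64 * j) := fun x => by
    rw [le_div_iff₀ (by positivity)]
    exact hgen x
  obtain ⟨D, e, c, hD, hc, hone, hkerc, hnorm, hdc⟩ := exists_adapted_coordinates ι hgen' hd
  have hDK : D ≤ K₂ := by
    rw [hD]
    exact finrank_span_le_of_card_le X ι hj hgen' hker hd hcount hK₂
  have hDK' : (D : ℝ) ≤ K₂ := by exact_mod_cast hDK
  have hkerc' := fun u hu => hker u (hkerc u hu)
  refine ⟨D, combHom c, hDK, fun x => ?_, hkerc', hdc, fun R k hk => ?_⟩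
  · rw [combHom_single, one_smul, pi_norm_le_iff_of_nonneg zero_le_one]
    exact hc x
  refine card_le_of_adapted_coordinates hs h0 hc hone hkerc' hdc hj' (fun Z hZ => ?_) hK₃ R k
    (le_trans (by gcongr) hk)
  obtain ⟨Z', hZ'card, hZ'⟩ := exists_lift_finset ι _ hker Z (R := 1 / 8) fun z hz => by
    obtain ⟨u, hu, hn⟩ := hZ z hz
    refine ⟨u, hu, (hnorm u).trans ?_⟩
    have h2 : D * ‖combHom c u‖ ≤ K₂ * (2 * j') := by gcongr
    have h3 : (K₂ * j' : ℝ) ≤ j := by exact_mod_cast hjj'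
    rw [mul_one_div, mul_div_assoc', div_le_iff₀ (by positivity)]
    linarith
  rw [← hZ'card]
  exact hcount Z' hZ'

/-- A finite set of vectors whose iterated sumset stops growing for a while is contained in a small
proper progression. -/
theorem exists_gap_of_growth (K₂ : ℕ) : ∃ C : ℕ, 1 ≤ C ∧
    ∀ {d : ℕ} (X : Finset (Fin d → ℤ)), (∀ x ∈ X, -x ∈ X) → 0 ∈ X →
    ∀ {κ K₃ : ℝ}, 0 < κ → ∀ {l j j' : ℕ}, 1 ≤ l → 1 ≤ j → 1 ≤ j' → j ≤ l → K₂ * j' ≤ j →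
    ((kfold X (2 * l)).card : ℝ) ≤ κ ^ 2 * (kfold X l).card →
    ((kfold X (l + j)).card : ℝ) ≤ (1 + 1 / (64 * κ)) * (kfold X l).card →
    8 * κ ^ 2 * (kfold X l).card ≤ K₂ * (kfold X j).card →
    8 * κ ^ 2 * (kfold X l).card ≤ K₃ * (kfold X j').card →
    ∀ h k : ℕ, 1 ≤ h → 2 * j' + K₂ * (C * h + 1) ≤ k →
    ∃ (J : Type) (_ : Fintype J) (w : J → Fin d → ℤ) (N : J → ℕ), Fintype.card J ≤ K₂ ∧
      (∀ i, 1 ≤ N i) ∧ (∀ x ∈ X, ∃ c : J → ℤ, (∀ i, |c i| ≤ N i) ∧ x = ∑ i, c i • w i) ∧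
      (∀ c : J → ℤ, (∀ i, |c i| ≤ 2 * N i) → ∑ i, c i • w i = 0 → c = 0) ∧
      ∏ i, (2 * h * N i + 1 : ℝ) ≤ K₃ * (kfold X k).card := by
  classical
  obtain ⟨C, hC, hgap⟩ := exists_lattice_gap K₂
  refine ⟨C, hC, ?_⟩
  intro d X hs h0 κ K₃ hκ l j j' hl hj hj' hjl hjj' hdbl hgrow hK₂ hK₃ h k hh hk
  obtain ⟨D, ι, hD, hgen, hker, hd, hcount⟩ :=
    exists_dense_lattice X hs h0 hκ hl hj hj' hjl hjj' hdbl hgrow hK₂ hK₃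
  obtain ⟨J, hJ, w, N, hJc, hN, hmem, hlift, hprop⟩ := hgap (Fin d → ℤ) (X → ℤ) (Fin D → ℝ) ι
    (combHom fun x : X => (x : Fin d → ℤ)) (by simpa using hD) hd hker
    (fun n g hng hn => (smul_eq_zero.1 hng).resolve_left hn) h hh
  have hprop' : ∀ c : J → ℤ, (∀ i, |c i| ≤ 2 * (h * N i)) → ∑ i, c i • w i = 0 → c = 0 := by
    intro c hc hc0
    exact hprop c (fun i => by simpa [mul_assoc] using hc i) hc0
  refine ⟨J, hJ, w, N, hJc, hN, fun x hx => ?_, fun c hc hc0 => ?_, ?_⟩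
  · obtain ⟨c, hc, hcx⟩ := hmem (Pi.single ⟨x, hx⟩ 1) (hgen _)
    rw [combHom_single, one_smul] at hcx
    exact ⟨c, hc, hcx⟩
  · refine hprop' c (fun i => (hc i).trans ?_) hc0
    have h1 : (1 : ℤ) ≤ h := by exact_mod_cast hh
    nlinarith [Int.natCast_nonneg (N i)]
  · set B := Fintype.piFinset fun i => Finset.Icc (-(h * N i : ℤ)) (h * N i) with hB
    have hBmem : ∀ c : J → ℤ, c ∈ B ↔ ∀ i, |c i| ≤ h * N i := by
      intro c
      simp [hB, abs_le]
    have hinj : Set.InjOn (fun c : J → ℤ => ∑ i, c i • w i) B := by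
      intro c hc c' hc' hcc
      have hc1 := (hBmem c).1 hc
      have hc2 := (hBmem c').1 hc'
      refine sub_eq_zero.1 (hprop' (c - c') (fun i => ?_) ?_)
      · have := abs_sub (c i) (c' i)
        rw [Pi.sub_apply]
        linarith [hc1 i, hc2 i]
      · simp_rw [Pi.sub_apply, sub_smul]
        rw [Finset.sum_sub_distrib, sub_eq_zero]
        exact hcc
    have h1 := hcount (C * h) k hk (B.image fun c => ∑ i, c i • w i) (fun z hz => by
      obtain ⟨c, hc, rfl⟩ := Finset.mem_image.1 hz
      obtain ⟨u, hu, huc⟩ := hlift c ((hBmem c).1 hc)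
      exact ⟨u, huc, by exact_mod_cast hu⟩)
    rw [Finset.card_image_of_injOn hinj, hB, Fintype.card_piFinset] at h1
    refine le_trans (le_of_eq ?_) h1
    push_cast
    refine Finset.prod_congr rfl fun i _ => ?_
    rw [Int.card_Icc]
    have : ((h * N i : ℤ) + 1 - -(h * N i : ℤ)).toNat = 2 * h * N i + 1 := by
      zify
      rw [sub_neg_eq_add, Int.toNat_of_nonneg (by positivity)]
      ring
    rw [this]
    push_cast
    ring

lemma exists_ratio_le {g : ℕ → ℝ} {η M : ℝ} (hη : 0 ≤ η) (h0 : 0 < g 0) {n : ℕ}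
    (hM : M ≤ n * η) (hn : g n ≤ M * g 0) : ∃ i < n, g (i + 1) ≤ (1 + η) * g i := by
  by_contra! hcon
  have h1 : ∀ i ≤ n, (1 + η) ^ i * g 0 ≤ g i := by
    intro i hi
    induction i with
    | zero => simp
    | succ i ih =>
      refine le_trans ?_ (hcon i (by omega)).le
      rw [pow_succ', mul_assoc]
      exact mul_le_mul_of_nonneg_left (ih (by omega)) (by linarith)
  have h2 := h1 n le_rfl
  have h3 := one_add_mul_le_pow (by linarith : (-2 : ℝ) ≤ η) n
  have h4 : (1 + n * η) * g 0 ≤ M * g 0 :=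
    (mul_le_mul_of_nonneg_right h3 h0.le).trans (h2.trans hn)
  have h5 := le_of_mul_le_mul_right h4 h0
  linarith

/-- A scale below which a polynomially growing sequence grows polynomially. -/
lemma exists_scale {f : ℕ → ℝ} (hf : ∀ i, 1 ≤ f i) {γ n : ℕ} (hγ : 1 ≤ γ)
    (hfn : f n ≤ 2 ^ (γ * (n + 1))) :
    ∃ p ≤ n, n ≤ 2 * p + 1 ∧ ∀ i ≤ p, f p ≤ 4 ^ (γ * (p - i)) * f i := by
  obtain ⟨p, hp, hmin⟩ := Finset.exists_min_image (Finset.range (n + 1))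
    (fun i => f i / 4 ^ (γ * i)) ⟨0, by simp⟩
  have hpn : p ≤ n := Nat.lt_succ_iff.1 (Finset.mem_range.1 hp)
  refine ⟨p, hpn, ?_, fun i hi => ?_⟩
  · have h1 := hmin n (by simp)
    rw [div_le_div_iff₀ (by positivity) (by positivity)] at h1
    have h2 : (4 : ℝ) ^ (γ * n) ≤ 2 ^ (γ * (n + 1)) * 4 ^ (γ * p) := by
      refine le_trans ?_ (h1.trans (mul_le_mul_of_nonneg_right hfn (by positivity)))
      exact le_mul_of_one_le_left (by positivity) (hf p)
    rw [show (4 : ℝ) = 2 ^ 2 by norm_num, ← pow_mul, ← pow_mul, ← pow_add,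
      pow_le_pow_iff_right₀ (by norm_num)] at h2
    nlinarith
  · have h1 := hmin i (by simp; omega)
    rw [div_le_div_iff₀ (by positivity) (by positivity)] at h1
    have h2 : (4 : ℝ) ^ (γ * p) = 4 ^ (γ * (p - i)) * 4 ^ (γ * i) := by
      rw [← pow_add, ← mul_add, Nat.sub_add_cancel hi]
    rw [h2, mul_comm (f i), mul_right_comm] at h1
    exact le_of_mul_le_mul_right h1 (by positivity)

/-- A symmetric set with a long iterated sumset of polynomial size is contained in a proper
progression of bounded rank, whose size is smaller than that of the sumset by the expected power. -/
theorem exists_gap_of_card_kfold_le {γ : ℕ} (hγ : 1 ≤ γ) : ∃ (r₀ : ℕ) (K : ℝ) (k₀ : ℕ), 0 < K ∧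
    ∀ k, k₀ ≤ k → ∀ {d : ℕ} (X : Finset (Fin d → ℤ)), (∀ x ∈ X, -x ∈ X) → 0 ∈ X →
    ((kfold X k).card : ℝ) ≤ (k : ℝ) ^ γ →
    ∃ (J : Type) (_ : Fintype J) (w : J → Fin d → ℤ) (N : J → ℕ), Fintype.card J ≤ r₀ ∧
      (∀ x ∈ X, ∃ c : J → ℤ, (∀ i, |c i| ≤ N i) ∧ x = ∑ i, c i • w i) ∧
      (∀ c : J → ℤ, (∀ i, |c i| ≤ 2 * N i) → ∑ i, c i • w i = 0 → c = 0) ∧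
      (∏ i, (2 * N i + 1 : ℝ)) * (k : ℝ) ^ Fintype.card J ≤ K * (kfold X k).card := by
  obtain ⟨a, ha⟩ : ∃ a : ℕ, a = 64 * 4 ^ γ * 16 ^ γ := ⟨_, rfl⟩
  obtain ⟨K₂, hK₂⟩ : ∃ K₂ : ℕ, K₂ = 8 * 16 ^ γ * 4 ^ (γ * (a + 2)) := ⟨_, rfl⟩
  obtain ⟨K₃, hK₃⟩ : ∃ K₃ : ℕ, K₃ = 8 * 16 ^ γ * 4 ^ (γ * (K₂ + a + 2)) := ⟨_, rfl⟩
  have hK₂' : (K₂ : ℝ) = 8 * 16 ^ γ * 4 ^ (γ * (a + 2)) := by rw [hK₂]; push_cast; rfl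
  have hK₃' : (K₃ : ℝ) = 8 * 16 ^ γ * 4 ^ (γ * (K₂ + a + 2)) := by rw [hK₃]; push_cast; rfl
  have hK₂pos : 1 ≤ K₂ := by rw [hK₂]; exact Nat.one_le_iff_ne_zero.2 (by positivity)
  have hK₃pos : 1 ≤ K₃ := by rw [hK₃]; exact Nat.one_le_iff_ne_zero.2 (by positivity)
  have hapos : 1 ≤ a := by rw [ha]; exact Nat.one_le_iff_ne_zero.2 (by positivity)
  obtain ⟨C, hC, hgap⟩ := exists_gap_of_growth K₂
  obtain ⟨T, hT⟩ : ∃ T, T = 2 * K₂ * (C + 1) := ⟨_, rfl⟩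
  have hTpos : 1 ≤ T := hT ▸ Nat.one_le_iff_ne_zero.2 (by positivity)
  refine ⟨K₂, (3 * T) ^ K₂ * K₃, 2 ^ (2 * (K₂ + a + 2) + 1) + T, by positivity, ?_⟩
  intro k hk d X hs h0 hcard
  have hk1 : k ≠ 0 := by
    have : 0 < 2 ^ (2 * (K₂ + a + 2) + 1) := by positivity
    omega
  obtain ⟨p, hpn, hnp, hp⟩ := exists_scale (f := fun i => ((kfold X (2 ^ i)).card : ℝ))
    (fun i => by exact_mod_cast card_kfold_pos h0 _) (n := Nat.log 2 k) hγ (by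
      have h1 : ((kfold X (2 ^ Nat.log 2 k)).card : ℝ) ≤ (kfold X k).card := by
        exact_mod_cast Finset.card_le_card (kfold_mono h0 (Nat.pow_log_le_self 2 hk1))
      have h2 : (k : ℝ) ≤ 2 ^ (Nat.log 2 k + 1) := by
        exact_mod_cast (Nat.lt_pow_succ_log_self (by norm_num) k).le
      calc _ ≤ _ := h1
        _ ≤ _ := hcard
        _ ≤ ((2 : ℝ) ^ (Nat.log 2 k + 1)) ^ γ := by gcongr
        _ = _ := by rw [← pow_mul, mul_comm])
  have hlog : 2 * (K₂ + a + 2) + 1 ≤ Nat.log 2 k :=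
    (Nat.le_log_iff_pow_le (by norm_num) hk1).2 (by omega)
  obtain ⟨b, rfl⟩ : ∃ b, p = b + K₂ + a + 2 := ⟨p - (K₂ + a + 2), by omega⟩
  have hle : ∀ {u v : ℕ}, u ≤ v → ((kfold X u).card : ℝ) ≤ (kfold X v).card := fun h => by
    exact_mod_cast Finset.card_le_card (kfold_mono h0 h)
  have hq := hp (b + K₂ + a) (by omega)
  have hj := hp (b + K₂) (by omega)
  have hj' := hp b (by omega)
  rw [show b + K₂ + a + 2 - (b + K₂ + a) = 2 by omega, mul_comm γ 2, pow_mul,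
    show (4 : ℝ) ^ 2 = 16 by norm_num] at hq
  rw [show b + K₂ + a + 2 - (b + K₂) = a + 2 by omega] at hj
  rw [show b + K₂ + a + 2 - b = K₂ + a + 2 by omega] at hj'
  have hp2 : 2 ^ (b + K₂ + a + 2) = 4 * 2 ^ (b + K₂ + a) := by rw [pow_add]; ring
  have hp1 : 2 ^ (b + K₂ + a) = 2 ^ a * 2 ^ (b + K₂) := by rw [pow_add]; ring
  obtain ⟨i, hi, hgi⟩ := exists_ratio_le
    (g := fun i => ((kfold X (2 ^ (b + K₂ + a) + i * 2 ^ (b + K₂))).card : ℝ))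
    (η := 1 / (64 * 4 ^ γ)) (M := 16 ^ γ) (n := 2 ^ a) (by positivity)
    (by exact_mod_cast card_kfold_pos h0 _) (by
      have h1 : ((64 * 4 ^ γ * 16 ^ γ : ℕ) : ℝ) ≤ (2 ^ a : ℕ) := by
        rw [← ha]
        exact_mod_cast Nat.lt_two_pow_self.le
      rw [mul_one_div, le_div_iff₀ (by positivity)]
      push_cast at h1 ⊢
      linarith) (by
      rw [← hp1, zero_mul, add_zero]
      exact (hle (by omega)).trans hq)
  obtain ⟨l, hl⟩ : ∃ l, l = 2 ^ (b + K₂ + a) + i * 2 ^ (b + K₂) := ⟨_, rfl⟩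
  have hl1 : l ≤ 2 * 2 ^ (b + K₂ + a) := by
    have := Nat.mul_le_mul_right (2 ^ (b + K₂)) hi.le
    omega
  have hl2 : ((kfold X l).card : ℝ) ≤ (kfold X (2 ^ (b + K₂ + a + 2))).card := hle (by omega)
  have hκ : ((4 : ℝ) ^ γ) ^ 2 = 16 ^ γ := by rw [← pow_mul, mul_comm, pow_mul]; norm_num
  have hbk : 2 * (2 * 2 ^ b) ≤ k := by
    have h1 : 2 ^ (b + 2) ≤ 2 ^ (b + K₂ + a + 2) := Nat.pow_le_pow_right (by norm_num) (by omega)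
    have h2 : 2 ^ (b + K₂ + a + 2) ≤ 2 ^ Nat.log 2 k := Nat.pow_le_pow_right (by norm_num) hpn
    have h3 := Nat.pow_log_le_self 2 hk1
    rw [pow_add] at h1
    omega
  have hh : 1 ≤ k / T := (Nat.one_le_div_iff hTpos).2 ((Nat.le_add_left _ _).trans hk)
  have hkT : T * (k / T) ≤ k := Nat.mul_div_le k T
  have hkT' : k ≤ 2 * T * (k / T) := by
    have h1 := Nat.div_add_mod k T
    have h2 := Nat.mod_lt k hTpos
    nlinarith
  obtain ⟨J, hJ, w, N, hJc, hN, hmem, hprop, hprod⟩ := hgap X hs h0 (κ := 4 ^ γ) (K₃ := K₃)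
    (by positivity) (l := l) (j := 2 ^ (b + K₂)) (j' := 2 ^ b)
    (hl ▸ Nat.one_le_iff_ne_zero.2 (by positivity)) Nat.one_le_two_pow Nat.one_le_two_pow
    (by
      have h1 : 2 ^ (b + K₂) ≤ 2 ^ (b + K₂ + a) := Nat.pow_le_pow_right (by norm_num) (by omega)
      omega)
    (by
      rw [pow_add, mul_comm]
      exact Nat.mul_le_mul_left _ Nat.lt_two_pow_self.le)
    (by
      rw [hκ]
      refine (hle (by omega)).trans (hq.trans ?_)
      exact mul_le_mul_of_nonneg_left (hle (by omega)) (by positivity))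
    (by
      rw [hl]
      convert hgi using 4
      ring)
    (by
      rw [hκ, hK₂']
      have := mul_le_mul_of_nonneg_left (hl2.trans hj) (by positivity : (0 : ℝ) ≤ 8 * 16 ^ γ)
      linarith)
    (by
      rw [hκ, hK₃']
      have := mul_le_mul_of_nonneg_left (hl2.trans hj') (by positivity : (0 : ℝ) ≤ 8 * 16 ^ γ)
      linarith)
    (k / T) k hh (by
      have h1 : 2 * (K₂ * (C * (k / T) + 1)) ≤ T * (k / T) := by
        rw [hT] at hh ⊢
        nlinarith [Nat.mul_le_mul_left K₂ hh]
      omega)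
  refine ⟨J, hJ, w, N, hJc, hmem, hprop, ?_⟩
  have hterm : ∀ i, (2 * N i + 1 : ℝ) * k ≤ 3 * T * (2 * (k / T : ℕ) * N i + 1) := by
    intro i
    have h1 : (1 : ℝ) ≤ N i := by exact_mod_cast hN i
    have h2 : (k : ℝ) ≤ 2 * T * (k / T : ℕ) := by exact_mod_cast hkT'
    have h3 : (0 : ℝ) ≤ T := Nat.cast_nonneg _
    have h4 : (2 * N i + 1 : ℝ) * k ≤ (3 * N i) * (2 * T * (k / T : ℕ)) := by gcongr; linarith
    nlinarith
  have hT3 : (1 : ℝ) ≤ 3 * T := by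
    have : (1 : ℝ) ≤ T := by exact_mod_cast hTpos
    linarith
  calc (∏ i, (2 * N i + 1 : ℝ)) * (k : ℝ) ^ Fintype.card J
      = ∏ i, (2 * N i + 1 : ℝ) * k := by
        rw [Finset.prod_mul_distrib, Finset.prod_const, Finset.card_univ]
    _ ≤ ∏ i, (3 * T * (2 * (k / T : ℕ) * N i + 1) : ℝ) :=
        Finset.prod_le_prod (fun i _ => by positivity) fun i _ => hterm i
    _ = (3 * T : ℝ) ^ Fintype.card J * ∏ i, (2 * (k / T : ℕ) * N i + 1 : ℝ) := by
        rw [Finset.prod_mul_distrib, Finset.prod_const, Finset.card_univ]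
    _ ≤ (3 * T : ℝ) ^ K₂ * (K₃ * (kfold X k).card) :=
        mul_le_mul (pow_le_pow_right₀ hT3 hJc) hprod (by positivity) (by positivity)
    _ = _ := by ring

section Walk

variable {d N : ℕ} [NeZero N]

lemma pairing_sum {J : Type} (s : Finset J) (a : Fin d → ZMod N) (x : J → Fin d → ZMod N) :
    pairing a (∑ j ∈ s, x j) = ∏ j ∈ s, pairing a (x j) := by
  classical
  induction s using Finset.induction_on with
  | empty => simp [pairing_zero]
  | insert j s hj ih => rw [Finset.sum_insert hj, Finset.prod_insert hj, pairing_add, ih]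

/-- Fourier bound for the number of walks with a given endpoint. -/
lemma card_walk_mul_card_le {n m : ℕ} (B : Fin n → Fin d → ZMod N) (b : Fin d → ZMod N) :
    ((Finset.univ.filter fun f : Fin m → Fin n => ∑ j, B (f j) = b).card : ℝ) *
      Fintype.card (Fin d → ZMod N) ≤ ∑ ξ, ‖∑ i, pairing ξ (B i)‖ ^ m := by
  have h : (((Finset.univ.filter fun f : Fin m → Fin n => ∑ j, B (f j) = b).card : ℝ) : ℂ) *
      (Fintype.card (Fin d → ZMod N) : ℝ) =
      ∑ ξ, (∑ i, pairing ξ (B i)) ^ m * starRingEnd ℂ (pairing ξ b) := by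
    calc _ = ∑ f : Fin m → Fin n,
          if ∑ j, B (f j) = b then (Fintype.card (Fin d → ZMod N) : ℂ) else 0 := by
          rw [← Finset.sum_filter, Finset.sum_const, nsmul_eq_mul]
          push_cast
          rfl
      _ = ∑ f : Fin m → Fin n, ∑ ξ, pairing ξ (∑ j, B (f j)) * starRingEnd ℂ (pairing ξ b) :=
          Finset.sum_congr rfl fun f _ => (sum_pairing_sub _ _).symm
      _ = _ := by
          rw [Finset.sum_comm]
          refine Finset.sum_congr rfl fun ξ _ => ?_
          rw [Fintype.sum_pow, Finset.sum_mul]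
          refine Finset.sum_congr rfl fun f _ => ?_
          rw [pairing_sum]
  have h2 := congrArg norm h
  rw [norm_mul, Complex.norm_real, Complex.norm_real, Real.norm_of_nonneg (by positivity),
    Real.norm_of_nonneg (by positivity)] at h2
  rw [h2]
  refine (norm_sum_le _ _).trans (Finset.sum_le_sum fun ξ _ => ?_)
  rw [norm_mul, norm_pow, RCLike.norm_conj, norm_pairing, mul_one]

lemma abs_re_pairing_le (ξ x : Fin d → ZMod N) :
    |(pairing ξ x).re| ≤ 1 - (1 - (pairing (ξ + ξ) x).re) / 4 := by
  have h1 : pairing (ξ + ξ) x = pairing ξ x * pairing ξ x := by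
    rw [pairing_comm, pairing_add, pairing_comm]
  have h2 := norm_pairing ξ x
  have h3 : (pairing ξ x).re * (pairing ξ x).re + (pairing ξ x).im * (pairing ξ x).im = 1 := by
    rw [← Complex.normSq_apply, Complex.normSq_eq_norm_sq, h2, one_pow]
  rw [h1, Complex.mul_re]
  have h4 : |(pairing ξ x).re| ^ 2 = (pairing ξ x).re * (pairing ξ x).re := by rw [sq_abs, sq]
  nlinarith [sq_nonneg (|(pairing ξ x).re| - 1)]

lemma re_pairing_le_one (ξ x : Fin d → ZMod N) : (pairing ξ x).re ≤ 1 :=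
  (Complex.re_le_norm _).trans (norm_pairing ξ x).le

lemma norm_sum_pairing_le {n : ℕ} (B : Fin n → Fin d → ZMod N) (σ : Equiv.Perm (Fin n))
    (hσ : ∀ i, B (σ i) = -B i) (ξ : Fin d → ZMod N) :
    ‖∑ i, pairing ξ (B i)‖ ≤ n - (∑ i, (1 - (pairing (ξ + ξ) (B i)).re)) / 4 := by
  have h1 : (∑ i, pairing ξ (B i)).im = 0 := by
    rw [← Complex.conj_eq_iff_im, map_sum, ← Equiv.sum_comp σ]
    refine Finset.sum_congr rfl fun i _ => ?_
    rw [hσ, pairing_neg, Complex.conj_conj]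
  have h2 : ‖∑ i, pairing ξ (B i)‖ = |(∑ i, pairing ξ (B i)).re| :=
    (Complex.abs_re_eq_norm.2 h1).symm
  rw [h2, Complex.re_sum]
  refine (Finset.abs_sum_le_sum_abs _ _).trans
    ((Finset.sum_le_sum fun i _ => abs_re_pairing_le ξ (B i)).trans (le_of_eq ?_))
  rw [Finset.sum_sub_distrib, Finset.sum_div]
  simp

lemma sum_add_self_of_odd (hN : Odd N) (F : (Fin d → ZMod N) → ℝ) :
    ∑ ξ, F (ξ + ξ) = ∑ ξ, F ξ := by
  refine Function.Bijective.sum_comp (e := fun ξ : Fin d → ZMod N => ξ + ξ)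
    (Finite.injective_iff_bijective.1 fun ξ ξ' h => ?_) F
  funext i
  have h1 : ξ i + ξ i = ξ' i + ξ' i := congrFun h i
  have h2 : IsUnit (2 : ZMod N) := by
    have := (ZMod.isUnit_iff_coprime 2 N).2 hN.coprime_two_left
    exact_mod_cast this
  rw [← two_mul, ← two_mul] at h1
  exact h2.mul_left_cancel h1

lemma sum_exp_neg_le_s11 {α : Type} [Fintype α] (h : α → ℝ) (h0 : ∀ a, 0 ≤ h a) {b : ℝ}
    (hb : ∀ l : ℕ, ((Finset.univ.filter fun a => h a ≤ l + 1).card : ℝ) ≤ b * Real.exp (l / 2)) :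
    ∑ a, Real.exp (-h a) ≤ 3 * b := by
  have hb0 : 0 ≤ b := by
    have := (Nat.cast_nonneg _).trans (hb 0)
    simpa using this
  obtain ⟨L, hL⟩ : ∃ L : ℕ, ∀ a, ⌊h a⌋₊ < L := by
    refine ⟨∑ a, ⌊h a⌋₊ + 1, fun a => Nat.lt_succ_of_le ?_⟩
    exact Finset.single_le_sum (f := fun a => ⌊h a⌋₊) (fun _ _ => Nat.zero_le _) (Finset.mem_univ a)
  set q := Real.exp (-(1 / 2)) with hq
  have hq0 : 0 < q := Real.exp_pos _
  have hq1 : q ≤ 2 / 3 := by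
    have h1 := Real.add_one_le_exp (1 / 2 : ℝ)
    rw [hq, Real.exp_neg, inv_le_comm₀ (Real.exp_pos _) (by norm_num)]
    linarith
  have hgeom : ∑ l ∈ Finset.range L, q ^ l ≤ 3 := by
    have h1 : (∑ l ∈ Finset.range L, q ^ l) * (1 - q) = 1 - q ^ L := geom_sum_mul_neg q L
    have h2 : 0 ≤ q ^ L := by positivity
    have h3 : 0 ≤ ∑ l ∈ Finset.range L, q ^ l := by positivity
    nlinarith
  calc ∑ a, Real.exp (-h a)
      ≤ ∑ a, ∑ l ∈ Finset.range L, if h a ≤ l + 1 then Real.exp (-(l : ℝ)) else 0 := by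
        refine Finset.sum_le_sum fun a _ => ?_
        have h1 : (⌊h a⌋₊ : ℝ) ≤ h a := Nat.floor_le (h0 a)
        have h2 : h a ≤ ⌊h a⌋₊ + 1 := (Nat.lt_floor_add_one _).le
        refine le_trans ?_ (Finset.single_le_sum
          (f := fun l : ℕ => if h a ≤ l + 1 then Real.exp (-(l : ℝ)) else 0)
          (fun l _ => ?_) (Finset.mem_range.2 (hL a)))
        · rw [if_pos h2]
          exact Real.exp_le_exp.2 (by linarith)
        · split_ifs
          · positivity
          · exact le_rfl
    _ = ∑ l ∈ Finset.range L,
          ((Finset.univ.filter fun a => h a ≤ l + 1).card : ℝ) * Real.exp (-(l : ℝ)) := by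
        rw [Finset.sum_comm]
        refine Finset.sum_congr rfl fun l _ => ?_
        rw [← Finset.sum_filter, Finset.sum_const, nsmul_eq_mul]
    _ ≤ ∑ l ∈ Finset.range L, b * q ^ l := by
        refine Finset.sum_le_sum fun l _ => ?_
        refine (mul_le_mul_of_nonneg_right (hb l) (Real.exp_pos _).le).trans (le_of_eq ?_)
        rw [mul_assoc, ← Real.exp_add, hq, ← Real.exp_nat_mul]
        congr 2
        ring
    _ ≤ _ := by
        rw [← Finset.mul_sum, mul_comm]
        exact mul_le_mul_of_nonneg_right hgeom hb0

/-- If a symmetric walk is concentrated then many frequencies have small dispersion. -/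
lemma exists_level {n m : ℕ} (hn : 0 < n) (hN : Odd N) (B : Fin n → Fin d → ZMod N)
    (σ : Equiv.Perm (Fin n)) (hσ : ∀ i, B (σ i) = -B i) (b : Fin d → ZMod N) {ρ : ℝ} (hρ : 0 < ρ)
    (hb : ρ * (n : ℝ) ^ m ≤
      ((Finset.univ.filter fun f : Fin m → Fin n => ∑ j, B (f j) = b).card : ℝ)) :
    ∃ l : ℕ, ρ * Fintype.card (Fin d → ZMod N) * Real.exp (l / 2) ≤
      4 * ((Finset.univ.filter fun ξ : Fin d → ZMod N =>
        m * (∑ i, (1 - (pairing ξ (B i)).re)) / (4 * n) ≤ l + 1).card : ℝ) := by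
  set h : (Fin d → ZMod N) → ℝ := fun ξ => m * (∑ i, (1 - (pairing ξ (B i)).re)) / (4 * n) with hh
  have hnR : (0 : ℝ) < n := by exact_mod_cast hn
  have hG : (0 : ℝ) < Fintype.card (Fin d → ZMod N) := by exact_mod_cast Fintype.card_pos
  by_contra! hcon
  have h1 : ∀ ξ, ‖∑ i, pairing ξ (B i)‖ ^ m ≤ (n : ℝ) ^ m * Real.exp (-h (ξ + ξ)) := by
    intro ξ
    have h2 : (n : ℝ) - (∑ i, (1 - (pairing (ξ + ξ) (B i)).re)) / 4 =
        n * (-((∑ i, (1 - (pairing (ξ + ξ) (B i)).re)) / (4 * n)) + 1) := by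
      field_simp
      ring
    have h3 : -h (ξ + ξ) = m * -((∑ i, (1 - (pairing (ξ + ξ) (B i)).re)) / (4 * n)) := by
      rw [hh]
      ring
    rw [h3, Real.exp_nat_mul, ← mul_pow]
    refine pow_le_pow_left₀ (norm_nonneg _) ((norm_sum_pairing_le B σ hσ ξ).trans ?_) m
    rw [h2]
    exact mul_le_mul_of_nonneg_left (Real.add_one_le_exp _) hnR.le
  have h2 := sum_exp_neg_le_s11 h (b := ρ * Fintype.card (Fin d → ZMod N) / 4) (fun ξ => by
    rw [hh]
    have : 0 ≤ ∑ i, (1 - (pairing ξ (B i)).re) :=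
      Finset.sum_nonneg fun i _ => sub_nonneg.2 (re_pairing_le_one _ _)
    positivity) (fun l => by linarith [hcon l])
  have h3 : ρ * (n : ℝ) ^ m * Fintype.card (Fin d → ZMod N) ≤
      (n : ℝ) ^ m * (3 * (ρ * Fintype.card (Fin d → ZMod N) / 4)) := by
    calc _ ≤ _ := mul_le_mul_of_nonneg_right hb hG.le
      _ ≤ _ := card_walk_mul_card_le B b
      _ ≤ ∑ ξ, (n : ℝ) ^ m * Real.exp (-h (ξ + ξ)) := Finset.sum_le_sum fun ξ _ => h1 ξ
      _ = (n : ℝ) ^ m * ∑ ξ, Real.exp (-h ξ) := by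
        rw [← Finset.mul_sum, sum_add_self_of_odd hN fun ξ => Real.exp (-h ξ)]
      _ ≤ _ := mul_le_mul_of_nonneg_left h2 (by positivity)
  have h4 : 0 < ρ * (n : ℝ) ^ m * Fintype.card (Fin d → ZMod N) := by positivity
  linarith

end Walk

section Dispersion

variable {d N : ℕ} [NeZero N]

lemma norm_one_sub_pairing_sq (ξ x : Fin d → ZMod N) :
    ‖1 - pairing ξ x‖ ^ 2 = 2 * (1 - (pairing ξ x).re) := by
  have h2 := norm_pairing ξ x
  have h3 : (pairing ξ x).re * (pairing ξ x).re + (pairing ξ x).im * (pairing ξ x).im = 1 := by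
    rw [← Complex.normSq_apply, Complex.normSq_eq_norm_sq, h2, one_pow]
  rw [← Complex.normSq_eq_norm_sq, Complex.normSq_apply]
  simp only [Complex.sub_re, Complex.one_re, Complex.sub_im, Complex.one_im]
  linarith

/-- The total dispersion of a group element over a set of frequencies. -/
noncomputable def dispersion (S : Finset (Fin d → ZMod N)) (x : Fin d → ZMod N) : ℝ :=
  ∑ ξ ∈ S, (1 - (pairing ξ x).re)

lemma dispersion_zero (S : Finset (Fin d → ZMod N)) : dispersion S 0 = 0 := by
  simp [dispersion, pairing_zero]

lemma dispersion_neg (S : Finset (Fin d → ZMod N)) (x : Fin d → ZMod N) :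
    dispersion S (-x) = dispersion S x := by
  simp [dispersion, pairing_neg]

lemma mul_dispersion_add_le (S : Finset (Fin d → ZMod N)) (x y : Fin d → ZMod N) (i : ℕ) :
    i * dispersion S (x + y) ≤ (i + 1) * (dispersion S x + i * dispersion S y) := by
  rw [dispersion, dispersion, dispersion, Finset.mul_sum, Finset.mul_sum, ← Finset.sum_add_distrib,
    Finset.mul_sum]
  refine Finset.sum_le_sum fun ξ _ => ?_
  have h1 := norm_one_sub_pairing_sq ξ (x + y)
  have h2 := norm_one_sub_pairing_sq ξ x
  have h3 := norm_one_sub_pairing_sq ξ y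
  have h4 : ‖1 - pairing ξ (x + y)‖ ≤ ‖1 - pairing ξ x‖ + ‖1 - pairing ξ y‖ := by
    have : 1 - pairing ξ (x + y) = (1 - pairing ξ x) + pairing ξ x * (1 - pairing ξ y) := by
      rw [pairing_add]
      ring
    rw [this]
    refine (norm_add_le _ _).trans ?_
    rw [norm_mul, norm_pairing, one_mul]
  have h5 : ‖1 - pairing ξ (x + y)‖ ^ 2 ≤ (‖1 - pairing ξ x‖ + ‖1 - pairing ξ y‖) ^ 2 :=
    pow_le_pow_left₀ (norm_nonneg _) h4 2
  rw [show 1 - (pairing ξ (x + y)).re = ‖1 - pairing ξ (x + y)‖ ^ 2 / 2 by linarith,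
    show 1 - (pairing ξ x).re = ‖1 - pairing ξ x‖ ^ 2 / 2 by linarith,
    show 1 - (pairing ξ y).re = ‖1 - pairing ξ y‖ ^ 2 / 2 by linarith]
  have h6 := mul_le_mul_of_nonneg_left h5 (Nat.cast_nonneg (α := ℝ) i)
  nlinarith [sq_nonneg (‖1 - pairing ξ x‖ - i * ‖1 - pairing ξ y‖)]

lemma dispersion_le_of_mem_kfold (S : Finset (Fin d → ZMod N)) (X : Finset (Fin d → ℤ)) {τ : ℝ}
    (hτ : ∀ x ∈ X, dispersion S (redMod d N x) ≤ τ) (k : ℕ) {x : Fin d → ℤ} (hx : x ∈ kfold X k) :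
    dispersion S (redMod d N x) ≤ k ^ 2 * τ := by
  induction k generalizing x with
  | zero =>
    have : x = 0 := by simpa [kfold] using hx
    simp [this, dispersion_zero]
  | succ k ih =>
    obtain ⟨y, hy, z, hz, rfl⟩ := Finset.mem_add.1 hx
    rcases k.eq_zero_or_pos with rfl | hk
    · have : y = 0 := by simpa [kfold] using hy
      simpa [this] using hτ z hz
    · have hkR : (0 : ℝ) < k := by exact_mod_cast hk
      have h1 := mul_dispersion_add_le S (redMod d N y) (redMod d N z) k
      rw [map_add]
      refine le_of_mul_le_mul_left (h1.trans ?_) hkR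
      have h2 := mul_le_mul_of_nonneg_left (hτ z hz) hkR.le
      have h3 := mul_le_mul_of_nonneg_left (add_le_add (ih hy) h2)
        (by positivity : (0 : ℝ) ≤ k + 1)
      refine h3.trans (le_of_eq ?_)
      push_cast
      ring

lemma card_kfold_mul_card_le (S : Finset (Fin d → ZMod N)) (X : Finset (Fin d → ℤ)) {τ : ℝ}
    (hτ : ∀ x ∈ X, dispersion S (redMod d N x) ≤ τ) {k : ℕ} (hk : k ^ 2 * τ ≤ S.card / 2)
    (hinj : ∀ x ∈ kfold X k, ∀ i, 2 * |x i| < N) :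
    ((kfold X k).card : ℝ) * S.card ≤ 4 * Fintype.card (Fin d → ZMod N) := by
  classical
  rw [← Finset.card_image_of_injOn (s := kfold X k) (f := redMod d N)
    fun x hx y hy h => redMod_injOn (hinj x hx) (hinj y hy) h]
  refine card_mul_card_le S _ fun z hz => ?_
  obtain ⟨x, hx, rfl⟩ := Finset.mem_image.1 hz
  have h1 := (dispersion_le_of_mem_kfold S X hτ k hx).trans hk
  rw [dispersion, Finset.sum_sub_distrib, Finset.sum_const, nsmul_eq_mul, mul_one] at h1
  have h2 := Complex.re_le_norm (∑ a ∈ S, pairing a (redMod d N x))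
  rw [Complex.re_sum] at h2
  linarith

end Dispersion

/-- A concentrated symmetric walk has most of its steps in a symmetric set with slowly growing
iterated sumsets. -/
theorem exists_slow_growth_of_walk {d n m : ℕ} (hn : 0 < n) (hm : 0 < m) (A : Fin n → Fin d → ℤ)
    (σ : Equiv.Perm (Fin n)) (hσ : ∀ i, A (σ i) = -A i) {ε ρ : ℝ} (hε : 0 < ε)
    (hρ : 0 < ρ) (a : Fin d → ℤ)
    (ha : ρ * (n : ℝ) ^ m ≤
      ((Finset.univ.filter fun f : Fin m → Fin n => ∑ j, A (f j) = a).card : ℝ)) :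
    ∃ l : ℕ, ρ * Real.exp (l / 2) ≤ 4 ∧ ∃ X : Finset (Fin d → ℤ), (∀ x ∈ X, -x ∈ X) ∧ 0 ∈ X ∧
      ((Finset.univ.filter fun i => A i ∉ X).card : ℝ) ≤ ε * n ∧
      ∀ k : ℕ, k ≤ m → 8 * (l + 1) * (k : ℝ) ^ 2 ≤ ε * m →
        (kfold X k).card * (ρ * Real.exp (l / 2)) ≤ 16 := by
  classical
  set X₀ : Finset (Fin d → ℤ) := insert 0 (Finset.univ.image A) with hX₀
  obtain ⟨N, hNodd, hN⟩ : ∃ N : ℕ, Odd N ∧ ∀ x ∈ kfold X₀ m, ∀ i, 2 * |x i| < N := by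
    refine ⟨2 * (∑ x ∈ kfold X₀ m, ∑ i, (x i).natAbs) + 1, ⟨_, rfl⟩, fun x hx i => ?_⟩
    have h1 : (x i).natAbs ≤ ∑ i, (x i).natAbs :=
      Finset.single_le_sum (f := fun i => (x i).natAbs) (fun _ _ => Nat.zero_le _)
        (Finset.mem_univ i)
    have h2 : ∑ i, (x i).natAbs ≤ ∑ x ∈ kfold X₀ m, ∑ i, (x i).natAbs :=
      Finset.single_le_sum (f := fun x : Fin d → ℤ => ∑ i, (x i).natAbs)
        (fun _ _ => Nat.zero_le _) hx
    rw [Int.abs_eq_natAbs]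
    norm_cast
    omega
  have : NeZero N := ⟨hNodd.pos.ne'⟩
  have hnR : (0 : ℝ) < n := by exact_mod_cast hn
  have hmR : (0 : ℝ) < m := by exact_mod_cast hm
  have hG : (0 : ℝ) < Fintype.card (Fin d → ZMod N) := by exact_mod_cast Fintype.card_pos
  obtain ⟨l, hl⟩ := exists_level hn hNodd (fun i => redMod d N (A i)) σ
    (fun i => by rw [hσ, map_neg]) (redMod d N a) (m := m) hρ (ha.trans (by
      norm_cast
      refine Finset.card_le_card fun f hf => ?_
      rw [Finset.mem_filter] at hf ⊢
      exact ⟨hf.1, by rw [← map_sum, hf.2]⟩))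
  set S := Finset.univ.filter fun ξ : Fin d → ZMod N =>
    m * (∑ i, (1 - (pairing ξ (redMod d N (A i))).re)) / (4 * n) ≤ l + 1 with hS
  have hSpos : (0 : ℝ) < S.card := by
    have : 0 < ρ * Fintype.card (Fin d → ZMod N) * Real.exp (l / 2) := by positivity
    linarith
  have hScard : (S.card : ℝ) ≤ Fintype.card (Fin d → ZMod N) := by
    exact_mod_cast Finset.card_le_univ S
  have hlog : ρ * Real.exp (l / 2) ≤ 4 := by
    refine le_of_mul_le_mul_right (a := (Fintype.card (Fin d → ZMod N) : ℝ)) ?_ hG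
    linarith
  obtain ⟨τ, hτ⟩ : ∃ τ, τ = 4 * (l + 1) * S.card / (m * ε) := ⟨_, rfl⟩
  have hτpos : 0 < τ := by rw [hτ]; positivity
  have hsum : ∑ i, dispersion S (redMod d N (A i)) ≤ τ * (ε * n) := by
    have h1 : ∑ i, dispersion S (redMod d N (A i)) =
        ∑ ξ ∈ S, ∑ i, (1 - (pairing ξ (redMod d N (A i))).re) := Finset.sum_comm
    rw [h1]
    have h2 : ∀ ξ ∈ S, ∑ i, (1 - (pairing ξ (redMod d N (A i))).re) ≤ (l + 1) * (4 * n) / m := by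
      intro ξ hξ
      have := (Finset.mem_filter.1 hξ).2
      rw [div_le_iff₀ (by positivity)] at this
      rw [le_div_iff₀ hmR]
      linarith
    refine (Finset.sum_le_card_nsmul _ _ _ h2).trans (le_of_eq ?_)
    rw [nsmul_eq_mul, hτ]
    field_simp
  have hdisp0 : ∀ x : Fin d → ZMod N, 0 ≤ dispersion S x := fun x =>
    Finset.sum_nonneg fun ξ _ => sub_nonneg.2 (re_pairing_le_one _ _)
  refine ⟨l, hlog, X₀.filter fun x => dispersion S (redMod d N x) ≤ τ, ?_, ?_, ?_, ?_⟩
  · intro x hx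
    rw [Finset.mem_filter] at hx ⊢
    refine ⟨?_, by rw [map_neg, dispersion_neg]; exact hx.2⟩
    rcases Finset.mem_insert.1 hx.1 with rfl | h
    · rw [neg_zero]
      exact Finset.mem_insert_self _ _
    · obtain ⟨i, -, rfl⟩ := Finset.mem_image.1 h
      rw [← hσ]
      exact Finset.mem_insert_of_mem (Finset.mem_image_of_mem A (Finset.mem_univ _))
  · rw [Finset.mem_filter, map_zero, dispersion_zero]
    exact ⟨Finset.mem_insert_self _ _, hτpos.le⟩
  · refine le_of_mul_le_mul_left (a := τ) (le_trans ?_ hsum) hτpos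
    set Y := Finset.univ.filter fun i => A i ∉ X₀.filter fun x => dispersion S (redMod d N x) ≤ τ
    have h1 : ∀ i ∈ Y, τ ≤ dispersion S (redMod d N (A i)) := by
      intro i hi
      have h2 := (Finset.mem_filter.1 hi).2
      rw [Finset.mem_filter] at h2
      by_contra! h3
      exact h2 ⟨Finset.mem_insert_of_mem (Finset.mem_image_of_mem A (Finset.mem_univ _)), h3.le⟩
    have h2 := Finset.card_nsmul_le_sum Y _ _ h1
    rw [nsmul_eq_mul, mul_comm] at h2
    exact h2.trans (Finset.sum_le_univ_sum_of_nonneg fun i => hdisp0 _)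
  · intro k hkm hk
    have hmono : ∀ j, kfold (X₀.filter fun x => dispersion S (redMod d N x) ≤ τ) j ⊆ kfold X₀ j := by
      intro j
      induction j with
      | zero => exact subset_rfl
      | succ j ih => exact Finset.add_subset_add ih (Finset.filter_subset _ _)
    have h1 := card_kfold_mul_card_le S (X₀.filter fun x => dispersion S (redMod d N x) ≤ τ)
      (fun x hx => (Finset.mem_filter.1 hx).2) (k := k) (by
        rw [hτ, mul_div_assoc', div_le_div_iff₀ (by positivity) (by norm_num)]
        nlinarith) fun x hx =>
          hN x (kfold_mono (Finset.mem_insert_self _ _) hkm (hmono k hx))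
    refine le_of_mul_le_mul_right (a := (Fintype.card (Fin d → ZMod N) : ℝ)) ?_ hG
    set Y := kfold (X₀.filter fun x => dispersion S (redMod d N x) ≤ τ) k
    have h2 := mul_le_mul_of_nonneg_left hl (Nat.cast_nonneg (α := ℝ) Y.card)
    linarith

open scoped Pointwise

/-- Finitely many real numbers generate a free abelian group of finite rank. -/
lemma exists_integer_coordinates {n : ℕ} (A : Fin n → ℝ) :
    ∃ (d : ℕ) (Ψ : (Fin d → ℤ) →+ ℝ) (A' : Fin n → Fin d → ℤ),
      Function.Injective Ψ ∧ ∀ i, Ψ (A' i) = A i := by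
  set H := Submodule.span ℤ (Set.range A) with hH
  have : Module.Finite ℤ H := Module.Finite.span_of_finite ℤ (Set.finite_range A)
  have : Module.Free ℤ H := Module.free_of_finite_type_torsion_free'
  let b := Module.finBasis ℤ H
  refine ⟨_, (H.subtype.comp b.equivFun.symm.toLinearMap).toAddMonoidHom,
    fun i => b.equivFun ⟨A i, Submodule.subset_span ⟨i, rfl⟩⟩, ?_, fun i => ?_⟩
  · exact H.injective_subtype.comp b.equivFun.symm.injective
  · change (H.subtype (b.equivFun.symm (b.equivFun _)) : ℝ) = A i
    rw [LinearEquiv.symm_apply_apply]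
    rfl

/-- The image of a proper symmetric progression under an injective homomorphism. -/
lemma exists_gapData {Γ J : Type} [AddCommGroup Γ] [Fintype J] (Ψ : Γ →+ ℝ)
    (hΨ : Function.Injective Ψ) (w : J → Γ) (N : J → ℕ)
    (hprop : ∀ c : J → ℤ, (∀ i, |c i| ≤ 2 * N i) → ∑ i, c i • w i = 0 → c = 0) :
    ∃ Q : GAPData ℝ (Fintype.card J), Q.IsSymmetric ∧ Q.IsProper ∧
      (∀ x : Γ, (∃ c : J → ℤ, (∀ i, |c i| ≤ N i) ∧ x = ∑ i, c i • w i) → Ψ x ∈ Q.toSet) ∧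
      (Q.toSet.ncard : ℝ) ≤ ∏ i, (2 * N i + 1 : ℝ) := by
  classical
  let e := Fintype.equivFin J
  have hsum : ∀ c : Fin (Fintype.card J) → ℤ,
      ∑ i, c i • Ψ (w (e.symm i)) = Ψ (∑ i, c (e i) • w i) := by
    intro c
    rw [map_sum, ← Equiv.sum_comp e]
    refine Finset.sum_congr rfl fun i _ => ?_
    rw [map_zsmul, Equiv.symm_apply_apply]
  refine ⟨⟨0, fun i => Ψ (w (e.symm i)), fun i => -(N (e.symm i)), fun i => N (e.symm i),
    fun i => by omega⟩, ⟨rfl, fun i => rfl⟩, ?_, ?_, ?_⟩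
  · intro c c' hc hc' h
    dsimp only at hc hc' h
    rw [hsum, hsum, add_right_inj] at h
    have h1 := hprop (fun i => c (e i) - c' (e i)) (fun i => by
      have h2 := hc (e i)
      have h3 := hc' (e i)
      rw [Equiv.symm_apply_apply] at h2 h3
      rw [abs_le]
      constructor <;> linarith [h2.1, h2.2, h3.1, h3.2]) (by
      simp_rw [sub_smul]
      rw [Finset.sum_sub_distrib, sub_eq_zero]
      exact hΨ h)
    funext i
    have h2 := congrFun h1 (e.symm i)
    simpa [sub_eq_zero] using h2
  · rintro x ⟨c, hc, rfl⟩
    refine ⟨fun i => c (e.symm i), fun i => abs_le.1 (hc _), ?_⟩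
    dsimp only
    rw [hsum, zero_add]
    simp
  · set B := Fintype.piFinset fun i : Fin (Fintype.card J) =>
      Finset.Icc (-(N (e.symm i) : ℤ)) (N (e.symm i)) with hB
    have hcard : (B.card : ℝ) = ∏ i, (2 * N i + 1 : ℝ) := by
      rw [hB, Fintype.card_piFinset, ← Equiv.prod_comp e.symm]
      push_cast
      refine Finset.prod_congr rfl fun i _ => ?_
      rw [Int.card_Icc, show ((N (e.symm i) : ℤ) + 1 - -(N (e.symm i) : ℤ)).toNat =
        2 * N (e.symm i) + 1 by omega]
      push_cast
      rfl
    rw [← hcard]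
    have h1 : GAPData.toSet ⟨0, fun i => Ψ (w (e.symm i)), fun i => -(N (e.symm i) : ℤ),
        fun i => N (e.symm i), fun i => by omega⟩ ⊆
        ((B.image fun c => ∑ i, c i • Ψ (w (e.symm i)) : Finset ℝ) : Set ℝ) := by
      rintro _ ⟨c, hc, rfl⟩
      refine Finset.mem_coe.2 (Finset.mem_image.2 ⟨c, ?_, by simp⟩)
      rw [hB, Fintype.mem_piFinset]
      exact fun i => Finset.mem_Icc.2 (hc i)
    have h2 := (Set.ncard_le_ncard h1 (Finset.finite_toSet _)).trans
      ((Set.ncard_coe_finset _).trans_le Finset.card_image_le)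
    exact_mod_cast h2

lemma exists_walk_of_rhoWalk_pos {n m : ℕ} {A : Fin n → ℝ} (hn : 0 < n) (h : 0 < rhoWalk n m A) :
    ∃ a, rhoWalk n m A / 2 * (n : ℝ) ^ m ≤
      ((Finset.univ.filter fun f : Fin m → Fin n => ∑ j, A (f j) = a).card : ℝ) := by
  obtain ⟨a, ha⟩ := exists_lt_of_lt_ciSup (half_lt_self h)
  have hnR : (0 : ℝ) < n := by exact_mod_cast hn
  refine ⟨a, ?_⟩
  rw [lt_div_iff₀ (by positivity)] at ha
  refine ha.le.trans (le_of_eq ?_)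
  rw [← Set.ncard_coe_finset]
  simp

lemma pos_of_rhoWalk_pos {n m : ℕ} {A : Fin n → ℝ} (hm : 0 < m) (h : 0 < rhoWalk n m A) :
    0 < n := by
  rcases n.eq_zero_or_pos with rfl | hn
  · rw [rhoWalk] at h
    simp [zero_pow hm.ne'] at h
  · exact hn

/-- Logarithmic terms are eventually dominated by the cube root. -/
lemma eventually_log_le {ε C : ℝ} (hε : 0 < ε) (B : ℝ) :
    ∀ᶠ x : ℝ in Filter.atTop,
      32 * (2 * Real.log 8 + 2 * C * Real.log x + 1) ≤ ε * x ^ (1 / 3 : ℝ) ∧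
        B ≤ x ^ (1 / 3 : ℝ) := by
  have htend := tendsto_rpow_atTop (show (0 : ℝ) < 1 / 3 by norm_num)
  have h1 : (fun x : ℝ => 32 * (2 * Real.log 8 + 2 * C * Real.log x + 1)) =o[Filter.atTop]
      fun x : ℝ => x ^ (1 / 3 : ℝ) := by
    have h2 := ((isLittleO_log_rpow_atTop (show (0 : ℝ) < 1 / 3 by norm_num)).const_mul_left
      (64 * C)).add (Asymptotics.isLittleO_const_left.2 (Or.inr
        (tendsto_norm_atTop_atTop.comp htend)) :
        (fun _ : ℝ => 32 * (2 * Real.log 8 + 1)) =o[Filter.atTop] fun x : ℝ => x ^ (1 / 3 : ℝ))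
    refine h2.congr_left fun x => ?_
    ring
  filter_upwards [h1.bound hε, htend.eventually_ge_atTop B, Filter.eventually_ge_atTop 0]
    with x hx hB hx0
  refine ⟨(le_abs_self _).trans (hx.trans_eq ?_), hB⟩
  rw [Real.norm_of_nonneg (by positivity)]

lemma sqrt_pow_le {l r r₀ : ℕ} (hr : r ≤ r₀) :
    √((l : ℝ) + 1) ^ r ≤ 2 ^ r₀ * r₀.factorial * Real.exp (1 / 2) * Real.exp (l / 2) := by
  have h1 : (1 : ℝ) ≤ l + 1 := by simp
  have h2 : √((l : ℝ) + 1) ≤ l + 1 := (Real.sqrt_le_sqrt (by nlinarith)).trans_eq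
    (Real.sqrt_sq (by positivity : (0 : ℝ) ≤ l + 1))
  have h3 := Real.pow_div_factorial_le_exp (((l : ℝ) + 1) / 2) (by positivity) r₀
  rw [div_le_iff₀ (by positivity), div_pow, div_le_iff₀ (by positivity), add_div, Real.exp_add]
    at h3
  calc √((l : ℝ) + 1) ^ r ≤ ((l : ℝ) + 1) ^ r := by gcongr
    _ ≤ ((l : ℝ) + 1) ^ r₀ := pow_le_pow_right₀ h1 hr
    _ ≤ _ := by linarith

/-- The scale up to which iterated sumsets grow slowly is a large power of the number of steps. -/
lemma exists_long_scale {ε C : ℝ} (hε : 0 < ε) (hε1 : ε ≤ 1) (k₀ : ℕ) :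
    ∃ m₀ : ℕ, 1 ≤ m₀ ∧ ∀ m l : ℕ, m₀ ≤ m → Real.exp (l / 2) ≤ 8 * (m : ℝ) ^ C →
      ∃ k : ℕ, k₀ ≤ k ∧ k ≤ m ∧ 8 * (l + 1) * (k : ℝ) ^ 2 ≤ ε * m ∧ (m : ℝ) ≤ k ^ 3 ∧
        √m ≤ k * √(32 / ε) * √((l : ℝ) + 1) := by
  obtain ⟨m₀, hm₀⟩ := Filter.eventually_atTop.1
    ((tendsto_natCast_atTop_atTop (R := ℝ)).eventually (eventually_log_le (C := C) hε (k₀ + 1)))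
  refine ⟨m₀ + 1, by omega, fun m l hm hl => ?_⟩
  obtain ⟨hlog, hk₀⟩ := hm₀ m (by omega)
  have hm1 : (1 : ℝ) ≤ m := by exact_mod_cast (by omega : 1 ≤ m)
  set t := (m : ℝ) ^ (1 / 3 : ℝ) with ht
  have ht0 : 0 < t := by positivity
  have ht3 : t ^ 3 = m := by
    rw [ht, ← Real.rpow_natCast, ← Real.rpow_mul (by positivity)]
    norm_num
  have hlle : 32 * ((l : ℝ) + 1) ≤ ε * t := by
    have h1 : (l : ℝ) / 2 ≤ Real.log 8 + C * Real.log m := by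
      rw [← Real.log_rpow (by positivity), ← Real.log_mul (by norm_num) (by positivity)]
      exact (Real.le_log_iff_exp_le (by positivity)).2 hl
    linarith
  set y := √(ε * m / (8 * (l + 1))) with hy
  have hysq : y ^ 2 * (8 * (l + 1)) = ε * m := by
    rw [hy, Real.sq_sqrt (by positivity)]
    field_simp
  have hyt : 2 * t ≤ y := by
    refine Real.le_sqrt_of_sq_le ?_
    rw [le_div_iff₀ (by positivity), ← ht3]
    nlinarith [mul_le_mul_of_nonneg_right hlle (sq_nonneg t)]
  have hkle : (⌊y⌋₊ : ℝ) ≤ y := Nat.floor_le (Real.sqrt_nonneg _)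
  have hlt := Nat.lt_floor_add_one y
  have hk0 : (0 : ℝ) ≤ k₀ := Nat.cast_nonneg _
  have hky : y ≤ 2 * ⌊y⌋₊ := by linarith
  have hkt : t ≤ ⌊y⌋₊ := by linarith
  have hl0 : (0 : ℝ) ≤ l := Nat.cast_nonneg _
  have hksq : (⌊y⌋₊ : ℝ) ^ 2 ≤ y ^ 2 := by gcongr
  have hk8 : 8 * (l + 1) * (⌊y⌋₊ : ℝ) ^ 2 ≤ ε * m := by
    rw [← hysq, mul_comm]
    gcongr
  refine ⟨⌊y⌋₊, ?_, ?_, hk8, ?_, ?_⟩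
  · have : (k₀ : ℝ) ≤ ⌊y⌋₊ := by linarith
    exact_mod_cast this
  · have h1 : (⌊y⌋₊ : ℝ) ≤ m := by
      have h2 : ε * m ≤ m := mul_le_of_le_one_left (by positivity) hε1
      nlinarith [mul_nonneg hl0 (sq_nonneg (⌊y⌋₊ : ℝ))]
    exact_mod_cast h1
  · rw [← ht3]
    gcongr
  · rw [mul_assoc, ← Real.sqrt_mul (by positivity)]
    refine Real.sqrt_le_iff.2 ⟨by positivity, ?_⟩
    rw [mul_pow, Real.sq_sqrt (by positivity)]
    have h1 : y ^ 2 ≤ 4 * (⌊y⌋₊ : ℝ) ^ 2 := by nlinarith [Real.sqrt_nonneg (ε * m / (8 * (l + 1)))]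
    have h2 : (m : ℝ) = y ^ 2 * (8 * (l + 1)) / ε := by
      rw [hysq]
      field_simp
    rw [h2, div_mul_eq_mul_div, mul_div_assoc', div_le_div_iff_of_pos_right hε]
    nlinarith [mul_le_mul_of_nonneg_right h1 (by positivity : (0 : ℝ) ≤ 8 * (l + 1))]

theorem stmt11 (ε C : ℝ) (hε0 : 0 < ε) (hε1 : ε < 1) (hC : 0 < C) :
    ∃ (r₀ : ℕ) (K : ℝ) (m₀ : ℕ), ∀ m : ℕ, m₀ ≤ m →
      ∀ (n : ℕ) (A : Fin n → ℝ),
        (∃ σ : Equiv.Perm (Fin n), ∀ i, A (σ i) = -A i) →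
        (m : ℝ) ^ (-C) ≤ rhoWalk n m A →
        ∀ n' : ℕ, ε * n ≤ (n' : ℝ) → n' ≤ n →
          ∃ (r : ℕ) (Q : GAPData ℝ r),
            r ≤ r₀ ∧ Q.IsSymmetric ∧ Q.IsProper ∧
            n - n' ≤ {i : Fin n | A i ∈ Q.toSet}.ncard ∧
            (Q.toSet.ncard : ℝ) ≤
              max 1 (K * (rhoWalk n m A)⁻¹ /
                ((m : ℝ) * (n' : ℝ) / (n : ℝ)) ^ ((r : ℝ) / 2)) := by
  obtain ⟨γ, hγ⟩ : ∃ γ : ℕ, γ = ⌈3 * C⌉₊ + 5 := ⟨_, rfl⟩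
  obtain ⟨r₀, K, k₀, hK, hgap⟩ := exists_gap_of_card_kfold_le (γ := γ) (by omega)
  obtain ⟨m₀, hm₀, hscale⟩ := exists_long_scale (C := C) hε0 hε1.le (k₀ + 2)
  refine ⟨r₀, 32 * K * √(32 / ε) ^ r₀ * (2 ^ r₀ * r₀.factorial * Real.exp (1 / 2)), m₀, ?_⟩
  rintro m hm n A ⟨σ, hσ⟩ hρ n' hn' hn'n
  have hm1 : 0 < m := by omega
  have hmR : (0 : ℝ) < m := by exact_mod_cast hm1
  set R := rhoWalk n m A with hR
  have hRpos : 0 < R := (Real.rpow_pos_of_pos hmR _).trans_le hρ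
  have hn : 0 < n := pos_of_rhoWalk_pos hm1 hRpos
  have hnR : (0 : ℝ) < n := by exact_mod_cast hn
  have hRm : R⁻¹ ≤ (m : ℝ) ^ C := by
    rw [Real.rpow_neg hmR.le] at hρ
    exact inv_le_of_inv_le₀ (by positivity) hρ
  obtain ⟨d, Ψ, A', hΨ, hA'⟩ := exists_integer_coordinates A
  obtain ⟨a, ha⟩ := exists_walk_of_rhoWalk_pos hn hRpos
  obtain ⟨a', ha'⟩ : ∃ a' : Fin d → ℤ, R / 2 * (n : ℝ) ^ m ≤
      ((Finset.univ.filter fun f : Fin m → Fin n => ∑ j, A' (f j) = a').card : ℝ) := by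
    have h1 : 0 < (Finset.univ.filter fun f : Fin m → Fin n => ∑ j, A (f j) = a).card := by
      have : 0 < R / 2 * (n : ℝ) ^ m := by positivity
      exact_mod_cast this.trans_le ha
    obtain ⟨f, hf⟩ := Finset.card_pos.1 h1
    refine ⟨∑ j, A' (f j), ha.trans ?_⟩
    norm_cast
    refine Finset.card_le_card fun g hg => ?_
    rw [Finset.mem_filter] at hf hg ⊢
    refine ⟨hg.1, hΨ ?_⟩
    rw [map_sum, map_sum]
    simp_rw [hA']
    rw [hf.2, hg.2]
  obtain ⟨l, hl, X, hXs, hX0, hXc, hX⟩ := exists_slow_growth_of_walk hn hm1 A' σ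
    (fun i => hΨ (by rw [hA', hσ, map_neg, hA'])) hε0 (half_pos hRpos) a' ha'
  have hexp : Real.exp (l / 2) ≤ 8 * (m : ℝ) ^ C := by
    have h1 : Real.exp (l / 2) ≤ 8 * R⁻¹ := by
      rw [← div_eq_mul_inv, le_div_iff₀ hRpos]
      linarith
    linarith
  obtain ⟨k, hk₀, hkm, hk8, hk3, hkm'⟩ := hscale m l hm hexp
  have hkX := hX k hkm hk8
  have hkX' : ((kfold X k).card : ℝ) * Real.exp (l / 2) ≤ 32 * R⁻¹ := by
    rw [← div_eq_mul_inv, le_div_iff₀ hRpos]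
    linarith
  have hk2 : (2 : ℝ) ≤ k := by exact_mod_cast (by omega : 2 ≤ k)
  have hgrow : ((kfold X k).card : ℝ) ≤ (k : ℝ) ^ γ := by
    have h1 : (1 : ℝ) ≤ Real.exp (l / 2) := Real.one_le_exp (by positivity)
    have h2 : (m : ℝ) ^ C ≤ (k : ℝ) ^ ⌈3 * C⌉₊ := by
      calc (m : ℝ) ^ C ≤ ((k : ℝ) ^ 3) ^ C := by gcongr
        _ = (k : ℝ) ^ (3 * C) := by
          rw [← Real.rpow_natCast, ← Real.rpow_mul (by positivity)]
          norm_num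
        _ ≤ (k : ℝ) ^ (⌈3 * C⌉₊ : ℝ) :=
          Real.rpow_le_rpow_of_exponent_le (by linarith) (Nat.le_ceil _)
        _ = _ := Real.rpow_natCast _ _
    have h3 : (2 : ℝ) ^ 5 ≤ (k : ℝ) ^ 5 := by gcongr
    have h4 : (0 : ℝ) ≤ (k : ℝ) ^ ⌈3 * C⌉₊ := by positivity
    rw [hγ, pow_add]
    nlinarith [Nat.cast_nonneg (α := ℝ) (kfold X k).card]
  obtain ⟨J, hJ, w, N, hJr, hXw, hprop, hprod⟩ := hgap k (by omega) X hXs hX0 hgrow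
  obtain ⟨Q, hQs, hQp, hQmem, hQc⟩ := exists_gapData Ψ hΨ w N hprop
  refine ⟨_, Q, hJr, hQs, hQp, ?_, ?_⟩
  · have h1 : (Finset.univ.filter fun i => A' i ∉ X).card ≤ n' := by
      exact_mod_cast hXc.trans hn'
    have h2 := Finset.card_filter_add_card_filter_not (s := Finset.univ) fun i => A' i ∈ X
    rw [Finset.card_univ, Fintype.card_fin] at h2
    have h3 : (Finset.univ.filter fun i => A' i ∈ X).card ≤ {i : Fin n | A i ∈ Q.toSet}.ncard := by
      rw [← Set.ncard_coe_finset]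
      refine Set.ncard_le_ncard (fun i hi => ?_) (Set.toFinite _)
      rw [Finset.mem_coe, Finset.mem_filter] at hi
      rw [Set.mem_ofPred_eq, ← hA']
      exact hQmem _ (hXw _ hi.2)
    omega
  · refine hQc.trans (le_max_of_le_right ?_)
    have hn'R : (0 : ℝ) < n' := (by positivity : 0 < ε * n).trans_le hn'
    have hden : ((m : ℝ) * n' / n) ^ ((Fintype.card J : ℝ) / 2) ≤ √m ^ Fintype.card J := by
      rw [← Real.rpow_natCast, ← Real.rpow_div_two_eq_sqrt _ hmR.le]
      refine Real.rpow_le_rpow (by positivity) ?_ (by positivity)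
      rw [div_le_iff₀ hnR]
      gcongr
    have hbase : 1 ≤ √(32 / ε) := by
      rw [Real.one_le_sqrt, le_div_iff₀ hε0]
      linarith
    rw [le_div_iff₀ (by positivity)]
    set P := ∏ i, (2 * N i + 1 : ℝ) with hP
    have hP0 : 0 ≤ P := by positivity
    calc P * ((m : ℝ) * n' / n) ^ ((Fintype.card J : ℝ) / 2)
        ≤ P * (k * √(32 / ε) * √((l : ℝ) + 1)) ^ Fintype.card J := by
          refine mul_le_mul_of_nonneg_left (hden.trans ?_) hP0
          gcongr
      _ = (P * (k : ℝ) ^ Fintype.card J) *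
            (√(32 / ε) ^ Fintype.card J * √((l : ℝ) + 1) ^ Fintype.card J) := by ring
      _ ≤ (K * (kfold X k).card) * (√(32 / ε) ^ r₀ *
            (2 ^ r₀ * r₀.factorial * Real.exp (1 / 2) * Real.exp (l / 2))) := by
          refine mul_le_mul hprod (mul_le_mul (pow_le_pow_right₀ hbase hJr) (sqrt_pow_le hJr)
            (by positivity) (by positivity)) (by positivity) (by positivity)
      _ = K * (√(32 / ε) ^ r₀ * (2 ^ r₀ * r₀.factorial * Real.exp (1 / 2))) *
            ((kfold X k).card * Real.exp (l / 2)) := by ring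
      _ ≤ K * (√(32 / ε) ^ r₀ * (2 ^ r₀ * r₀.factorial * Real.exp (1 / 2))) * (32 * R⁻¹) :=
          mul_le_mul_of_nonneg_left hkX' (by positivity)
      _ = _ := by ring
end
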